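/- Let H be a bounded hyperbolic component of S_p of Type D, i.e., for (c,a) ∈ H the map f_{c,a} has a second attracting periodic orbit attracting −c; let z_{c,a} ∈ U_{c,a}(−c) be the corresponding attracting periodic point, of period q. Then the multiplier map ρ: H → 𝔻, (c,a) ↦ (f_{c,a}^q)'(z_{c,a}), is a conformal isomorphism onto the unit disk, and it extends to a homeomorphism from the closure of H onto the closed unit disk; in particular ∂H is a Jordan curve. -/

import Mathlib

open Set Function Filter Topology Metric

noncomputable section

/-- The cubic polynomial `f_{c,a}(z) = z^3 - 3c^2 z + a`, with critical points `c` and `-c`. -/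
def cubic (c a : ℂ) : ℂ → ℂ := fun z => z ^ 3 - 3 * c ^ 2 * z + a

/-- The critically periodic curve `S_p`: parameters for which the critical point `c`
has exact period `p`. -/
def Sp (p : ℕ) : Set (ℂ × ℂ) :=
  {w | (cubic w.1 w.2)^[p] w.1 = w.1 ∧ ∀ k, 1 ≤ k → k < p → (cubic w.1 w.2)^[k] w.1 ≠ w.1}

/-- `S_p^*`: the curve `S_p` minus the finitely many parameters for which `-c` meets
the orbit of `c`. -/
def SpStar (p : ℕ) : Set (ℂ × ℂ) :=
  {w ∈ Sp p | ∀ k, 0 < k → k ≤ p → (cubic w.1 w.2)^[k] w.1 ≠ -w.1}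

/-- The filled Julia set of a polynomial: points with bounded forward orbit. -/
def filledJulia (f : ℂ → ℂ) : Set ℂ :=
  {z | Bornology.IsBounded (range fun n => f^[n] z)}

/-- The Julia set of a polynomial: the boundary of the filled Julia set. -/
def juliaSet (f : ℂ → ℂ) : Set ℂ := frontier (filledJulia f)

/-- The Fatou set of a polynomial. -/
def fatouSet (f : ℂ → ℂ) : Set ℂ := (juliaSet f)ᶜ

/-- The Fatou component containing a point `z`. -/
def fatouComponent (f : ℂ → ℂ) (z : ℂ) : Set ℂ := connectedComponentIn (fatouSet f) z

/-- The orbit of `z` converges to an attracting periodic cycle of `f`. -/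
def AttractedToAttractingCycle (f : ℂ → ℂ) (z : ℂ) : Prop :=
  ∃ n : ℕ, 0 < n ∧ ∃ w : ℂ, f^[n] w = w ∧ ‖deriv (f^[n]) w‖ < 1 ∧
    Tendsto (fun k => f^[n * k] z) atTop (𝓝 w)

/-- A parameter `(c,a)` is hyperbolic if both critical points `c`, `-c` of `f_{c,a}`
are attracted to attracting cycles. -/
def IsHyperbolicParam (w : ℂ × ℂ) : Prop :=
  AttractedToAttractingCycle (cubic w.1 w.2) w.1 ∧
    AttractedToAttractingCycle (cubic w.1 w.2) (-w.1)

/-- The hyperbolic locus on `S_p`. -/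
def hypLocus (p : ℕ) : Set (ℂ × ℂ) := {w ∈ Sp p | IsHyperbolicParam w}

/-- A hyperbolic component on `S_p`: a connected component of the hyperbolic locus. -/
def IsHyperbolicComponent (p : ℕ) (H : Set (ℂ × ℂ)) : Prop :=
  ∃ w ∈ hypLocus p, H = connectedComponentIn (hypLocus p) w

/-- A Jordan curve: a homeomorphic image of the unit circle. -/
def IsJordanCurve {X : Type*} [TopologicalSpace X] (Γ : Set X) : Prop :=
  ∃ φ : ↥(sphere (0 : ℂ) 1) → X, Continuous φ ∧ Injective φ ∧ range φ = Γ

/-- A Jordan disk in `ℂ`: an open connected set bounded by a Jordan curve. -/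
def IsJordanDisk (S : Set ℂ) : Prop :=
  IsOpen S ∧ IsConnected S ∧ IsJordanCurve (frontier S)

/-- `A_{c,a}`: the union of the `p` Fatou components containing the superattracting
orbit of `c`. -/
def critBasin (p : ℕ) (w : ℂ × ℂ) : Set ℂ :=
  ⋃ k ∈ Finset.range p, fatouComponent (cubic w.1 w.2) ((cubic w.1 w.2)^[k] w.1)

/-- The connectedness locus `C(S_p)`. -/
def connLocus (p : ℕ) : Set (ℂ × ℂ) :=
  {w ∈ Sp p | IsConnected (juliaSet (cubic w.1 w.2))}

/-- `C₀(S_p)`: parameters in `C(S_p)` whose free critical orbit never enters `A_{c,a}`. -/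
def connLocus0 (p : ℕ) : Set (ℂ × ℂ) :=
  {w ∈ connLocus p | ∀ k : ℕ, (cubic w.1 w.2)^[k] (-w.1) ∉ critBasin p w}

/-- A Böttcher coordinate of `g` at a superattracting fixed point `z₀`, defined on an
open set `U`, conjugating `g` to `z ↦ z^d`, injective near `z₀`. -/
structure IsBottcherAt (g : ℂ → ℂ) (z₀ : ℂ) (B : ℂ → ℂ) (U : Set ℂ) (d : ℕ) : Prop where
  open_dom : IsOpen U
  mem : z₀ ∈ U
  mapsTo : MapsTo g U U
  analytic : AnalyticOnNhd ℂ B U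
  zero : B z₀ = 0
  two_le : 2 ≤ d
  conj : ∀ z ∈ U, B (g z) = B z ^ d
  inj : ∃ V ⊆ U, IsOpen V ∧ z₀ ∈ V ∧ InjOn B V

/-- A Böttcher coordinate of `g` defined on a whole (super)attracting Fatou
component `U`, a conformal isomorphism onto the unit disk conjugating `g` to `z ↦ z^d`. -/
structure IsFullBottcher (g : ℂ → ℂ) (z₀ : ℂ) (U : Set ℂ) (B : ℂ → ℂ) (d : ℕ) : Prop where
  two_le : 2 ≤ d
  analytic : AnalyticOnNhd ℂ B U
  bij : BijOn B U (ball (0 : ℂ) 1)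
  zero : B z₀ = 0
  conj : ∀ z ∈ U, B (g z) = B z ^ d

/-- The basin of infinity of a polynomial. -/
def basinInf (f : ℂ → ℂ) : Set ℂ := {z | Tendsto (fun n => ‖f^[n] z‖) atTop atTop}

/-- A Böttcher coordinate of a cubic polynomial near infinity, tangent to the identity. -/
structure IsBottcherInf (f : ℂ → ℂ) (B : ℂ → ℂ) (R₀ : ℝ) : Prop where
  one_le : 1 ≤ R₀
  analytic : AnalyticOnNhd ℂ B {z : ℂ | R₀ < ‖z‖}
  inj : InjOn B {z : ℂ | R₀ < ‖z‖}
  mapsTo : ∀ z : ℂ, R₀ < ‖z‖ → R₀ < ‖f z‖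
  conj : ∀ z : ℂ, R₀ < ‖z‖ → B (f z) = B z ^ 3
  asymp : Tendsto (fun z => B z / z) (Bornology.cobounded ℂ) (𝓝 1)

/-- A Böttcher coordinate of a cubic polynomial defined on the whole basin of infinity
(available when the Julia set is connected). -/
structure IsFullBottcherInf (f : ℂ → ℂ) (B : ℂ → ℂ) : Prop where
  analytic : AnalyticOnNhd ℂ B (basinInf f)
  inj : InjOn B (basinInf f)
  conj : ∀ z ∈ basinInf f, B (f z) = B z ^ 3
  asymp : Tendsto (fun z => B z / z) (Bornology.cobounded ℂ) (𝓝 1)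

/-- The external ray of angle `θ` (for a cubic polynomial), described through a Böttcher
coordinate `B` near infinity: points whose large iterates lie on the straight part of the
ray of angle `3^n θ`. -/
def extRaySet (f B : ℂ → ℂ) (R₀ : ℝ) (θ : ℝ) : Set ℂ :=
  {z | ∃ N : ℕ, ∀ n, N ≤ n → R₀ < ‖f^[n] z‖ ∧
    ∃ r : ℝ, 1 < r ∧
      B (f^[n] z) = (r : ℂ) * Complex.exp (2 * Real.pi * Complex.I * ((3 : ℂ) ^ n * (θ : ℂ)))}

/-- `R` is the external ray of angle `θ` of `f`. -/
def IsExternalRaySet (f : ℂ → ℂ) (θ : ℝ) (R : Set ℂ) : Prop :=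
  ∃ B R₀, IsBottcherInf f B R₀ ∧ R = extRaySet f B R₀ θ

/-- The internal ray of angle `θ` (w.r.t. a Böttcher coordinate `B` of `f^p` at the
superattracting periodic point `z₀`) in the Fatou component of `z₀`. -/
def intRaySet (p : ℕ) (f : ℂ → ℂ) (z₀ : ℂ) (B : ℂ → ℂ) (U : Set ℂ) (θ : ℝ) : Set ℂ :=
  {z ∈ fatouComponent f z₀ | ∃ N : ℕ, ∀ n, N ≤ n → f^[p * n] z ∈ U ∧
    ∃ r : ℝ, 0 ≤ r ∧ r < 1 ∧
      B (f^[p * n] z) = (r : ℂ) * Complex.exp (2 * Real.pi * Complex.I * ((2 : ℂ) ^ n * (θ : ℂ)))}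

/-- `R` is the internal ray of angle `θ` of `f` in the periodic Fatou component of `z₀`. -/
def IsInternalRaySet (p : ℕ) (f : ℂ → ℂ) (z₀ : ℂ) (θ : ℝ) (R : Set ℂ) : Prop :=
  ∃ B U d, IsBottcherAt (f^[p]) z₀ B U d ∧ R = intRaySet p f z₀ B U θ

/-- A ray `R` (as a set) lands at the point `q`. -/
def LandsAt (R : Set ℂ) (q : ℂ) : Prop := IsConnected R ∧ closure R \ R = {q}

/-- `q` is a repelling periodic point of `f`. -/
def IsRepellingPeriodicPt (f : ℂ → ℂ) (q : ℂ) : Prop :=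
  ∃ n : ℕ, 0 < n ∧ f^[n] q = q ∧ 1 < ‖deriv (f^[n]) q‖

/-- `q` is a parabolic periodic point of `f`: its multiplier is a root of unity. -/
def IsParabolicPeriodicPt (f : ℂ → ℂ) (q : ℂ) : Prop :=
  ∃ n : ℕ, 0 < n ∧ f^[n] q = q ∧ ∃ m : ℕ, 0 < m ∧ (deriv (f^[n]) q) ^ m = 1

/-- `f` has a parabolic periodic point. -/
def HasParabolicPoint (f : ℂ → ℂ) : Prop := ∃ q, IsParabolicPeriodicPt f q

/-- The Green function of the basin of infinity. -/
def greenInf (f : ℂ → ℂ) (z : ℂ) : ℝ :=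
  limUnder atTop fun n : ℕ => Real.log ‖f^[n] z‖ / 3 ^ n

/-- The Green function of a periodic Fatou component containing the orbit point `w₀`. -/
def greenComp (p : ℕ) (f : ℂ → ℂ) (w₀ z : ℂ) : ℝ :=
  limUnder atTop fun n : ℕ => Real.log ‖f^[p * n] z - w₀‖ / 2 ^ n

/-- The truncated plane `X_{c,a}`: the plane minus the equipotential trap near infinity
and near the superattracting cycle. -/
def Xset (p : ℕ) (c a : ℂ) : Set ℂ :=
  {z | ¬ (z ∈ basinInf (cubic c a) ∧ 1 ≤ greenInf (cubic c a) z) ∧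
    ∀ k, k < p → ¬ (z ∈ fatouComponent (cubic c a) ((cubic c a)^[k] c) ∧
      greenComp p (cubic c a) ((cubic c a)^[k] c) z ≤ -1)}

/-- `G = γ_{c,a}(θ)`: the forward invariant graph generated by the closed internal ray of
angle `θ` in `U_{c,a}(c)` together with the closures of all external rays landing at its
landing point. -/
def IsGammaGraph (p : ℕ) (c a : ℂ) (θ : ℝ) (G : Set ℂ) : Prop :=
  ∃ (Rint : Set ℂ) (ζ : ℂ), IsInternalRaySet p (cubic c a) c θ Rint ∧
    closure Rint \ Rint = {ζ} ∧
    G = ⋃ k : ℕ, (cubic c a)^[k] ''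
      (closure Rint ∪ ⋃₀ {S | ∃ t R, IsExternalRaySet (cubic c a) t R ∧
        closure R \ R = {ζ} ∧ S = closure R})

/-- A puzzle for `f` (with periodic critical point of period `p`) relative to the
truncated plane `X`. -/
structure IsPuzzle (p : ℕ) (f : ℂ → ℂ) (X Γ : Set ℂ) : Prop where
  subset_closure : Γ ⊆ closure X
  boundary_subset : frontier X ⊆ Γ
  compact : IsCompact Γ
  forward_inv : f '' (Γ ∩ f^[p] ⁻¹' X) ⊆ Γ
  crit_avoid : ∀ c' : ℂ, deriv f c' = 0 → ∀ k : ℕ, f^[k] c' ∉ Γ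

/-- The puzzle piece of depth `n` containing `z`. -/
def pieceAt (f : ℂ → ℂ) (X Γ : Set ℂ) (n : ℕ) (z : ℂ) : Set ℂ :=
  connectedComponentIn (f^[n] ⁻¹' (X \ Γ)) z

/-- An `ℓ`-admissible puzzle. -/
structure IsAdmissiblePuzzle (ℓ p : ℕ) (f : ℂ → ℂ) (X Γ : Set ℂ) : Prop where
  puzzle : IsPuzzle p f X Γ
  nondeg : ∀ c' : ℂ, deriv f c' = 0 → c' ∈ juliaSet f →
    ∃ d : ℕ, closure (pieceAt f X Γ (d + ℓ) c') ⊆ pieceAt f X Γ d c'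
  repelling : ∀ z ∈ Γ ∩ juliaSet f, ∀ n : ℕ, 0 < n → f^[n] z = z →
    1 < ‖deriv (f^[n]) z‖
  jordan : ∀ (n : ℕ) (z : ℂ), z ∈ f^[n] ⁻¹' (X \ Γ) → IsJordanDisk (pieceAt f X Γ n z)

/-- The tableau `T_f(z)` is periodic. -/
def TableauPeriodic (f : ℂ → ℂ) (X Γ : Set ℂ) (z : ℂ) : Prop :=
  ∃ k : ℕ, 1 ≤ k ∧ ∀ n : ℕ, pieceAt f X Γ n z = f^[k] '' pieceAt f X Γ (n + k) z

/-- `x` combinatorially accumulates to `y` (for `f`). -/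
def CombAcc (f : ℂ → ℂ) (X Γ : Set ℂ) (x y : ℂ) : Prop :=
  ∀ n : ℕ, ∃ j : ℕ, 0 < j ∧ f^[j] '' pieceAt f X Γ (n + j) x = pieceAt f X Γ n y

/-- `x` combinatorially accumulates to `y` for `g = f^p` (puzzle depths in `pℕ`). -/
def CombAccG (p : ℕ) (f : ℂ → ℂ) (X Γ : Set ℂ) (x y : ℂ) : Prop :=
  ∀ n : ℕ, ∃ j : ℕ, 0 < j ∧
    f^[p * j] '' pieceAt f X Γ (p * n + p * j) x = pieceAt f X Γ (p * n) y

/-- Critical points of `f` on the Julia set. -/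
def critJulia (f : ℂ → ℂ) : Set ℂ := {z | deriv f z = 0 ∧ z ∈ juliaSet f}

/-- `[x]_f`: critical points combinatorially bi-accumulating with `x`. -/
def critClass (f : ℂ → ℂ) (X Γ : Set ℂ) (x : ℂ) : Set ℂ :=
  {c' ∈ critJulia f | CombAcc f X Γ x c' ∧ CombAcc f X Γ c' x}

/-- `P_{n+k}(c')` is a child of `P_n(c₁)`: the map
`f^(k-1) : P_{n+k-1}(f(c')) → P_n(c₁)` is conformal. -/
def IsChild (f : ℂ → ℂ) (X Γ : Set ℂ) (n k : ℕ) (c' c₁ : ℂ) : Prop :=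
  0 < k ∧ f^[k - 1] '' pieceAt f X Γ (n + k - 1) (f c') = pieceAt f X Γ n c₁ ∧
    InjOn (f^[k - 1]) (pieceAt f X Γ (n + k - 1) (f c'))

/-- The critical piece `P_n(c₁)` has only finitely many children. -/
def FinitelyManyChildren (f : ℂ → ℂ) (X Γ : Set ℂ) (n : ℕ) (c₁ : ℂ) : Prop :=
  Set.Finite {q : ℂ × ℕ | q.1 ∈ critJulia f ∧ IsChild f X Γ n q.2 q.1 c₁}

/-- The tableau of `x` is persistently recurrent. -/
def PersistentlyRecurrent (f : ℂ → ℂ) (X Γ : Set ℂ) (x : ℂ) : Prop :=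
  CombAcc f X Γ x x ∧ ∀ c₁ ∈ critClass f X Γ x, ∀ n : ℕ, FinitelyManyChildren f X Γ n c₁

/-- A function on a subset of `ℂ²` is analytic along every analytic disc contained in it
(this expresses holomorphy of a function on an analytic curve in `ℂ²`). -/
def AnalyticOnSlice (Φ : ℂ × ℂ → ℂ) (H : Set (ℂ × ℂ)) : Prop :=
  ∀ (U : Set ℂ) (γ : ℂ → ℂ × ℂ), IsOpen U →
    AnalyticOnNhd ℂ (fun t => (γ t).1) U → AnalyticOnNhd ℂ (fun t => (γ t).2) U →
    (∀ t ∈ U, γ t ∈ H) → AnalyticOnNhd ℂ (fun t => Φ (γ t)) U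

/-- A quasiconformal homeomorphism of the plane (metric definition: bounded circular
distortion). -/
def IsQCHomeo (φ : ℂ → ℂ) : Prop :=
  Continuous φ ∧ Bijective φ ∧ ∃ K : ℝ, ∀ x : ℂ,
    Filter.limsup (fun r : ℝ =>
        sSup ((fun y => dist (φ y) (φ x)) '' sphere x r) /
          sInf ((fun y => dist (φ y) (φ x)) '' sphere x r)) (𝓝[>] (0 : ℝ)) ≤ K

/-- The sector of the parameter disk coordinate `Φ`, of radii `> 1 - 1/(k+1)` and
angles within `1/(k+1)` of `t`. -/
def paramSector (Φ : ℂ × ℂ → ℂ) (H : Set (ℂ × ℂ)) (t : ℝ) (k : ℕ) : Set (ℂ × ℂ) :=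
  {w ∈ H | ∃ r θ' : ℝ, 1 - 1 / (k + 1) < r ∧ r < 1 ∧ |θ' - t| < 1 / (k + 1) ∧
    Φ w = (r : ℂ) * Complex.exp (2 * Real.pi * Complex.I * (θ' : ℂ))}

/-- The impression of the parameter ray of angle `t`. -/
def impression (Φ : ℂ × ℂ → ℂ) (H : Set (ℂ × ℂ)) (t : ℝ) : Set (ℂ × ℂ) :=
  ⋂ k : ℕ, closure (paramSector Φ H t k)

end

theorem cubic_hasDerivAt (c a z : ℂ) : HasDerivAt (cubic c a) (3 * (z ^ 2 - c ^ 2)) z := by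
  have h : HasDerivAt (fun z : ℂ => z ^ 3 - 3 * c ^ 2 * z + a)
      ((3 : ℕ) * z ^ (3 - 1) - 3 * c ^ 2 * 1) z :=
    (((hasDerivAt_id z).pow 3).fun_sub ((hasDerivAt_id z).const_mul _)).add_const a |>.congr_deriv
      (by simp)
  exact h.congr_deriv (by push_cast; ring)

theorem cubic_deriv (c a z : ℂ) : deriv (cubic c a) z = 3 * (z ^ 2 - c ^ 2) :=
  (cubic_hasDerivAt c a z).deriv

theorem cubic_differentiable (c a : ℂ) : Differentiable ℂ (cubic c a) :=
  fun z => (cubic_hasDerivAt c a z).differentiableAt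

theorem deriv_iterate_eq_prod {g : ℂ → ℂ} (hg : Differentiable ℂ g) (n : ℕ) (z : ℂ) :
    deriv (g^[n]) z = ∏ j ∈ Finset.range n, deriv g (g^[j] z) := by
  induction n with
  | zero => simp
  | succ n ih =>
    rw [Function.iterate_succ', deriv_comp z (hg _) ((hg.iterate n) z), ih,
      Finset.prod_range_succ, mul_comm]

theorem cubic_escape (M : ℝ) (hM : 0 ≤ M) : ∃ R : ℝ, 1 < R ∧ ∀ c a : ℂ, ‖c‖ ≤ M → ‖a‖ ≤ M →
    ∀ z : ℂ, R ≤ ‖z‖ → 2 * ‖z‖ ≤ ‖cubic c a z‖ := by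
  refine ⟨3 * M ^ 2 + M + 3, by nlinarith [sq_nonneg M], fun c a hc ha z hz => ?_⟩
  have h1 : ‖z‖ ^ 3 ≤ ‖cubic c a z‖ + 3 * ‖c‖ ^ 2 * ‖z‖ + ‖a‖ := by
    have : z ^ 3 = cubic c a z + 3 * c ^ 2 * z - a := by simp only [cubic]; ring
    calc ‖z‖ ^ 3 = ‖cubic c a z + 3 * c ^ 2 * z - a‖ := by rw [← this, norm_pow]
      _ ≤ ‖cubic c a z‖ + ‖3 * c ^ 2 * z‖ + ‖a‖ :=
        (norm_sub_le _ _).trans (by gcongr; exact norm_add_le _ _)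
      _ = _ := by simp
  have hz1 : 1 ≤ ‖z‖ := by nlinarith [sq_nonneg M]
  have h2 : ‖c‖ ^ 2 ≤ M ^ 2 := by gcongr
  have h3 : 3 * M ^ 2 + M + 3 ≤ ‖z‖ ^ 2 := by nlinarith
  have h4 : ‖z‖ * (3 * M ^ 2 + M + 3) ≤ ‖z‖ ^ 3 := by
    calc _ ≤ ‖z‖ * ‖z‖ ^ 2 := by gcongr
      _ = _ := by ring
  have h5 : 3 * ‖c‖ ^ 2 * ‖z‖ ≤ 3 * M ^ 2 * ‖z‖ := by gcongr
  nlinarith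

theorem norm_iterate_ge {g : ℂ → ℂ} {R : ℝ} (hR : 1 < R)
    (hg : ∀ z : ℂ, R ≤ ‖z‖ → 2 * ‖z‖ ≤ ‖g z‖) {z : ℂ} (hz : R ≤ ‖z‖) (n : ℕ) :
    2 ^ n * ‖z‖ ≤ ‖g^[n] z‖ := by
  induction n with
  | zero => simp
  | succ n ih =>
    have h1 : (1 : ℝ) ≤ 2 ^ n := one_le_pow₀ (by norm_num)
    have h0 : 0 ≤ ‖z‖ := norm_nonneg _
    rw [Function.iterate_succ_apply']
    have := hg _ (show R ≤ ‖g^[n] z‖ by nlinarith)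
    rw [pow_succ]; linarith

theorem norm_lt_of_iterate_lt {g : ℂ → ℂ} {R : ℝ} (hR : 1 < R)
    (hg : ∀ z : ℂ, R ≤ ‖z‖ → 2 * ‖z‖ ≤ ‖g z‖) {z : ℂ} {n : ℕ} (hz : ‖g^[n] z‖ < R) : ‖z‖ < R := by
  by_contra! h
  have h1 : (1 : ℝ) ≤ 2 ^ n := one_le_pow₀ (by norm_num)
  have := norm_iterate_ge hR hg h n
  nlinarith [norm_nonneg z]

theorem norm_lt_of_periodic {g : ℂ → ℂ} {R : ℝ} (hR : 1 < R)
    (hg : ∀ z : ℂ, R ≤ ‖z‖ → 2 * ‖z‖ ≤ ‖g z‖) {z : ℂ} {n : ℕ} (hn : 0 < n) (hz : g^[n] z = z) :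
    ‖z‖ < R := by
  by_contra! h
  have h1 : (2 : ℝ) ≤ 2 ^ n := le_self_pow₀ (by norm_num) hn.ne'
  have := norm_iterate_ge hR hg h n
  rw [hz] at this
  nlinarith [norm_nonneg z]

theorem exists_contracting_radius {g : ℂ → ℂ} {g' z : ℂ} (hd : HasDerivAt g g' z) (hz : g z = z)
    (h1 : ‖g'‖ < 1) : ∃ κ : ℝ, 0 < κ ∧ κ < 1 ∧ ∃ r > 0, ∀ x, ‖x - z‖ ≤ r →
      ‖g x - z‖ ≤ κ * ‖x - z‖ := by
  obtain ⟨κ, hκ, hκ1⟩ := exists_between h1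
  refine ⟨κ, (norm_nonneg _).trans_lt hκ, hκ1, ?_⟩
  have := hd.isLittleO.def (sub_pos.2 hκ)
  obtain ⟨r, hr, h⟩ := Metric.eventually_nhds_iff.1 this
  refine ⟨r / 2, by positivity, fun x hx => ?_⟩
  have h2 := h (show dist x z < r by rw [dist_eq_norm]; linarith)
  rw [hz] at h2
  calc ‖g x - z‖ = ‖(g x - z - (x - z) • g') + (x - z) • g'‖ := by simp
    _ ≤ (κ - ‖g'‖) * ‖x - z‖ + ‖x - z‖ * ‖g'‖ := by
      refine (norm_add_le _ _).trans (add_le_add h2 (by rw [norm_smul]))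
    _ = _ := by ring

theorem iterate_contracting {g : ℂ → ℂ} {z : ℂ} {κ r : ℝ} (h0 : 0 ≤ κ) (h1 : κ < 1)
    (h : ∀ x, ‖x - z‖ ≤ r → ‖g x - z‖ ≤ κ * ‖x - z‖) {x : ℂ} (hx : ‖x - z‖ ≤ r) (k : ℕ) :
    ‖g^[k] x - z‖ ≤ κ ^ k * ‖x - z‖ := by
  induction k with
  | zero => simp
  | succ k ih =>
    have hk : κ ^ k ≤ 1 := pow_le_one₀ h0 h1.le
    rw [Function.iterate_succ_apply']
    refine (h _ (ih.trans ?_)).trans ?_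
    · nlinarith [norm_nonneg (x - z)]
    · rw [pow_succ']; nlinarith

theorem tendsto_iterate_of_contracting {g : ℂ → ℂ} {z : ℂ} {κ r : ℝ} (h0 : 0 ≤ κ) (h1 : κ < 1)
    (h : ∀ x, ‖x - z‖ ≤ r → ‖g x - z‖ ≤ κ * ‖x - z‖) {x : ℂ} (hx : ‖x - z‖ ≤ r) :
    Tendsto (fun k => g^[k] x) atTop (𝓝 z) := by
  rw [tendsto_iff_norm_sub_tendsto_zero]
  refine squeeze_zero (fun _ => norm_nonneg _) (iterate_contracting h0 h1 h hx) ?_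
  simpa using (tendsto_pow_atTop_nhds_zero_of_lt_one h0 h1).mul_const ‖x - z‖

section

open ENNReal MeasureTheory

theorem lintegral_image_of_hasDerivAt {f f' : ℂ → ℂ} {s : Set ℂ} (hs : MeasurableSet s)
    (hf : ∀ z ∈ s, HasDerivAt f (f' z) z) (hi : InjOn f s) (g : ℂ → ENNReal) :
    ∫⁻ x in f '' s, g x = ∫⁻ z in s, ‖f' z‖ₑ ^ 2 * g (f z) := by
  have h : ∀ z ∈ s, HasFDerivWithinAt f
      ((ContinuousLinearMap.toSpanSingleton ℂ (f' z)).restrictScalars ℝ) s z :=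
    fun z hz => ((hf z hz).hasFDerivAt.restrictScalars ℝ).hasFDerivWithinAt
  rw [lintegral_image_eq_lintegral_abs_det_fderiv_mul volume hs h hi]
  refine setLIntegral_congr_fun hs fun z _ => ?_
  have hd : ((ContinuousLinearMap.toSpanSingleton ℂ (f' z)).restrictScalars ℝ).det
      = ‖f' z‖ ^ 2 := by
    simp [ContinuousLinearMap.det, LinearMap.det_restrictScalars,
      Algebra.norm_complex_eq, Complex.normSq_eq_norm_sq]
  simp only [hd]
  rw [abs_of_nonneg (by positivity), ENNReal.ofReal_pow (norm_nonneg _), ofReal_norm]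

theorem exists_disjoint_cover_injOn {f f' : ℂ → ℂ} (hf : ∀ z, HasStrictDerivAt f (f' z) z) :
    ∃ E : ℕ → Set ℂ, (∀ n, MeasurableSet (E n)) ∧ Pairwise (Disjoint on E) ∧
      (∀ n, InjOn f (E n)) ∧ ∀ z, f' z ≠ 0 → ∃ n, z ∈ E n := by
  have h : ∀ z, ∃ U : Set ℂ, IsOpen U ∧ InjOn f U ∧ (f' z ≠ 0 → z ∈ U) := by
    intro z
    by_cases hz : f' z = 0
    · exact ⟨∅, isOpen_empty, by simp, by simp [hz]⟩
    · let e := ((hf z).hasStrictFDerivAt_equiv hz).toOpenPartialHomeomorph f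
      exact ⟨e.source, e.open_source, e.injOn,
        fun _ => ((hf z).hasStrictFDerivAt_equiv hz).mem_toOpenPartialHomeomorph_source⟩
  choose U hUo hUi hU using h
  obtain ⟨t, -, htc, ht⟩ := TopologicalSpace.countable_cover_nhdsWithin (f := U)
    (s := {z | f' z ≠ 0}) fun z hz => mem_nhdsWithin_of_mem_nhds ((hUo z).mem_nhds (hU z hz))
  obtain ⟨e, he⟩ := Set.countable_iff_exists_subset_range.1 htc
  refine ⟨disjointed fun n => U (e n), MeasurableSet.disjointed fun n => (hUo _).measurableSet,
    disjoint_disjointed _, fun n => (hUi _).mono (disjointed_subset _ _), fun z hz => ?_⟩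
  have h1 := ht hz
  simp only [mem_iUnion] at h1
  obtain ⟨x, hx, hzx⟩ := h1
  obtain ⟨n, rfl⟩ := he hx
  have : z ∈ ⋃ n, U (e n) := mem_iUnion.2 ⟨n, hzx⟩
  rwa [← iUnion_disjointed, mem_iUnion] at this

theorem lintegral_le_lintegral_preimage {f f' : ℂ → ℂ} (hf : ∀ z, HasStrictDerivAt f (f' z) z)
    (hf' : Measurable f') {u h : ℂ → ENNReal} (hu : Measurable u) {V : Set ℂ}
    (hV : MeasurableSet V)
    (hh : ∀ᵐ x, x ∈ V → ∃ P : Finset ℂ, (∀ y ∈ P, f y = x ∧ f' y ≠ 0) ∧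
      h x ≤ ∑ y ∈ P, u y / ‖f' y‖ₑ ^ 2) :
    ∫⁻ x in V, h x ≤ ∫⁻ z in f ⁻¹' V, u z := by
  obtain ⟨E, hEm, hEd, hEi, hE⟩ := exists_disjoint_cover_injOn hf
  have hfc : Continuous f := continuous_iff_continuousAt.2 fun z => (hf z).hasDerivAt.continuousAt
  have hE0 : ∀ n, MeasurableSet (E n ∩ {z | f' z ≠ 0}) := fun n =>
    (hEm n).inter (hf' (measurableSet_singleton 0).compl)
  let F : ℕ → Set ℂ := fun n => E n ∩ {z | f' z ≠ 0}
  have hFi : ∀ n, InjOn f (F n) := fun n => (hEi n).mono inter_subset_left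
  let w : ℕ → ℂ → ENNReal := fun n => Function.extend ((F n).domRestrict f)
    (fun z => u z / ‖f' z‖ₑ ^ 2) 0
  have hemb : ∀ n, MeasurableEmbedding ((F n).domRestrict f) := fun n =>
    hfc.continuousOn.measurableEmbedding (hE0 n) (hFi n)
  have hwm : ∀ n, Measurable (w n) := fun n =>
    (hemb n).measurable_extend ((hu.div (hf'.enorm.pow_const 2)).comp measurable_subtype_coe)
      measurable_const
  have hw : ∀ n, ∀ z ∈ F n, w n (f z) = u z / ‖f' z‖ₑ ^ 2 := fun n z hz =>
    (hemb n).injective.extend_apply (fun z : F n => u z / ‖f' z‖ₑ ^ 2) 0 ⟨z, hz⟩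
  have hw0 : ∀ n, ∀ x ∉ f '' F n, w n x = 0 := fun n x hx =>
    Function.extend_apply' _ _ _ fun ⟨z, hz⟩ => hx ⟨z, z.2, hz⟩
  have h1 : ∫⁻ x in V, h x ≤ ∫⁻ x in V, ∑' n, w n x := by
    refine lintegral_mono_ae ((ae_restrict_iff' hV).2 ?_)
    filter_upwards [hh] with x hx hxV
    obtain ⟨P, hP, hle⟩ := hx hxV
    refine hle.trans ?_
    have hn : ∀ y, ∃ n, y ∈ P → y ∈ F n := by
      intro y
      by_cases hy : y ∈ P
      · obtain ⟨n, hn⟩ := hE y (hP y hy).2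
        exact ⟨n, fun _ => ⟨hn, (hP y hy).2⟩⟩
      · exact ⟨0, fun h => absurd h hy⟩
    choose i hi using hn
    have hinj : InjOn i (P : Set ℂ) := fun y hy y' hy' he => by
      have h1 := hi y hy
      rw [he] at h1
      exact hFi _ h1 (hi y' hy') ((hP y hy).1.trans (hP y' hy').1.symm)
    calc ∑ y ∈ P, u y / ‖f' y‖ₑ ^ 2 = ∑ y ∈ P, w (i y) x := by
          refine Finset.sum_congr rfl fun y hy => ?_
          rw [← hw _ y (hi y hy), (hP y hy).1]
      _ = ∑ n ∈ P.image i, w n x := (Finset.sum_image (f := fun n => w n x) hinj).symm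
      _ ≤ ∑' n, w n x := ENNReal.sum_le_tsum _
  refine h1.trans ?_
  rw [lintegral_tsum fun n => (hwm n).aemeasurable]
  have h2 : ∀ n, ∫⁻ x in V, w n x = ∫⁻ z in F n ∩ f ⁻¹' V, u z := by
    intro n
    have hm : MeasurableSet (F n ∩ f ⁻¹' V) := (hE0 n).inter (hfc.measurable hV)
    have h3 : ∫⁻ x in V, w n x = ∫⁻ x in f '' (F n ∩ f ⁻¹' V), w n x := by
      have him : MeasurableSet (f '' (F n ∩ f ⁻¹' V)) :=
        hm.image_of_continuousOn_injOn hfc.continuousOn ((hFi n).mono inter_subset_left)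
      rw [← lintegral_indicator hV, ← lintegral_indicator him]
      congr 1
      ext x
      by_cases hxV : x ∈ V
      · by_cases hx : x ∈ f '' F n
        · obtain ⟨z, hz, rfl⟩ := hx
          rw [indicator_of_mem hxV, indicator_of_mem
              (mem_image_of_mem f (show z ∈ F n ∩ f ⁻¹' V from ⟨hz, hxV⟩))]
        · rw [indicator_of_mem hxV, hw0 n x hx, indicator_of_notMem]
          rintro ⟨z, hz, rfl⟩; exact hx ⟨z, hz.1, rfl⟩
      · rw [indicator_of_notMem hxV, indicator_of_notMem]
        rintro ⟨z, hz, rfl⟩; exact hxV hz.2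
    rw [h3, lintegral_image_of_hasDerivAt hm (fun z _ => (hf z).hasDerivAt)
      ((hFi n).mono inter_subset_left)]
    refine setLIntegral_congr_fun hm fun z hz => ?_
    simp only [hw n z hz.1]
    refine ENNReal.mul_div_cancel ?_ (by simp)
    simpa using hz.1.2
  simp only [h2]
  rw [← lintegral_iUnion (fun n => (hE0 n).inter (hfc.measurable hV))]
  · exact lintegral_mono_set (iUnion_subset fun n => inter_subset_right)
  · intro m n hmn
    exact (hEd hmn).mono (inter_subset_left.trans inter_subset_left)
      (inter_subset_left.trans inter_subset_left)

end

section

open ENNReal MeasureTheory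

theorem cubic_hasStrictDerivAt (c a z : ℂ) :
    HasStrictDerivAt (cubic c a) (3 * (z ^ 2 - c ^ 2)) z := by
  have h := ((cubic_differentiable c a).contDiff (n := 1)).contDiffAt (x := z)
  have := h.hasStrictDerivAt (by simp)
  rwa [cubic_deriv] at this

/-- A point that is periodic with multiplier of modulus less than one. -/
def IsAttractingPeriodic (f : ℂ → ℂ) (b : ℂ) : Prop :=
  ∃ n, 0 < n ∧ f^[n] b = b ∧ ‖deriv (f^[n]) b‖ < 1

theorem IsAttractingPeriodic.exists_ball {f : ℂ → ℂ} (hf : Differentiable ℂ f) {b : ℂ}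
    (h : IsAttractingPeriodic f b) :
    ∃ n, 0 < n ∧ ∃ r > 0, ∀ x, ‖x - b‖ < r → ‖f^[n] x - b‖ < r := by
  obtain ⟨n, hn, hb, hd⟩ := h
  obtain ⟨κ, hκ0, hκ1, r, hr, hc⟩ :=
    exists_contracting_radius ((hf.iterate n) b).hasDerivAt hb hd
  exact ⟨n, hn, r, hr, fun x hx => (hc x hx.le).trans_lt
    (by nlinarith [norm_nonneg (x - b)])⟩

theorem iterate_ball {f : ℂ → ℂ} {b : ℂ} {n : ℕ} {r : ℝ}
    (h : ∀ x, ‖x - b‖ < r → ‖f^[n] x - b‖ < r) {x : ℂ} (hx : ‖x - b‖ < r) (j : ℕ) :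
    ‖f^[n * j] x - b‖ < r := by
  induction j with
  | zero => simpa using hx
  | succ j ih => rw [Nat.mul_succ, add_comm, Function.iterate_add_apply]; exact h _ ih

theorem eq_zero_of_transfer_fixed {c a : ℂ} {A : Finset ℂ}
    (hA : ∀ b ∈ A, IsAttractingPeriodic (cubic c a) b) {φ : ℂ → ℂ} (hm : Measurable φ)
    (hφ : AnalyticOnNhd ℂ φ (A : Set ℂ)ᶜ)
    (hT : ∀ᵐ x, ∃ P : Finset ℂ, (∀ y ∈ P, cubic c a y = x ∧ 3 * (y ^ 2 - c ^ 2) ≠ 0) ∧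
      φ x = ∑ y ∈ P, φ y / (3 * (y ^ 2 - c ^ 2)) ^ 2) :
    ∀ z, z ∉ A → φ z = 0 := by
  set f := cubic c a with hfdef
  have hfd : Differentiable ℂ f := cubic_differentiable c a
  have hfc : Continuous f := hfd.continuous
  have hfit : ∀ k, Continuous (f^[k]) := fun k => hfc.iterate k
  have hball : ∀ b, ∃ n : ℕ, ∃ r : ℝ, b ∈ A → 0 < n ∧ 0 < r ∧
      ∀ x, ‖x - b‖ < r → ‖f^[n] x - b‖ < r := by
    intro b
    by_cases hb : b ∈ A
    · obtain ⟨n, hn, r, hr, h⟩ := (hA b hb).exists_ball hfd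
      exact ⟨n, r, fun _ => ⟨hn, hr, h⟩⟩
    · exact ⟨0, 0, fun h => absurd h hb⟩
  choose n r hnr using hball
  obtain ⟨R, hR1, hR⟩ := cubic_escape (max ‖c‖ ‖a‖) (by positivity)
  replace hR := hR c a (le_max_left _ _) (le_max_right _ _)
  let N : Set ℂ := {z | ∃ b ∈ A, ∃ k : ℕ, ‖f^[k] z - b‖ < r b}
  have hNo : IsOpen N := by
    have : N = ⋃ b ∈ A, ⋃ k : ℕ, {z | ‖f^[k] z - b‖ < r b} := by ext; simp [N]
    rw [this]
    refine isOpen_biUnion fun b _ => isOpen_iUnion fun k => ?_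
    exact isOpen_lt ((hfit k).sub continuous_const).norm continuous_const
  have hNf : ∀ z, f z ∈ N ↔ z ∈ N := by
    intro z
    constructor
    · rintro ⟨b, hb, k, hk⟩
      exact ⟨b, hb, k + 1, hk⟩
    · rintro ⟨b, hb, k, hk⟩
      obtain ⟨hn, hr, h⟩ := hnr b hb
      refine ⟨b, hb, k + (n b - 1), ?_⟩
      rw [← Function.iterate_succ_apply, show (k + (n b - 1)).succ = n b + k by omega,
        Function.iterate_add_apply]
      exact h _ hk
  have hAN : ∀ b ∈ A, b ∈ N := fun b hb => ⟨b, hb, 0, by simpa using (hnr b hb).2.1⟩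
  let V : Set ℂ := ball 0 R \ N
  have hV : MeasurableSet V := measurableSet_ball.diff hNo.measurableSet
  have hVf : f ⁻¹' V ⊆ V := by
    intro z hz
    refine ⟨?_, fun h => hz.2 ((hNf z).2 h)⟩
    have h1 : ‖f^[1] z‖ < R := by simpa using hz.1
    simpa using norm_lt_of_iterate_lt hR1 hR h1
  have hφc : ContinuousOn φ (A : Set ℂ)ᶜ := hφ.continuousOn
  have hfin : ∫⁻ z in V, ‖φ z‖ₑ ≠ ⊤ := by
    have hK : IsCompact (closedBall (0 : ℂ) R \ N) := (isCompact_closedBall _ _).diff hNo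
    obtain ⟨C, hC⟩ := hK.exists_bound_of_continuousOn
      (hφc.mono fun z hz h => hz.2 (hAN z h))
    have h1 : ∫⁻ z in V, ‖φ z‖ₑ ≤ ∫⁻ _ in V, ENNReal.ofReal C := by
      refine setLIntegral_mono measurable_const fun z hz => ?_
      rw [← ofReal_norm]
      exact ENNReal.ofReal_le_ofReal (hC z ⟨ball_subset_closedBall hz.1, hz.2⟩)
    refine ne_top_of_le_ne_top ?_ h1
    rw [setLIntegral_const]
    exact ENNReal.mul_ne_top ENNReal.ofReal_ne_top
      (ne_top_of_le_ne_top measure_ball_lt_top.ne (measure_mono sdiff_subset))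
  have hle : ∫⁻ z in V, ‖φ z‖ₑ ≤ ∫⁻ z in f ⁻¹' V, ‖φ z‖ₑ := by
    refine lintegral_le_lintegral_preimage (f' := fun z => 3 * (z ^ 2 - c ^ 2))
      (fun z => cubic_hasStrictDerivAt c a z) (by fun_prop) hm.enorm hV ?_
    filter_upwards [hT] with x hx _
    obtain ⟨P, hP, he⟩ := hx
    refine ⟨P, hP, ?_⟩
    rw [he]
    refine (enorm_sum_le _ _).trans (Finset.sum_le_sum fun y hy => ?_)
    have := (hP y hy).2
    rw [div_eq_mul_inv, enorm_mul, enorm_inv (pow_ne_zero 2 this), enorm_pow, div_eq_mul_inv]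
  have hfV : MeasurableSet (f ⁻¹' V) := hfc.measurable hV
  have hz0 : ∫⁻ z in V \ f ⁻¹' V, ‖φ z‖ₑ = 0 := by
    have h1 : ∫⁻ z in V, ‖φ z‖ₑ =
        (∫⁻ z in f ⁻¹' V, ‖φ z‖ₑ) + ∫⁻ z in V \ f ⁻¹' V, ‖φ z‖ₑ := by
      rw [← lintegral_inter_add_sdiff (fun z => ‖φ z‖ₑ) V hfV, inter_eq_self_of_subset_right hVf]
    have h2 : ∫⁻ z in f ⁻¹' V, ‖φ z‖ₑ ≠ ⊤ := ne_top_of_le_ne_top hfin (lintegral_mono_set hVf)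
    rw [h1] at hle
    by_contra h0
    exact absurd hle (not_le.2 (ENNReal.lt_add_right h2 h0))
  let W : Set ℂ := {z | ‖z‖ < R ∧ R < ‖f z‖}
  have hWo : IsOpen W := (isOpen_lt continuous_norm continuous_const).inter
    (isOpen_lt continuous_const hfc.norm)
  have hWN : ∀ z ∈ W, z ∉ N := by
    rintro z hz ⟨b, hb, k, hk⟩
    obtain ⟨hn, hr, h⟩ := hnr b hb
    obtain ⟨j, hj⟩ := pow_unbounded_of_one_lt (‖b‖ + r b) (one_lt_two (α := ℝ))
    have h1 := norm_iterate_ge hR1 hR hz.2.le (k + n b * (j + 1) - 1)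
    have h2 := iterate_ball h hk (j + 1)
    rw [← Function.iterate_add_apply] at h2
    rw [← Function.iterate_succ_apply] at h1
    have hpos : 0 < n b * (j + 1) := by positivity
    rw [show (k + n b * (j + 1) - 1).succ = n b * (j + 1) + k by omega] at h1
    have h3 : j ≤ k + n b * (j + 1) - 1 := by
      have : j + 1 ≤ n b * (j + 1) := Nat.le_mul_of_pos_left _ hn
      omega
    have h4 : (2 : ℝ) ^ j ≤ 2 ^ (k + n b * (j + 1) - 1) := pow_le_pow_right₀ (by norm_num) h3
    have h5 : ‖f^[n b * (j + 1) + k] z‖ ≤ ‖b‖ + r b := by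
      have := norm_add_le (f^[n b * (j + 1) + k] z - b) b
      rw [sub_add_cancel] at this
      linarith
    have h6 : (1 : ℝ) ≤ 2 ^ j := one_le_pow₀ (by norm_num)
    have h7 := hz.2
    nlinarith
  have hWV : W ⊆ V \ f ⁻¹' V := fun z hz =>
    ⟨⟨by simpa using hz.1, hWN z hz⟩, fun h => by
      have : ‖f z‖ < R := by simpa using h.1
      exact lt_asymm this hz.2⟩
  have hWA : W ⊆ (A : Set ℂ)ᶜ := fun z hz h => hWN z hz (hAN z h)
  have hae : φ =ᵐ[volume.restrict W] 0 := by
    have h1 : ∫⁻ z in W, ‖φ z‖ₑ = 0 := le_antisymm (hz0 ▸ lintegral_mono_set hWV) bot_le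
    rw [lintegral_eq_zero_iff hm.enorm] at h1
    filter_upwards [h1] with z hz
    simpa using hz
  have hW0 : EqOn φ 0 W :=
    Measure.eqOn_open_of_ae_eq hae hWo (hφc.mono hWA) continuousOn_const
  obtain ⟨z₀, hz₀⟩ : W.Nonempty := by
    have h1 : ((R : ℝ) : ℂ) ∈ closure (ball (0 : ℂ) R) := by
      rw [closure_ball _ (by linarith)]
      simp [abs_of_pos (show (0 : ℝ) < R by linarith)]
    have h2 : {z | R < ‖f z‖} ∈ 𝓝 ((R : ℝ) : ℂ) := by
      refine (isOpen_lt continuous_const hfc.norm).mem_nhds ?_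
      have h3 : ‖(R : ℂ)‖ = R := by simp [abs_of_pos (show (0 : ℝ) < R by linarith)]
      have := hR (R : ℂ) h3.ge
      rw [h3] at this
      show R < ‖f R‖
      linarith
    obtain ⟨z, hz1, hz2⟩ := mem_closure_iff_nhds.1 h1 _ h2
    exact ⟨z, by simpa using hz2, hz1⟩
  have hconn : IsPreconnected (A : Set ℂ)ᶜ :=
    (A.countable_toSet.isConnected_compl_of_one_lt_rank (by simp)).isPreconnected
  have := hφ.eqOn_of_preconnected_of_eventuallyEq (g := 0) (fun z _ => analyticAt_const) hconn
    (hWA hz₀) (eventually_of_mem (hWo.mem_nhds hz₀) hW0)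
  exact fun z hz => this (by simpa using hz)

end

theorem exists_cubic_roots {c a x : ℂ} (hc : cubic c a c ≠ x) (hc' : cubic c a (-c) ≠ x) :
    ∃ y₁ y₂ y₃ : ℂ, y₁ ≠ y₂ ∧ y₁ ≠ y₃ ∧ y₂ ≠ y₃ ∧
      ∀ z, cubic c a z - x = (z - y₁) * (z - y₂) * (z - y₃) := by
  obtain ⟨y₁, h₁⟩ : ∃ y, cubic c a y = x := by
    have hd : (Polynomial.X ^ 3 - Polynomial.C (3 * c ^ 2) * Polynomial.X
        + Polynomial.C (a - x)).degree = 3 := by compute_degree!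
    obtain ⟨y, hy⟩ := IsAlgClosed.exists_root _ (by rw [hd]; norm_num)
    refine ⟨y, ?_⟩
    simp [Polynomial.IsRoot] at hy
    simp only [cubic]
    linear_combination hy
  obtain ⟨s, hs⟩ := IsAlgClosed.exists_pow_nat_eq (12 * c ^ 2 - 3 * y₁ ^ 2) (n := 2) (by norm_num)
  have hf : ∀ z, cubic c a z - x = (z - y₁) * (z - (-y₁ + s) / 2) * (z - (-y₁ - s) / 2) := by
    intro z
    rw [← h₁]; simp only [cubic]
    linear_combination (1 / 4 * (z - y₁)) * hs
  have hne : ∀ z, cubic c a z = x → z ^ 2 - c ^ 2 ≠ 0 := by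
    intro z hz h0
    have : (z - c) * (z + c) = 0 := by linear_combination h0
    rcases mul_eq_zero.1 this with h | h
    · exact hc (sub_eq_zero.1 h ▸ hz)
    · exact hc' (eq_neg_of_add_eq_zero_left h ▸ hz)
  have e2 : cubic c a ((-y₁ + s) / 2) = x := by
    have := hf ((-y₁ + s) / 2); simp at this; linear_combination this
  refine ⟨y₁, _, _, ?_, ?_, ?_, hf⟩
  · intro h
    refine hne y₁ h₁ ?_
    have hs' : s = 3 * y₁ := by linear_combination -2 * h
    rw [hs'] at hs; linear_combination 1 / 12 * hs
  · intro h
    refine hne y₁ h₁ ?_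
    have hs' : s = -3 * y₁ := by linear_combination 2 * h
    rw [hs'] at hs; linear_combination 1 / 12 * hs
  · intro h
    refine hne _ e2 ?_
    have hs' : s = 0 := by linear_combination h
    rw [hs'] at hs ⊢; linear_combination 1 / 12 * hs

theorem sum_inv_aux {y₁ y₂ y₃ α : ℂ} (h12 : y₁ ≠ y₂) (h13 : y₁ ≠ y₃) (h23 : y₂ ≠ y₃)
    (h1 : y₁ ≠ α) (h2 : y₂ ≠ α) (h3 : y₃ ≠ α) :
    1 / ((y₁ - α) * ((y₁ - y₂) * (y₁ - y₃))) + (1 / ((y₂ - α) * ((y₂ - y₁) * (y₂ - y₃))) +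
      1 / ((y₃ - α) * ((y₃ - y₁) * (y₃ - y₂)))) = 1 / -((α - y₁) * (α - y₂) * (α - y₃)) := by
  have := sub_ne_zero.2 h12
  have := sub_ne_zero.2 h13
  have := sub_ne_zero.2 h23
  have := sub_ne_zero.2 h12.symm
  have := sub_ne_zero.2 h13.symm
  have := sub_ne_zero.2 h23.symm
  have := sub_ne_zero.2 h1
  have := sub_ne_zero.2 h2
  have := sub_ne_zero.2 h3
  have := sub_ne_zero.2 h1.symm
  have := sub_ne_zero.2 h2.symm
  have := sub_ne_zero.2 h3.symm
  rw [← sub_eq_zero]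
  rw [show y₂ - y₁ = -(y₁ - y₂) by ring, show y₃ - y₁ = -(y₁ - y₃) by ring,
    show y₃ - y₂ = -(y₂ - y₃) by ring, show α - y₁ = -(y₁ - α) by ring,
    show α - y₂ = -(y₂ - α) by ring, show α - y₃ = -(y₃ - α) by ring]
  field_simp
  ring

theorem sum_inv_sq_aux {y₁ y₂ y₃ α : ℂ} (h12 : y₁ ≠ y₂) (h13 : y₁ ≠ y₃) (h23 : y₂ ≠ y₃)
    (h1 : y₁ ≠ α) (h2 : y₂ ≠ α) (h3 : y₃ ≠ α) :
    1 / ((y₁ - α) ^ 2 * ((y₁ - y₂) * (y₁ - y₃))) +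
      (1 / ((y₂ - α) ^ 2 * ((y₂ - y₁) * (y₂ - y₃))) +
      1 / ((y₃ - α) ^ 2 * ((y₃ - y₁) * (y₃ - y₂)))) =
      ((α - y₂) * (α - y₃) + (α - y₁) * (α - y₃) + (α - y₁) * (α - y₂)) /
        (-((α - y₁) * (α - y₂) * (α - y₃))) ^ 2 := by
  have := sub_ne_zero.2 h12
  have := sub_ne_zero.2 h13
  have := sub_ne_zero.2 h23
  have := sub_ne_zero.2 h1
  have := sub_ne_zero.2 h2
  have := sub_ne_zero.2 h3
  rw [← sub_eq_zero]
  rw [show y₂ - y₁ = -(y₁ - y₂) by ring, show y₃ - y₁ = -(y₁ - y₃) by ring,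
    show y₃ - y₂ = -(y₂ - y₃) by ring, show α - y₁ = -(y₁ - α) by ring,
    show α - y₂ = -(y₂ - α) by ring, show α - y₃ = -(y₃ - α) by ring]
  field_simp
  ring

/-- A fibre of the cubic over a non-critical value, together with Lagrange interpolation sums. -/
structure IsCubicFibre (c a x : ℂ) (P : Finset ℂ) : Prop where
  map_eq : ∀ y ∈ P, cubic c a y = x
  ne : ∀ y ∈ P, 3 * (y ^ 2 - c ^ 2) ≠ 0
  sum_inv : ∀ α, cubic c a α ≠ x →
    ∑ y ∈ P, 1 / ((y - α) * (3 * (y ^ 2 - c ^ 2))) = 1 / (x - cubic c a α)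
  sum_inv_sq : ∀ α, cubic c a α ≠ x →
    ∑ y ∈ P, 1 / ((y - α) ^ 2 * (3 * (y ^ 2 - c ^ 2))) =
      3 * (α ^ 2 - c ^ 2) / (x - cubic c a α) ^ 2

theorem exists_isCubicFibre {c a x : ℂ} (hc : cubic c a c ≠ x) (hc' : cubic c a (-c) ≠ x) :
    ∃ P, IsCubicFibre c a x P := by
  obtain ⟨y₁, y₂, y₃, h12, h13, h23, h⟩ := exists_cubic_roots hc hc'
  have hd : ∀ z, 3 * (z ^ 2 - c ^ 2) =
      (z - y₂) * (z - y₃) + (z - y₁) * (z - y₃) + (z - y₁) * (z - y₂) := by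
    intro z
    have h0 := h 0
    have h1 := h 1
    have h2 := h (-1)
    simp only [cubic] at h0 h1 h2
    have e1 : y₁ + y₂ + y₃ = 0 := by linear_combination 1 / 2 * h1 + 1 / 2 * h2 - h0
    linear_combination 1 / 2 * h1 - 1 / 2 * h2 + 2 * z * e1
  have e1 : 3 * (y₁ ^ 2 - c ^ 2) = (y₁ - y₂) * (y₁ - y₃) := by rw [hd]; ring
  have e2 : 3 * (y₂ ^ 2 - c ^ 2) = (y₂ - y₁) * (y₂ - y₃) := by rw [hd]; ring
  have e3 : 3 * (y₃ ^ 2 - c ^ 2) = (y₃ - y₁) * (y₃ - y₂) := by rw [hd]; ring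
  have f1 : cubic c a y₁ = x := by have := h y₁; simp at this; linear_combination this
  have f2 : cubic c a y₂ = x := by have := h y₂; simp at this; linear_combination this
  have f3 : cubic c a y₃ = x := by have := h y₃; simp at this; linear_combination this
  refine ⟨{y₁, y₂, y₃}, ?_, ?_, ?_, ?_⟩
  · simp [f1, f2, f3]
  · simp only [Finset.mem_insert, Finset.mem_singleton]
    rintro y (rfl | rfl | rfl)
    · rw [e1]; exact mul_ne_zero (sub_ne_zero.2 h12) (sub_ne_zero.2 h13)
    · rw [e2]; exact mul_ne_zero (sub_ne_zero.2 h12.symm) (sub_ne_zero.2 h23)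
    · rw [e3]; exact mul_ne_zero (sub_ne_zero.2 h13.symm) (sub_ne_zero.2 h23.symm)
  · intro α hα
    rw [Finset.sum_insert (by simp [h12, h13]), Finset.sum_insert (by simp [h23]),
      Finset.sum_singleton, e1, e2, e3, sum_inv_aux h12 h13 h23, ← h, neg_sub]
    all_goals rintro rfl; contradiction
  · intro α hα
    rw [Finset.sum_insert (by simp [h12, h13]), Finset.sum_insert (by simp [h23]),
      Finset.sum_singleton, e1, e2, e3, sum_inv_sq_aux h12 h13 h23, ← h, neg_sub, hd]
    all_goals rintro rfl; contradiction

namespace IsCubicFibre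

variable {c a x : ℂ} {P : Finset ℂ}

theorem sum_simple_pole (hP : IsCubicFibre c a x P) (hc : c ≠ 0) (h1 : cubic c a c ≠ x)
    (h2 : cubic c a (-c) ≠ x) {b : ℂ} (hb : cubic c a b ≠ x) (hbc : b ≠ c) (hbc' : b ≠ -c) :
    ∑ y ∈ P, 1 / (y - b) / (3 * (y ^ 2 - c ^ 2)) ^ 2 =
      1 / (3 * (b ^ 2 - c ^ 2)) * (1 / (x - cubic c a b)) +
      1 / (6 * c * (c - b)) * (1 / (x - cubic c a c)) +
      1 / (6 * c * (c + b)) * (1 / (x - cubic c a (-c))) := by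
  rw [← hP.sum_inv b hb, ← hP.sum_inv c h1, ← hP.sum_inv (-c) h2, Finset.mul_sum, Finset.mul_sum,
    Finset.mul_sum, ← Finset.sum_add_distrib, ← Finset.sum_add_distrib]
  refine Finset.sum_congr rfl fun y hy => ?_
  have hy1 : y - b ≠ 0 := sub_ne_zero.2 fun h => hb (h ▸ hP.map_eq y hy)
  have hy2 : y - c ≠ 0 := sub_ne_zero.2 fun h => h1 (h ▸ hP.map_eq y hy)
  have hy3 : y + c ≠ 0 := fun h => h2 (eq_neg_of_add_eq_zero_left h ▸ hP.map_eq y hy)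
  have hb1 : b - c ≠ 0 := sub_ne_zero.2 hbc
  have hb2 : b + c ≠ 0 := fun h => hbc' (eq_neg_of_add_eq_zero_left h)
  rw [show y ^ 2 - c ^ 2 = (y - c) * (y + c) by ring,
      show b ^ 2 - c ^ 2 = (b - c) * (b + c) by ring,
    show c - b = -(b - c) by ring, show c + b = b + c by ring, sub_neg_eq_add]
  field_simp
  ring

theorem sum_double_pole (hP : IsCubicFibre c a x P) (hc : c ≠ 0) (h1 : cubic c a c ≠ x)
    (h2 : cubic c a (-c) ≠ x) {b : ℂ} (hb : cubic c a b ≠ x) (hbc : b ≠ c) (hbc' : b ≠ -c) :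
    ∑ y ∈ P, 1 / (y - b) ^ 2 / (3 * (y ^ 2 - c ^ 2)) ^ 2 =
      1 / (x - cubic c a b) ^ 2 -
      6 * b / (3 * (b ^ 2 - c ^ 2)) ^ 2 * (1 / (x - cubic c a b)) +
      1 / (6 * c * (c - b) ^ 2) * (1 / (x - cubic c a c)) -
      1 / (6 * c * (c + b) ^ 2) * (1 / (x - cubic c a (-c))) := by
  have hb1 : b - c ≠ 0 := sub_ne_zero.2 hbc
  have hb2 : b + c ≠ 0 := fun h => hbc' (eq_neg_of_add_eq_zero_left h)
  have hb3 : 3 * (b ^ 2 - c ^ 2) ≠ 0 := by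
    rw [show b ^ 2 - c ^ 2 = (b - c) * (b + c) by ring]; simp [hb1, hb2]
  have e : 1 / (x - cubic c a b) ^ 2 = 1 / (3 * (b ^ 2 - c ^ 2)) *
      (3 * (b ^ 2 - c ^ 2) / (x - cubic c a b) ^ 2) := by
    rw [← mul_div_assoc, one_div_mul_cancel hb3]
  rw [e, ← hP.sum_inv_sq b hb, ← hP.sum_inv b hb, ← hP.sum_inv c h1, ← hP.sum_inv (-c) h2,
    Finset.mul_sum, Finset.mul_sum,
    Finset.mul_sum, Finset.mul_sum, ← Finset.sum_sub_distrib, ← Finset.sum_add_distrib,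
    ← Finset.sum_sub_distrib]
  refine Finset.sum_congr rfl fun y hy => ?_
  have hy1 : y - b ≠ 0 := sub_ne_zero.2 fun h => hb (h ▸ hP.map_eq y hy)
  have hy2 : y - c ≠ 0 := sub_ne_zero.2 fun h => h1 (h ▸ hP.map_eq y hy)
  have hy3 : y + c ≠ 0 := fun h => h2 (eq_neg_of_add_eq_zero_left h ▸ hP.map_eq y hy)
  rw [show y ^ 2 - c ^ 2 = (y - c) * (y + c) by ring,
      show b ^ 2 - c ^ 2 = (b - c) * (b + c) by ring,
    show c - b = -(b - c) by ring, show c + b = b + c by ring, sub_neg_eq_add]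
  field_simp
  ring

theorem sum_pole_crit (hP : IsCubicFibre c a x P) (hc : c ≠ 0) (h1 : cubic c a c ≠ x)
    (h2 : cubic c a (-c) ≠ x) {b : ℂ} (hb : b = c ∨ b = -c) :
    ∑ y ∈ P, 1 / (y - b) / (3 * (y ^ 2 - c ^ 2)) ^ 2 =
      1 / (12 * c ^ 2) * (1 / (x - cubic c a (-b))) -
      1 / (12 * c ^ 2) * (1 / (x - cubic c a b)) := by
  have hb1 : cubic c a b ≠ x := by rcases hb with rfl | rfl <;> assumption
  have hb2 : cubic c a (-b) ≠ x := by rcases hb with rfl | rfl <;> simpa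
  have hbc : c ^ 2 = b ^ 2 := by rcases hb with rfl | rfl <;> ring
  have hb0 : b ≠ 0 := by rcases hb with rfl | rfl <;> simpa
  have e : ∑ y ∈ P, 1 / ((y - b) ^ 2 * (3 * (y ^ 2 - c ^ 2))) = 0 := by
    rw [hP.sum_inv_sq b hb1, hbc]; simp
  rw [← add_zero (_ - _), ← mul_zero (1 / (6 * b)), ← e, ← hP.sum_inv b hb1, ← hP.sum_inv (-b) hb2,
    Finset.mul_sum, Finset.mul_sum,
    Finset.mul_sum, ← Finset.sum_sub_distrib, ← Finset.sum_add_distrib]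
  refine Finset.sum_congr rfl fun y hy => ?_
  have hy2 : y - b ≠ 0 := sub_ne_zero.2 fun h => hb1 (h ▸ hP.map_eq y hy)
  have hy3 : y + b ≠ 0 := fun h => hb2 (eq_neg_of_add_eq_zero_left h ▸ hP.map_eq y hy)
  rw [hbc, show y ^ 2 - b ^ 2 = (y - b) * (y + b) by ring, sub_neg_eq_add]
  field_simp
  ring

end IsCubicFibre

section

open Matrix MeasureTheory

theorem eq_zero_of_sum_poles_eq_zero {A : Finset ℂ} {β δ : ℂ → ℂ}
    (h : ∀ z, z ∉ A → ∑ b ∈ A, (β b / (z - b) + δ b / (z - b) ^ 2) = 0) :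
    ∀ b ∈ A, β b = 0 ∧ δ b = 0 := by
  intro b₀ hb₀
  let ψ : ℂ → ℂ := fun z => ∑ b ∈ A.erase b₀, (β b / (z - b) + δ b / (z - b) ^ 2)
  have hψ : ContinuousAt ψ b₀ := by
    refine tendsto_finsetSum _ fun b hb => ?_
    have hne : b₀ - b ≠ 0 := sub_ne_zero.2 (Finset.ne_of_mem_erase hb).symm
    have : ContinuousAt (fun z => β b / (z - b) + δ b / (z - b) ^ 2) b₀ := by
      fun_prop (disch := simpa using hne)
    exact this
  have hev : ∀ᶠ z in 𝓝[≠] b₀, β b₀ * (z - b₀) + δ b₀ + (z - b₀) ^ 2 * ψ z = 0 := by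
    have h1 : ∀ᶠ z in 𝓝[≠] b₀, z ∉ A.erase b₀ :=
      eventually_nhdsWithin_of_eventually_nhds
        ((A.erase b₀).finite_toSet.isClosed.isOpen_compl.mem_nhds (by simp))
    filter_upwards [h1, self_mem_nhdsWithin] with z hz hz0
    have hz0' : z ≠ b₀ := hz0
    have hzA : z ∉ A := fun h' => hz (Finset.mem_erase.2 ⟨hz0', h'⟩)
    have h2 := h z hzA
    rw [← Finset.add_sum_erase _ _ hb₀] at h2
    have hne := sub_ne_zero.2 hz0'
    have h3 : ψ z = -(β b₀ / (z - b₀) + δ b₀ / (z - b₀) ^ 2) := by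
      simp only [ψ]; linear_combination h2
    rw [h3]; field_simp; ring
  have hlim1 : Tendsto (fun z => β b₀ * (z - b₀) + δ b₀ + (z - b₀) ^ 2 * ψ z) (𝓝[≠] b₀)
      (𝓝 (δ b₀)) := by
    have h4 : ContinuousAt (fun z => β b₀ * (z - b₀) + δ b₀ + (z - b₀) ^ 2 * ψ z) b₀ := by fun_prop
    simpa [ContinuousAt] using h4.tendsto.mono_left nhdsWithin_le_nhds
  have hδ : δ b₀ = 0 :=
    tendsto_nhds_unique hlim1 (tendsto_const_nhds.congr' (hev.mono fun z hz => hz.symm))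
  refine ⟨?_, hδ⟩
  have hlim2 : Tendsto (fun z => β b₀ + (z - b₀) * ψ z) (𝓝[≠] b₀) (𝓝 (β b₀)) := by
    have h4 : ContinuousAt (fun z => β b₀ + (z - b₀) * ψ z) b₀ := by fun_prop
    simpa [ContinuousAt] using h4.tendsto.mono_left nhdsWithin_le_nhds
  refine tendsto_nhds_unique hlim2 (tendsto_const_nhds.congr' ?_)
  filter_upwards [hev, self_mem_nhdsWithin] with z hz hz0
  have hne : z - b₀ ≠ 0 := sub_ne_zero.2 hz0
  refine mul_left_cancel₀ hne ?_
  rw [hδ] at hz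
  linear_combination -hz

theorem false_of_transfer_matrix {c a : ℂ} {A : Finset ℂ}
    (hA : ∀ b ∈ A, IsAttractingPeriodic (cubic c a) b) {ι : Type*} [Fintype ι] [DecidableEq ι]
    {e h : ι → ℂ → ℂ} (hm : ∀ i, Measurable (e i))
    (ha : ∀ i, AnalyticOnNhd ℂ (e i) (A : Set ℂ)ᶜ)
    (hli : ∀ x : ι → ℂ, (∀ z, z ∉ A → ∑ i, x i * e i z = 0) → x = 0)
    {L : ι → ℂ} (hL : L ≠ 0) {B : Finset ℂ}
    (hrow : ∀ i, ∃ m : ι → ℂ, m ⬝ᵥ L = 0 ∧ ∀ x, x ∉ B → ∀ P, IsCubicFibre c a x P →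
      e i x - ∑ y ∈ P, e i y / (3 * (y ^ 2 - c ^ 2)) ^ 2 = m ⬝ᵥ fun j => h j x) : False := by
  choose M hM1 hM2 using hrow
  have hdet : (Matrix.of M).det = 0 :=
    Matrix.exists_mulVec_eq_zero_iff.1 ⟨L, hL, funext fun i => hM1 i⟩
  obtain ⟨x, hx0, hx⟩ := Matrix.exists_vecMul_eq_zero_iff.2 hdet
  refine hx0 (hli x ?_)
  refine eq_zero_of_transfer_fixed hA (φ := fun z => ∑ i, x i * e i z)
    (Finset.measurable_sum _ fun i _ => (hm i).const_mul _)
    (Finset.analyticOnNhd_fun_sum _ fun i _ => analyticOnNhd_const.mul (ha i)) ?_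
  have hfin : ({cubic c a c, cubic c a (-c)} ∪ (B : Set ℂ)).Finite :=
    (Set.toFinite _).union B.finite_toSet
  filter_upwards [hfin.countable.ae_notMem volume] with w hw
  simp only [mem_union, mem_insert_iff, mem_singleton_iff, Finset.mem_coe, not_or] at hw
  obtain ⟨P, hP⟩ := exists_isCubicFibre (Ne.symm hw.1.1) (Ne.symm hw.1.2)
  refine ⟨P, fun y hy => ⟨hP.map_eq y hy, hP.ne y hy⟩, ?_⟩
  have h1 : ∑ i, x i * (e i w - ∑ y ∈ P, e i y / (3 * (y ^ 2 - c ^ 2)) ^ 2) = 0 := by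
    have h2 : ∀ i, x i * (e i w - ∑ y ∈ P, e i y / (3 * (y ^ 2 - c ^ 2)) ^ 2) =
        x i * (M i ⬝ᵥ fun j => h j w) := fun i => by rw [hM2 i w hw.2 P hP]
    simp only [h2]
    calc ∑ i, x i * (M i ⬝ᵥ fun j => h j w) = x ⬝ᵥ (Matrix.of M *ᵥ fun j => h j w) := rfl
      _ = (x ᵥ* Matrix.of M) ⬝ᵥ fun j => h j w := Matrix.dotProduct_mulVec _ _ _
      _ = 0 := by rw [hx, zero_dotProduct]
  simp only [mul_sub, Finset.sum_sub_distrib, Finset.mul_sum] at h1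
  rw [sub_eq_zero.1 h1, Finset.sum_comm]
  refine Finset.sum_congr rfl fun y _ => ?_
  rw [Finset.sum_div]
  exact Finset.sum_congr rfl fun i _ => by ring

section rows

variable {c a c' a' : ℂ} {ι : Type*} [Fintype ι] [DecidableEq ι] {h : ι → ℂ → ℂ} {L : ι → ℂ}

theorem exists_row_simple (hc : c ≠ 0) {b ξ : ℂ} (hbc : b ≠ c) (hbc' : b ≠ -c) {i j k l : ι}
    (hi : ∀ x, h i x = 1 / (x - b)) (hj : ∀ x, h j x = 1 / (x - cubic c a b))
    (hk : ∀ x, h k x = 1 / (x - cubic c a c)) (hl : ∀ x, h l x = 1 / (x - cubic c a (-c)))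
    (Li : L i = ξ) (Lj : L j = 3 * (b ^ 2 - c ^ 2) * ξ + (-6 * c * c' * b + a'))
    (Lk : L k = -6 * c * c' * c + a') (Ll : L l = -6 * c * c' * (-c) + a') :
    ∃ m : ι → ℂ, m ⬝ᵥ L = 0 ∧ ∀ x, cubic c a c ≠ x → cubic c a (-c) ≠ x → cubic c a b ≠ x →
      ∀ P, IsCubicFibre c a x P →
      1 / (x - b) - ∑ y ∈ P, 1 / (y - b) / (3 * (y ^ 2 - c ^ 2)) ^ 2 = m ⬝ᵥ fun j => h j x := by
  refine ⟨(Pi.single i 1 : ι → ℂ) - (Pi.single j (1 / (3 * (b ^ 2 - c ^ 2))) : ι → ℂ) -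
    (Pi.single k (1 / (6 * c * (c - b))) : ι → ℂ) -
      (Pi.single l (1 / (6 * c * (c + b))) : ι → ℂ), ?_, ?_⟩
  · have hb1 : b - c ≠ 0 := sub_ne_zero.2 hbc
    have hb2 : b + c ≠ 0 := fun h => hbc' (eq_neg_of_add_eq_zero_left h)
    simp only [sub_dotProduct, single_dotProduct, Li, Lj, Lk, Ll]
    rw [show b ^ 2 - c ^ 2 = (b - c) * (b + c) by ring,
      show c - b = -(b - c) by ring, show c + b = b + c by ring]
    field_simp
    ring
  · intro x h1 h2 h3 P hP
    rw [hP.sum_simple_pole hc h1 h2 h3 hbc hbc']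
    simp only [sub_dotProduct, single_dotProduct, hi, hj, hk, hl]
    ring

theorem exists_row_crit (hc : c ≠ 0) {b ξ : ℂ} (hb : b = c ∨ b = -c) {i j k : ι}
    (hi : ∀ x, h i x = 1 / (x - b)) (hj : ∀ x, h j x = 1 / (x - cubic c a b))
    (hk : ∀ x, h k x = 1 / (x - cubic c a (-b)))
    (Li : L i = ξ) (hξ : c * ξ = b * c') (Lj : L j = -6 * c * c' * b + a')
    (Lk : L k = -6 * c * c' * (-b) + a') :
    ∃ m : ι → ℂ, m ⬝ᵥ L = 0 ∧ ∀ x, cubic c a c ≠ x → cubic c a (-c) ≠ x →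
      ∀ P, IsCubicFibre c a x P →
      1 / (x - b) - ∑ y ∈ P, 1 / (y - b) / (3 * (y ^ 2 - c ^ 2)) ^ 2 = m ⬝ᵥ fun j => h j x := by
  refine ⟨(Pi.single i 1 : ι → ℂ) + (Pi.single j (1 / (12 * c ^ 2)) : ι → ℂ) -
    (Pi.single k (1 / (12 * c ^ 2)) : ι → ℂ), ?_, ?_⟩
  · simp only [sub_dotProduct, add_dotProduct, single_dotProduct, Li, Lj, Lk]
    field_simp
    linear_combination 12 * c * hξ
  · intro x h1 h2 P hP
    rw [hP.sum_pole_crit hc h1 h2 hb]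
    simp only [sub_dotProduct, add_dotProduct, single_dotProduct, hi, hj, hk]
    ring

theorem exists_row_double (hc : c ≠ 0) {O : Finset ℂ} (hO : O.image (cubic c a) = O)
    (hbc : c ∉ O) (hbc' : -c ∉ O) {i : ℂ → ι} {k l : ι} {ξ : ℂ → ℂ}
    (hi : ∀ b ∈ O, ∀ x, h (i b) x = 1 / (x - b))
    (hk : ∀ x, h k x = 1 / (x - cubic c a c)) (hl : ∀ x, h l x = 1 / (x - cubic c a (-c)))
    (Li : ∀ b ∈ O, L (i b) = ξ b)
    (hξ : ∀ b ∈ O, ξ (cubic c a b) = 3 * (b ^ 2 - c ^ 2) * ξ b + (-6 * c * c' * b + a'))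
    (Lk : L k = -6 * c * c' * c + a') (Ll : L l = -6 * c * c' * (-c) + a')
    (hsum : ∑ b ∈ O, (6 * b * ξ b - 6 * c * c') / (3 * (b ^ 2 - c ^ 2)) = 0) :
    ∃ m : ι → ℂ, m ⬝ᵥ L = 0 ∧ ∀ x, cubic c a c ≠ x → cubic c a (-c) ≠ x →
      (∀ b ∈ O, cubic c a b ≠ x) → ∀ P, IsCubicFibre c a x P →
      ∑ b ∈ O, 1 / (x - b) ^ 2 - ∑ y ∈ P, (∑ b ∈ O, 1 / (y - b) ^ 2) / (3 * (y ^ 2 - c ^ 2)) ^ 2 =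
        m ⬝ᵥ fun j => h j x := by
  have hmem : ∀ b ∈ O, cubic c a b ∈ O := fun b hb => hO ▸ Finset.mem_image_of_mem _ hb
  have hinj : InjOn (cubic c a) (O : Set ℂ) := Finset.card_image_iff.1 (by rw [hO])
  refine ⟨∑ b ∈ O, ((Pi.single (i (cubic c a b)) (6 * b / (3 * (b ^ 2 - c ^ 2)) ^ 2) : ι → ℂ) -
    (Pi.single k (1 / (6 * c * (c - b) ^ 2)) : ι → ℂ) +
      (Pi.single l (1 / (6 * c * (c + b) ^ 2)) : ι → ℂ)), ?_, ?_⟩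
  · rw [sum_dotProduct, ← hsum]
    refine Finset.sum_congr rfl fun b hb => ?_
    have hb1 : b - c ≠ 0 := sub_ne_zero.2 fun h => hbc (h ▸ hb)
    have hb2 : b + c ≠ 0 := fun h => hbc' (eq_neg_of_add_eq_zero_left h ▸ hb)
    simp only [sub_dotProduct, add_dotProduct, single_dotProduct, Li _ (hmem b hb), hξ b hb, Lk, Ll]
    rw [show b ^ 2 - c ^ 2 = (b - c) * (b + c) by ring,
      show c - b = -(b - c) by ring, show c + b = b + c by ring]
    field_simp
    ring
  · intro x h1 h2 h3 P hP
    have e1 : ∑ b ∈ O, 1 / (x - b) ^ 2 = ∑ b ∈ O, 1 / (x - cubic c a b) ^ 2 := by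
      conv_lhs => rw [← hO]
      exact Finset.sum_image hinj
    simp only [Finset.sum_div]
    rw [Finset.sum_comm, e1, ← Finset.sum_sub_distrib, sum_dotProduct]
    refine Finset.sum_congr rfl fun b hb => ?_
    have := hP.sum_double_pole hc h1 h2 (h3 b hb) (fun h => hbc (h ▸ hb)) (fun h => hbc' (h ▸ hb))
    rw [this]
    simp only [sub_dotProduct, add_dotProduct, single_dotProduct, hi _ (hmem b hb), hk, hl]
    ring

end rows

theorem infinitesimal_rigidity {c a c' a' : ℂ} (hc : c ≠ 0) {A : Finset ℂ}
    (hA : ∀ b ∈ A, IsAttractingPeriodic (cubic c a) b) (hinv : ∀ b ∈ A, cubic c a b ∈ A)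
    (hcA : c ∈ A) {ξ : ℂ → ℂ}
    (hξ : ∀ b ∈ A, ξ (cubic c a b) = 3 * (b ^ 2 - c ^ 2) * ξ b + (-6 * c * c' * b + a'))
    (hξc : ξ c = c')
    (h : (-c ∈ A ∧ ξ (-c) = -c') ∨ (-c ∉ A ∧ ∃ O ⊆ A, O.Nonempty ∧ O.image (cubic c a) = O ∧
      c ∉ O ∧ ∑ b ∈ O, (6 * b * ξ b - 6 * c * c') / (3 * (b ^ 2 - c ^ 2)) = 0)) :
    c' = 0 ∧ a' = 0 := by
  by_contra hne
  have hfc : ξ (cubic c a c) = -6 * c * c' * c + a' := by rw [hξ c hcA]; ring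
  have hnz : ¬ ∀ b ∈ A, ξ b = 0 := by
    intro h0
    have h1 : c' = 0 := by rw [← hξc]; exact h0 c hcA
    refine hne ⟨h1, ?_⟩
    rw [h0 _ (hinv c hcA), h1] at hfc
    linear_combination -hfc
  have hmeas : ∀ b : ℂ, Measurable fun z : ℂ => 1 / (z - b) := fun b => by fun_prop
  have han : ∀ b ∈ A, AnalyticOnNhd ℂ (fun z : ℂ => 1 / (z - b)) (A : Set ℂ)ᶜ := by
    intro b hb z hz
    refine analyticAt_const.div (analyticAt_id.sub analyticAt_const) ?_
    exact sub_ne_zero.2 fun h => hz (by simpa [← h] using hb)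
  rcases h with ⟨hcA', hξc'⟩ | ⟨hcA', O, hOA, hOne, hO, hcO, hsum⟩
  · have hfc' : ξ (cubic c a (-c)) = -6 * c * c' * (-c) + a' := by rw [hξ (-c) hcA']; ring
    refine false_of_transfer_matrix hA (ι := A) (e := fun b z => 1 / (z - b))
      (h := fun b z => 1 / (z - b)) (L := fun b => ξ b) (B := A) (fun b => hmeas b)
      (fun b => han b b.2) ?_ ?_ ?_
    · intro x hx
      have := eq_zero_of_sum_poles_eq_zero (A := A)
        (β := fun b => if hb : b ∈ A then x ⟨b, hb⟩ else 0) (δ := 0) ?_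
      · ext ⟨b, hb⟩
        simpa [hb] using (this b hb).1
      · intro z hz
        refine Eq.trans ?_ (hx z hz)
        rw [← Finset.sum_coe_sort A]
        refine Finset.sum_congr rfl fun b _ => ?_
        simp [div_eq_mul_inv]
    · intro h0
      exact hnz fun b hb => congrFun h0 ⟨b, hb⟩
    · rintro ⟨b, hb⟩
      by_cases hbc : b = c ∨ b = -c
      · have hnb : -b ∈ A := by rcases hbc with rfl | rfl <;> simpa
        obtain ⟨m, hm1, hm2⟩ := exists_row_crit (a := a) (a' := a') (c' := c') (ξ := ξ b)
          (h := fun (b : A) z => 1 / (z - b)) (L := fun b : A => ξ b) hc hbc (i := ⟨b, hb⟩)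
          (j := ⟨_, hinv b hb⟩) (k := ⟨_, hinv _ hnb⟩)
          (fun _ => rfl) (fun _ => rfl) (fun _ => rfl) rfl
          (by rcases hbc with rfl | rfl
              · rw [hξc]
              · rw [hξc']; ring)
          (by rcases hbc with rfl | rfl <;> assumption)
          (by rcases hbc with rfl | rfl
              · exact hfc'
              · simpa using hfc)
        refine ⟨m, hm1, fun x hx P hP => hm2 x ?_ ?_ P hP⟩
        · exact fun h => hx (h ▸ hinv c hcA)
        · exact fun h => hx (h ▸ hinv _ hcA')
      · rw [not_or] at hbc
        obtain ⟨m, hm1, hm2⟩ := exists_row_simple (a := a) (a' := a') (c' := c') (ξ := ξ b)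
          (h := fun (b : A) z => 1 / (z - b)) (L := fun b : A => ξ b) hc hbc.1 hbc.2
          (i := ⟨b, hb⟩) (j := ⟨_, hinv b hb⟩) (k := ⟨_, hinv c hcA⟩) (l := ⟨_, hinv _ hcA'⟩)
          (fun _ => rfl) (fun _ => rfl) (fun _ => rfl) (fun _ => rfl) rfl (hξ b hb) hfc hfc'
        refine ⟨m, hm1, fun x hx P hP => hm2 x ?_ ?_ ?_ P hP⟩
        · exact fun h => hx (h ▸ hinv c hcA)
        · exact fun h => hx (h ▸ hinv _ hcA')
        · exact fun h => hx (h ▸ hinv b hb)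
  · let hh : Option A → ℂ → ℂ := fun i z =>
      i.elim (1 / (z - cubic c a (-c))) fun b => 1 / (z - b)
    let L : Option A → ℂ := fun i => i.elim (-6 * c * c' * (-c) + a') fun b => ξ b
    refine false_of_transfer_matrix hA (ι := Option A)
      (e := fun i z => i.elim (∑ b ∈ O, 1 / (z - b) ^ 2) fun b => 1 / (z - b))
      (h := hh) (L := L) (B := insert (cubic c a (-c)) A) ?_ ?_ ?_ ?_ ?_
    · rintro (_ | b)
      · exact Finset.measurable_sum _ fun b _ => by fun_prop
      · exact hmeas b
    · rintro (_ | b)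
      · refine Finset.analyticOnNhd_fun_sum _ fun b hb z hz => ?_
        refine analyticAt_const.div ((analyticAt_id.sub analyticAt_const).pow 2) ?_
        exact pow_ne_zero 2 (sub_ne_zero.2 fun h => hz (by simpa [← h] using hOA hb))
      · exact han b b.2
    · intro x hx
      have := eq_zero_of_sum_poles_eq_zero (A := A)
        (β := fun b => if hb : b ∈ A then x (some ⟨b, hb⟩) else 0)
        (δ := fun b => if b ∈ O then x none else 0) ?_
      · ext i
        rcases i with _ | ⟨b, hb⟩
        · obtain ⟨b, hb⟩ := hOne
          simpa [hb] using (this b (hOA hb)).2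
        · simpa [hb] using (this b hb).1
      · intro z hz
        refine Eq.trans ?_ (hx z hz)
        rw [Fintype.sum_option, Finset.sum_add_distrib, add_comm]
        congr 1
        · simp only [Option.elim, Finset.mul_sum, ite_div, zero_div]
          rw [← Finset.sum_filter, Finset.filter_mem_eq_inter, Finset.inter_eq_right.2 hOA]
          exact Finset.sum_congr rfl fun b _ => by ring
        · rw [← Finset.sum_coe_sort A]
          refine Finset.sum_congr rfl fun b _ => ?_
          simp [div_eq_mul_inv]
    · intro h0
      exact hnz fun b hb => congrFun h0 (some ⟨b, hb⟩)
    · have hB1 : ∀ x, x ∉ insert (cubic c a (-c)) A → cubic c a c ≠ x := fun x hx h =>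
        hx (Finset.mem_insert_of_mem (h ▸ hinv c hcA))
      have hB2 : ∀ x, x ∉ insert (cubic c a (-c)) A → cubic c a (-c) ≠ x := fun x hx h =>
        hx (h ▸ Finset.mem_insert_self _ _)
      rintro (_ | ⟨b, hb⟩)
      · obtain ⟨m, hm1, hm2⟩ := exists_row_double (a := a) (a' := a') (c' := c') (ξ := ξ)
          (h := hh) (L := L) hc hO hcO (fun h => hcA' (hOA h))
          (i := fun b => if hb : b ∈ A then some ⟨b, hb⟩ else none)
          (k := some ⟨_, hinv c hcA⟩) (l := none)
          (fun b hb x => by simp [hh, hOA hb]) (fun _ => rfl) (fun _ => rfl)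
          (fun b hb => by simp [L, hOA hb]) (fun b hb => hξ b (hOA hb)) hfc rfl hsum
        refine ⟨m, hm1, fun x hx P hP => hm2 x (hB1 x hx) (hB2 x hx) ?_ P hP⟩
        exact fun b hb h => hx (Finset.mem_insert_of_mem (h ▸ hinv b (hOA hb)))
      · by_cases hbc : b = c
        · obtain ⟨m, hm1, hm2⟩ := exists_row_crit (a := a) (a' := a') (c' := c') (ξ := ξ b)
            (h := hh) (L := L) hc (Or.inl hbc) (i := some ⟨b, hb⟩)
            (j := some ⟨_, hinv b hb⟩) (k := none)
            (fun _ => rfl) (fun _ => rfl) (fun _ => by simp [hh, hbc]) rfl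
            (by rw [hbc, hξc]) (by simp only [L, Option.elim, hbc, hfc]) (by simp [L, hbc])
          exact ⟨m, hm1, fun x hx P hP => hm2 x (hB1 x hx) (hB2 x hx) P hP⟩
        · obtain ⟨m, hm1, hm2⟩ := exists_row_simple (a := a) (a' := a') (c' := c') (ξ := ξ b)
            (h := hh) (L := L) hc hbc (fun h => hcA' (h ▸ hb)) (i := some ⟨b, hb⟩)
            (j := some ⟨_, hinv b hb⟩) (k := some ⟨_, hinv c hcA⟩) (l := none)
            (fun _ => rfl) (fun _ => rfl) (fun _ => rfl) (fun _ => rfl) rfl (hξ b hb) hfc rfl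
          refine ⟨m, hm1, fun x hx P hP => hm2 x (hB1 x hx) (hB2 x hx) ?_ P hP⟩
          exact fun h => hx (Finset.mem_insert_of_mem (h ▸ hinv b hb))

end

theorem IsLocalHomeomorph.exists_section {E X : Type*} [TopologicalSpace E] [T2Space E]
    [TopologicalSpace X] [T2Space X] [LocallyCompactSpace X] [SimplyConnectedSpace X]
    [LocallyPathConnectedSpace X] {f : E → X} (hf : IsLocalHomeomorph f)
    (hp : ∀ ⦃K⦄, IsCompact K → IsCompact (f ⁻¹' K)) (e₀ : E) :
    ∃ σ : X → E, Continuous σ ∧ (∀ x, f (σ x) = x) ∧ σ (f e₀) = e₀ ∧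
      (PreconnectedSpace E → ∀ e, σ (f e) = e) := by
  have hprop : IsProperMap f := isProperMap_iff_isCompact_preimage.2 ⟨hf.continuous, hp⟩
  have hcov : IsCoveringMap f := by
    rw [isCoveringMap_iff_isCoveringMapOn_univ]
    refine hprop.isClosedMap.isCoveringMapOn_of_isLocalHomeomorphOn (fun x _ => ?_)
      (hf.isLocalHomeomorphOn.mono (subset_univ _))
    refine (hp isCompact_singleton).finite ?_
    refine (hf.isLocalHomeomorphOn.mono (subset_univ _)).isDiscrete_of_image ?_
    exact (Set.Subsingleton.isDiscrete (subsingleton_singleton.anti (image_preimage_subset _ _)))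
  obtain ⟨F, ⟨h1, h2⟩, -⟩ := hcov.existsUnique_continuousMap_lifts
    (ContinuousMap.id X) (f e₀) e₀ rfl
  refine ⟨F, F.continuous, fun x => congrFun h2 x, h1, fun _ e => ?_⟩
  refine congrFun (hcov.eq_of_comp_eq (F.continuous.comp hf.continuous) continuous_id ?_ e₀ ?_) e
  · funext e
    exact congrFun h2 (f e)
  · simpa using h1

/-- A proper local homeomorphism onto an open convex subset of the plane admits sections. -/
theorem exists_section_of_proper {X : Type*} [TopologicalSpace X] [T2Space X] {H : Set X}
    {ρ : X → ℂ} {D : Set ℂ} (hD : IsOpen D) (hconv : Convex ℝ D) (hmaps : MapsTo ρ H D)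
    (hcont : ContinuousOn ρ H) (hopen : ∀ w ∈ H, 𝓝 (ρ w) ≤ map ρ (𝓝[H] w))
    (hinj : ∀ w ∈ H, ∃ N ∈ 𝓝[H] w, InjOn ρ N)
    (hproper : ∀ K ⊆ D, IsCompact K → IsCompact (H ∩ ρ ⁻¹' K)) {w₀ : X} (hw₀ : w₀ ∈ H) :
    ∃ σ : ℂ → X, ContinuousOn σ D ∧ (∀ v ∈ D, σ v ∈ H ∧ ρ (σ v) = v) ∧ σ (ρ w₀) = w₀ ∧
      (IsPreconnected H → ∀ w ∈ H, σ (ρ w) = w) := by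
  have hne : D.Nonempty := ⟨_, hmaps hw₀⟩
  have : ContractibleSpace D := hconv.contractibleSpace hne
  have : SimplyConnectedSpace D := SimplyConnectedSpace.ofContractible D
  have : LocallyPathConnectedSpace D := hD.locallyPathConnectedSpace
  have : LocallyCompactSpace D := hD.locallyCompactSpace
  let f : H → D := hmaps.restrict ρ H D
  have hfc : Continuous f := hcont.mapsToRestrict hmaps
  have hnhds (w : H) : 𝓝 (f w) ≤ map f (𝓝 w) := by
    intro S hS
    rw [mem_map] at hS
    have h1 : ((↑) : D → ℂ) '' S ∈ 𝓝 (ρ w) := by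
      apply hopen w w.2
      rw [mem_map]
      rw [nhds_subtype_eq_comap_nhdsWithin] at hS
      obtain ⟨t, ht, hts⟩ := hS
      filter_upwards [ht, self_mem_nhdsWithin] with x hx hxH
      exact ⟨f ⟨x, hxH⟩, hts (a := ⟨x, hxH⟩) hx, rfl⟩
    rw [nhds_subtype_eq_comap]
    refine ⟨_, h1, ?_⟩
    rintro x ⟨y, hy, hxy⟩
    rwa [← Subtype.ext hxy]
  have hfo : IsOpenMap f := IsOpenMap.of_nhds_le hnhds
  have hf : IsLocalHomeomorph f := by
    rw [isLocalHomeomorph_iff_isOpenEmbedding_restrict]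
    intro w
    obtain ⟨N, hN, hNi⟩ := hinj w w.2
    have hN' : ((↑) : H → X) ⁻¹' N ∈ 𝓝 w := by
      rw [nhds_subtype_eq_comap_nhdsWithin]
      exact preimage_mem_comap hN
    refine ⟨interior (((↑) : H → X) ⁻¹' N), interior_mem_nhds.2 hN', ?_⟩
    refine .of_continuous_injective_isOpenMap (hfc.comp continuous_subtype_val) ?_
      (hfo.domRestrict isOpen_interior)
    rintro ⟨x, hx⟩ ⟨y, hy⟩ hxy
    have := hNi (interior_subset hx : x ∈ ((↑) : H → X) ⁻¹' N)
      (interior_subset hy : y ∈ ((↑) : H → X) ⁻¹' N) (congrArg Subtype.val hxy)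
    exact Subtype.ext (Subtype.ext this)
  have hp : ∀ ⦃K⦄, IsCompact K → IsCompact (f ⁻¹' K) := by
    intro K hK
    rw [Subtype.isCompact_iff]
    convert hproper _ (Subtype.coe_image_subset D K) (hK.image continuous_subtype_val) using 1
    ext x
    constructor
    · rintro ⟨y, hy, rfl⟩
      exact ⟨y.2, f y, hy, rfl⟩
    · rintro ⟨hx, y, hy, hyx⟩
      refine ⟨⟨x, hx⟩, ?_, rfl⟩
      have : f ⟨x, hx⟩ = y := Subtype.ext hyx.symm
      simpa [this] using hy
  obtain ⟨σ, h1, h2, h3, h4⟩ := hf.exists_section hp ⟨w₀, hw₀⟩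
  classical
  have hs (v : ℂ) (hv : v ∈ D) : (if h : v ∈ D then (σ ⟨v, h⟩ : X) else w₀) =
    σ ⟨v, hv⟩ := dif_pos hv
  refine ⟨fun v => if h : v ∈ D then σ ⟨v, h⟩ else w₀, ?_, fun v hv => ?_, ?_, fun hH w hw => ?_⟩
  · rw [continuousOn_iff_continuous_domRestrict]
    convert continuous_subtype_val.comp h1 using 1
    funext v
    exact hs v v.2
  · simp only [hs v hv]
    exact ⟨(σ ⟨v, hv⟩).2, congrArg Subtype.val (h2 ⟨v, hv⟩)⟩
  · simp only [hs _ (hmaps hw₀)]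
    exact congrArg Subtype.val h3
  · simp only [hs _ (hmaps hw)]
    exact congrArg Subtype.val (h4 (isPreconnected_iff_preconnectedSpace.1 hH) ⟨w, hw⟩)

/-- For a polynomial-like map, every attracting cycle attracts a critical point. -/
theorem exists_critical_point_attracted {g : ℂ → ℂ} (hg : Differentiable ℂ g) {R : ℝ}
    (hR : ∀ z, ‖z‖ = R → R < ‖g z‖) {N : ℕ} {z₀ : ℂ} (hz : g^[N] z₀ = z₀)
    (hd : ‖deriv (g^[N]) z₀‖ < 1) (horb : ∀ i, ‖g^[i] z₀‖ < R) :
    ∃ x, ‖x‖ < R ∧ deriv g x = 0 ∧ ∃ j, Tendsto (fun k => g^[N * k + j] x) atTop (𝓝 z₀) := by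
  by_contra! hcon
  have hgn (n : ℕ) : Differentiable ℂ (g^[n]) := hg.iterate n
  have hR0 : 0 < R := (norm_nonneg _).trans_lt (horb 0)
  obtain ⟨κ, hκ0, hκ1, r, hr, hκ⟩ := exists_contracting_radius (hgn N z₀).hasDerivAt hz hd
  obtain ⟨δ, hδ, hδR⟩ : ∃ δ > 0, ball z₀ δ ⊆ ball 0 R :=
    Metric.isOpen_iff.1 isOpen_ball z₀ (by simpa using horb 0)
  set s := min r δ with hs
  have hs0 : 0 < s := lt_min hr hδ
  have hiter {z : ℂ} (hz : z ∈ ball z₀ s) :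
      Tendsto (fun k => g^[N * k] z) atTop (𝓝 z₀) := by
    simp only [iterate_mul]
    refine tendsto_iterate_of_contracting hκ0.le hκ1 hκ ?_
    rw [mem_ball, dist_eq_norm] at hz
    exact hz.le.trans (min_le_left _ _)
  let W (k : ℕ) : Set ℂ := {z | (∀ i ≤ N * k, g^[i] z ∈ ball (0 : ℂ) R) ∧ g^[N * k] z ∈ ball z₀ s}
  have hWopen (k : ℕ) : IsOpen (W k) := by
    have : W k = (⋂ i ∈ Finset.range (N * k + 1), (g^[i]) ⁻¹' ball (0 : ℂ) R) ∩
        (g^[N * k]) ⁻¹' ball z₀ s := by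
      ext z
      simp [W]
    rw [this]
    exact (isOpen_biInter_finset fun i _ => isOpen_ball.preimage (hgn i).continuous).inter
      (isOpen_ball.preimage (hgn _).continuous)
  have hWd {k : ℕ} {z : ℂ} (hz : z ∈ W k) : deriv (g^[N * k]) z ≠ 0 := by
    rw [deriv_iterate_eq_prod hg, Finset.prod_ne_zero_iff]
    intro i hi h0
    have hi' := Finset.mem_range.1 hi
    refine hcon (g^[i] z) (by simpa using hz.1 i hi'.le) h0 (N * k - i) ?_
    refine (hiter hz.2).congr fun m => ?_
    rw [← iterate_add_apply, ← iterate_add_apply]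
    exact congrArg (fun n => g^[n] z) (by omega)
  have hz₀W (k : ℕ) : z₀ ∈ W k := by
    refine ⟨fun i _ => by simpa using horb i, ?_⟩
    rw [iterate_mul, iterate_fixed hz]
    exact mem_ball_self hs0
  have hfix (k : ℕ) : g^[N * k] z₀ = z₀ := by rw [iterate_mul, iterate_fixed hz]
  have hsect (k : ℕ) : ∃ σ : ℂ → ℂ, ContinuousOn σ (ball z₀ s) ∧
      (∀ v ∈ ball z₀ s, σ v ∈ W k ∧ g^[N * k] (σ v) = v) ∧ σ z₀ = z₀ := by
    have hstrict (w : ℂ) : HasStrictDerivAt (g^[N * k]) (deriv (g^[N * k]) w) w :=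
      ((hgn (N * k)).analyticAt w).hasStrictDerivAt
    obtain ⟨σ, h1, h2, h3, -⟩ := exists_section_of_proper (H := W k) (ρ := g^[N * k])
      isOpen_ball (convex_ball z₀ s) (fun z hz => hz.2) (hgn _).continuous.continuousOn
      (fun w hw => by
        rw [(hWopen k).nhdsWithin_eq hw, (hstrict w).map_nhds_eq (hWd hw)])
      (fun w hw => by
        rw [(hWopen k).nhdsWithin_eq hw]
        refine ⟨_, (hstrict w).eventually_left_inverse (hWd hw), fun x hx y hy hxy => ?_⟩
        rw [← hx.out, ← hy.out, hxy])
      (fun K hK hKc => by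
        have hKR : K ⊆ ball 0 R := hK.trans ((ball_subset_ball (min_le_right _ _)).trans hδR)
        have : W k ∩ g^[N * k] ⁻¹' K =
            (⋂ i ∈ Finset.range (N * k + 1), (g^[i]) ⁻¹' closedBall (0 : ℂ) R) ∩
              g^[N * k] ⁻¹' K := by
          ext z
          constructor
          · rintro ⟨h1, h2⟩
            refine ⟨?_, h2⟩
            simp only [mem_iInter]
            intro i hi
            exact ball_subset_closedBall (h1.1 i (Nat.lt_succ_iff.1 (Finset.mem_range.1 hi)))
          · rintro ⟨h1, h2⟩
            refine ⟨⟨fun i hi => ?_, hK h2⟩, h2⟩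
            simp only [mem_iInter, Finset.mem_range, Nat.lt_succ_iff] at h1
            rcases hi.lt_or_eq with hi' | rfl
            · have h3 := h1 i hi
              have h4 := h1 (i + 1) hi'
              simp only [mem_preimage, mem_closedBall_zero_iff] at h3 h4
              rw [mem_ball_zero_iff]
              refine h3.lt_of_ne fun he => ?_
              have := hR _ he
              rw [← iterate_succ_apply' g] at this
              exact absurd h4 (not_le.2 this)
            · exact hKR h2
        rw [this]
        refine IsCompact.of_isClosed_subset (isCompact_closedBall (0 : ℂ) R) ?_ ?_
        · exact (isClosed_biInter fun i _ => isClosed_closedBall.preimage (hgn i).continuous).inter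
            (hKc.isClosed.preimage (hgn _).continuous)
        · intro z hz
          have := hz.1
          simp only [mem_iInter] at this
          exact this 0 (by simp))
      (hz₀W k)
    rw [hfix] at h3
    exact ⟨σ, h1, h2, h3⟩
  have hbound (k : ℕ) : (‖deriv (g^[N]) z₀‖ ^ k)⁻¹ ≤ R / (s / 2) := by
    obtain ⟨σ, h1, h2, h3⟩ := hsect k
    have hder {v : ℂ} (hv : v ∈ ball z₀ s) :
        HasDerivAt σ (deriv (g^[N * k]) (σ v))⁻¹ v := by
      refine HasDerivAt.of_local_left_inverse (h1.continuousAt (isOpen_ball.mem_nhds hv))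
        (hgn _ _).hasDerivAt (hWd (h2 v hv).1) ?_
      filter_upwards [isOpen_ball.mem_nhds hv] with y hy using (h2 y hy).2
    have hsub : closedBall z₀ (s / 2) ⊆ ball z₀ s := closedBall_subset_ball (by linarith)
    have hpow : deriv (g^[N * k]) z₀ = deriv (g^[N]) z₀ ^ k := by
      rw [iterate_mul]
      have := (HasDerivAt.iterate z₀ (hgn N z₀).hasDerivAt hz k).deriv
      rw [this]
    have hC := Complex.norm_deriv_le_of_forall_mem_sphere_norm_le (f := σ) (c := z₀) (R := s / 2)
      (C := R) (half_pos hs0)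
      (DifferentiableOn.diffContOnCl fun v hv =>
        ((hder (hsub (closure_ball_subset_closedBall hv))).differentiableAt.differentiableWithinAt))
      (fun z hz => by
        have := (h2 z (hsub (sphere_subset_closedBall hz))).1.1 0 (Nat.zero_le _)
        rw [iterate_zero, id, mem_ball_zero_iff] at this
        exact this.le)
    rw [(hder (mem_ball_self hs0)).deriv, h3, hpow, norm_inv, norm_pow] at hC
    exact hC
  have hne : deriv (g^[N]) z₀ ≠ 0 := by
    have := hWd (hz₀W 1)
    rwa [mul_one] at this
  have h1 : 1 < ‖deriv (g^[N]) z₀‖⁻¹ := (one_lt_inv₀ (norm_pos_iff.2 hne)).2 hd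
  obtain ⟨k, hk⟩ := pow_unbounded_of_one_lt (R / (s / 2)) h1
  have := hbound k
  rw [← inv_pow] at this
  exact absurd this (not_le.2 hk)

/-- A point attracted by two cycles forces the cycles to coincide. -/
theorem exists_iterate_eq_of_tendsto {g : ℂ → ℂ} (hg : Continuous g) {N₁ N₂ j₁ j₂ : ℕ}
    (hN₁ : 0 < N₁) (hN₂ : 0 < N₂) {x z₁ z₂ : ℂ}
    (h₁ : Tendsto (fun k => g^[N₁ * k + j₁] x) atTop (𝓝 z₁))
    (h₂ : Tendsto (fun k => g^[N₂ * k + j₂] x) atTop (𝓝 z₂)) :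
    g^[j₂] z₁ = g^[j₁] z₂ := by
  have e₁ : Tendsto (fun k : ℕ => N₂ * k) atTop atTop := tendsto_id.const_mul_atTop' hN₂
  have e₂ : Tendsto (fun k : ℕ => N₁ * k) atTop atTop := tendsto_id.const_mul_atTop' hN₁
  have k₁ := ((hg.iterate j₂).tendsto z₁).comp (h₁.comp e₁)
  have k₂ := ((hg.iterate j₁).tendsto z₂).comp (h₂.comp e₂)
  refine tendsto_nhds_unique k₁ (k₂.congr fun k => ?_)
  simp only [comp_apply, ← iterate_add_apply]
  exact congrArg (fun n => g^[n] x) (by ring)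

theorem deriv_iterate_apply_self {g : ℂ → ℂ} (hg : Differentiable ℂ g) {n : ℕ} {z : ℂ}
    (hz : g^[n] z = z) : deriv (g^[n]) (g z) = deriv (g^[n]) z := by
  rw [deriv_iterate_eq_prod hg, deriv_iterate_eq_prod hg]
  cases n with
  | zero => simp
  | succ m =>
    rw [Finset.prod_range_succ, Finset.prod_range_succ']
    simp only [← iterate_succ_apply, hz, iterate_zero, id]

theorem iterate_iterate_eq {g : ℂ → ℂ} {n : ℕ} {z : ℂ} (hz : g^[n] z = z) (i : ℕ) :
    g^[n] (g^[i] z) = g^[i] z := by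
  rw [← iterate_add_apply, add_comm, iterate_add_apply, hz]

theorem deriv_iterate_iterate {g : ℂ → ℂ} (hg : Differentiable ℂ g) {n : ℕ} {z : ℂ}
    (hz : g^[n] z = z) (i : ℕ) : deriv (g^[n]) (g^[i] z) = deriv (g^[n]) z := by
  induction i with
  | zero => rfl
  | succ i ih =>
    rw [iterate_succ_apply', deriv_iterate_apply_self hg (iterate_iterate_eq hz i), ih]

theorem injOn_iterate {g : ℂ → ℂ} {n : ℕ} (hn : 0 < n) {z : ℂ} (hz : g^[n] z = z)
    (hmin : ∀ k, 0 < k → k < n → g^[k] z ≠ z) : InjOn (fun i => g^[i] z) (Iio n) := by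
  have h : minimalPeriod g z = n := by
    refine (IsPeriodicPt.minimalPeriod_le hn hz).antisymm ?_
    by_contra! hlt
    exact hmin _ (IsPeriodicPt.minimalPeriod_pos hn hz) hlt (iterate_minimalPeriod ..)
  rw [← h]
  exact iterate_injOn_Iio_minimalPeriod

/-- `z` is an attracting periodic point of exact period `q` of a cubic whose critical point `c`
has exact period `p`; it attracts `-c` and is not on the orbit of `c`. -/
structure IsTypeDPoint (p q : ℕ) (c a z : ℂ) : Prop where
  pos_p : 0 < p
  pos_q : 0 < q
  per_c : (cubic c a)^[p] c = c
  min_c : ∀ k, 0 < k → k < p → (cubic c a)^[k] c ≠ c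
  per_z : (cubic c a)^[q] z = z
  min_z : ∀ k, 0 < k → k < q → (cubic c a)^[k] z ≠ z
  mult : ‖deriv ((cubic c a)^[q]) z‖ < 1
  tendsto : Tendsto (fun k => (cubic c a)^[q * k] (-c)) atTop (𝓝 z)
  disj : ∀ k, k < p → z ≠ (cubic c a)^[k] c

theorem three_mul_sq_sub_sq_ne_zero {c x : ℂ} (h1 : x ≠ c) (h2 : x ≠ -c) :
    3 * (x ^ 2 - c ^ 2) ≠ 0 := by
  rw [show 3 * (x ^ 2 - c ^ 2) = 3 * ((x - c) * (x + c)) by ring]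
  refine mul_ne_zero three_ne_zero (mul_ne_zero (sub_ne_zero.2 h1) ?_)
  rwa [← sub_neg_eq_add, sub_ne_zero]

namespace IsTypeDPoint

variable {p q : ℕ} {c a z : ℂ} (h : IsTypeDPoint p q c a z)
include h

theorem iterate_c_mod (k : ℕ) : (cubic c a)^[k] c = (cubic c a)^[k % p] c :=
  (IsPeriodicPt.iterate_mod_apply (f := cubic c a) h.per_c k).symm

theorem ne_iterate_c (i k : ℕ) : (cubic c a)^[i] z ≠ (cubic c a)^[k] c := by
  intro he
  have h1 : (cubic c a)^[(q - i % q)] ((cubic c a)^[i] z) = z := by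
    rw [← IsPeriodicPt.iterate_mod_apply (f := cubic c a) h.per_z i, ← iterate_add_apply,
      Nat.sub_add_cancel (Nat.mod_lt _ h.pos_q).le, h.per_z]
  rw [he, ← iterate_add_apply, h.iterate_c_mod] at h1
  exact h.disj _ (Nat.mod_lt _ h.pos_p) h1.symm

theorem neg_c_ne (k : ℕ) : -c ≠ (cubic c a)^[k] c := by
  intro he
  have hfin : ((fun i => (cubic c a)^[i] c) '' Iio p).Finite := (finite_Iio p).image _
  have : z ∈ (fun i => (cubic c a)^[i] c) '' Iio p := by
    refine hfin.isClosed.mem_of_tendsto h.tendsto (Eventually.of_forall fun m => ?_)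
    rw [he, ← iterate_add_apply, h.iterate_c_mod]
    exact ⟨_, Nat.mod_lt _ h.pos_p, rfl⟩
  obtain ⟨i, hi, hiz⟩ := this
  exact h.disj i hi hiz.symm

theorem c_ne_zero : c ≠ 0 := by
  intro hc
  exact h.neg_c_ne 0 (by simp [hc])

theorem transversal {c' a' : ℂ} {X Y : ℕ → ℂ} (hX0 : X 0 = c')
    (hX : ∀ n, X (n + 1) = 3 * (((cubic c a)^[n] c) ^ 2 - c ^ 2) * X n +
      (-6 * c * c' * (cubic c a)^[n] c + a')) (hXp : X p = c')
    (hY : ∀ n, Y (n + 1) = 3 * (((cubic c a)^[n] z) ^ 2 - c ^ 2) * Y n +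
      (-6 * c * c' * (cubic c a)^[n] z + a')) (hYq : Y q = Y 0)
    (hM : ∑ i ∈ Finset.range q,
      (∏ j ∈ (Finset.range q).erase i, (3 * (((cubic c a)^[j] z) ^ 2 - c ^ 2))) *
        (6 * (cubic c a)^[i] z * Y i - 6 * c * c') = 0) : c' = 0 ∧ a' = 0 ∧ Y 0 = 0 := by
  classical
  have hc := h.c_ne_zero
  have hic := injOn_iterate h.pos_p h.per_c h.min_c
  have hiz := injOn_iterate h.pos_q h.per_z h.min_z
  obtain ⟨ξ, hξX, hξY⟩ : ∃ ξ : ℂ → ℂ, (∀ i < p, ξ ((cubic c a)^[i] c) = X i) ∧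
      ∀ i < q, ξ ((cubic c a)^[i] z) = Y i := by
    have hinj : Injective (Sum.elim (fun i : Fin p => (cubic c a)^[i] c)
        (fun i : Fin q => (cubic c a)^[i] z)) :=
      Injective.sumElim (fun i j hij => Fin.ext (hic i.2 j.2 hij))
        (fun i j hij => Fin.ext (hiz i.2 j.2 hij)) fun i j => (h.ne_iterate_c j i).symm
    refine ⟨extend (Sum.elim (fun i : Fin p => (cubic c a)^[i] c)
      (fun i : Fin q => (cubic c a)^[i] z)) (Sum.elim (fun i : Fin p => X i)
        (fun i : Fin q => Y i)) 0, fun i hi => ?_, fun i hi => ?_⟩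
    · exact hinj.extend_apply _ _ (Sum.inl ⟨i, hi⟩)
    · exact hinj.extend_apply _ _ (Sum.inr ⟨i, hi⟩)
  set Oc := (Finset.range p).image fun i => (cubic c a)^[i] c with hOc
  set Oz := (Finset.range q).image fun i => (cubic c a)^[i] z with hOz
  have memOc (i : ℕ) : (cubic c a)^[i] c ∈ Oc := by
    rw [h.iterate_c_mod]
    exact Finset.mem_image.2 ⟨_, Finset.mem_range.2 (Nat.mod_lt _ h.pos_p), rfl⟩
  have memOz (i : ℕ) : (cubic c a)^[i] z ∈ Oz := by
    rw [← IsPeriodicPt.iterate_mod_apply (f := cubic c a) h.per_z i]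
    exact Finset.mem_image.2 ⟨_, Finset.mem_range.2 (Nat.mod_lt _ h.pos_q), rfl⟩
  have hA (b : ℂ) (hb : b ∈ Oc ∪ Oz) : (∃ i < p, b = (cubic c a)^[i] c) ∨
      ∃ i < q, b = (cubic c a)^[i] z := by
    simp only [hOc, hOz, Finset.mem_union, Finset.mem_image, Finset.mem_range] at hb
    grind
  have hdc : deriv ((cubic c a)^[p]) c = 0 := by
    rw [deriv_iterate_eq_prod (cubic_differentiable c a)]
    exact Finset.prod_eq_zero (Finset.mem_range.2 h.pos_p) (by simp [cubic_deriv])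
  have hξ : ∀ b ∈ Oc ∪ Oz,
      ξ (cubic c a b) = 3 * (b ^ 2 - c ^ 2) * ξ b + (-6 * c * c' * b + a') := by
    intro b hb
    rcases hA b hb with ⟨i, hi, rfl⟩ | ⟨i, hi, rfl⟩
    · rw [hξX i hi, ← hX, ← iterate_succ_apply' (cubic c a)]
      rcases (Nat.succ_le_of_lt hi).lt_or_eq with h1 | h1
      · exact hξX _ h1
      · rw [h1, h.per_c, ← Nat.succ_eq_add_one, h1, hXp]
        exact (hξX 0 h.pos_p).trans hX0
    · rw [hξY i hi, ← hY, ← iterate_succ_apply' (cubic c a)]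
      rcases (Nat.succ_le_of_lt hi).lt_or_eq with h1 | h1
      · exact hξY _ h1
      · rw [h1, h.per_z, ← Nat.succ_eq_add_one, h1, hYq]
        exact hξY 0 h.pos_q
  have hcase : (-c ∈ Oc ∪ Oz ∧ ξ (-c) = -c') ∨ (-c ∉ Oc ∪ Oz ∧ ∃ O ⊆ Oc ∪ Oz, O.Nonempty ∧
      O.image (cubic c a) = O ∧ c ∉ O ∧
        ∑ b ∈ O, (6 * b * ξ b - 6 * c * c') / (3 * (b ^ 2 - c ^ 2)) = 0) := by
    have hzc (j : ℕ) : (cubic c a)^[j] z ≠ c := h.ne_iterate_c j 0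
    by_cases hm : -c ∈ Oc ∪ Oz
    · refine .inl ⟨hm, ?_⟩
      rcases hA _ hm with ⟨i, hi, hic⟩ | ⟨i, hi, hic⟩
      · exact absurd hic (h.neg_c_ne i)
      · rw [Finset.sum_eq_single_of_mem i (Finset.mem_range.2 hi)] at hM
        · have hne : ∏ j ∈ (Finset.range q).erase i,
              (3 * (((cubic c a)^[j] z) ^ 2 - c ^ 2)) ≠ 0 := by
            refine Finset.prod_ne_zero_iff.2 fun j hj => ?_
            rw [Finset.mem_erase, Finset.mem_range] at hj
            refine three_mul_sq_sub_sq_ne_zero (hzc j) fun hjc => hj.1 ?_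
            exact hiz hj.2 hi (hjc.trans hic)
          have h1 := (mul_eq_zero.1 hM).resolve_left hne
          rw [← hξY i hi, ← hic] at h1
          have h2 : c * (ξ (-c) + c') = 0 := by linear_combination (-1 / 6) * h1
          exact eq_neg_of_add_eq_zero_left ((mul_eq_zero.1 h2).resolve_left hc)
        · intro j hj hji
          refine mul_eq_zero_of_left (Finset.prod_eq_zero (i := i) ?_ ?_) _
          · exact Finset.mem_erase.2 ⟨hji.symm, Finset.mem_range.2 hi⟩
          · rw [← hic]; ring
    · refine .inr ⟨hm, Oz, Finset.subset_union_right, ⟨z, memOz 0⟩, ?_, ?_, ?_⟩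
      · refine Finset.eq_of_subset_of_card_le ?_ ?_
        · intro b hb
          obtain ⟨x, hx, rfl⟩ := Finset.mem_image.1 hb
          obtain ⟨i, hi, rfl⟩ := Finset.mem_image.1 hx
          simpa only [← iterate_succ_apply' (cubic c a)] using memOz (i + 1)
        · refine Finset.card_le_card ?_
          intro x hx
          obtain ⟨i, hi, rfl⟩ := Finset.mem_image.1 hx
          refine Finset.mem_image.2 ⟨(cubic c a)^[i + (q - 1)] z, memOz _, ?_⟩
          rw [← iterate_succ_apply' (cubic c a),
              show (i + (q - 1)).succ = i + q by have := h.pos_q; omega,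
            iterate_add_apply, h.per_z]
      · intro hcz
        obtain ⟨i, hi, hic⟩ := Finset.mem_image.1 hcz
        exact hzc i hic
      · have hne (j : ℕ) : 3 * (((cubic c a)^[j] z) ^ 2 - c ^ 2) ≠ 0 := by
          refine three_mul_sq_sub_sq_ne_zero (hzc j) fun hjc => hm ?_
          rw [← hjc]
          exact Finset.mem_union_right _ (memOz j)
        rw [hOz, Finset.sum_image fun i hi j hj hij =>
          hiz (by simpa using hi) (by simpa using hj) hij]
        have hP : ∏ j ∈ Finset.range q, (3 * (((cubic c a)^[j] z) ^ 2 - c ^ 2)) ≠ 0 :=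
          Finset.prod_ne_zero_iff.2 fun j _ => hne j
        refine (mul_eq_zero.1 ((Finset.mul_sum _ _ _).trans (Eq.trans ?_ hM))).resolve_left hP
        refine Finset.sum_congr rfl fun i hi => ?_
        rw [← Finset.mul_prod_erase _ _ hi, hξY i (Finset.mem_range.1 hi)]
        rw [mul_comm (3 * _), mul_assoc, mul_div_cancel₀ _ (hne i)]
  obtain ⟨h1, h2⟩ := infinitesimal_rigidity hc (A := Oc ∪ Oz) (c' := c') (a' := a') (ξ := ξ)
    (fun b hb => by
      rcases hA b hb with ⟨i, hi, rfl⟩ | ⟨i, hi, rfl⟩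
      · refine ⟨p, h.pos_p, iterate_iterate_eq h.per_c i, ?_⟩
        rw [deriv_iterate_iterate (cubic_differentiable c a) h.per_c, hdc]
        simp
      · refine ⟨q, h.pos_q, iterate_iterate_eq h.per_z i, ?_⟩
        rw [deriv_iterate_iterate (cubic_differentiable c a) h.per_z]
        exact h.mult)
    (fun b hb => by
      rcases hA b hb with ⟨i, hi, rfl⟩ | ⟨i, hi, rfl⟩
      · rw [← iterate_succ_apply' (cubic c a)]
        exact Finset.mem_union_left _ (memOc _)
      · rw [← iterate_succ_apply' (cubic c a)]
        exact Finset.mem_union_right _ (memOz _))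
    (Finset.mem_union_left _ (memOc 0)) hξ ((hξX 0 h.pos_p).trans hX0) hcase
  refine ⟨h1, h2, ?_⟩
  have hYn (n : ℕ) : Y n = deriv ((cubic c a)^[n]) z * Y 0 := by
    rw [deriv_iterate_eq_prod (cubic_differentiable c a)]
    induction n with
    | zero => simp
    | succ n ih =>
      rw [hY, Finset.prod_range_succ, ih, cubic_deriv, h1, h2]
      ring
  have h3 : (deriv ((cubic c a)^[q]) z - 1) * Y 0 = 0 := by
    rw [sub_mul, ← hYn, hYq, one_mul, sub_self]
  refine (mul_eq_zero.1 h3).resolve_left fun h4 => ?_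
  have := h.mult
  rw [sub_eq_zero.1 h4] at this
  simp at this

end IsTypeDPoint

section
variable {E : Type*} [NormedAddCommGroup E] [NormedSpace ℂ E] {m : WithTop ℕ∞} {c a z : E → ℂ}

theorem contDiff_cubic_iterate (hc : ContDiff ℂ m c) (ha : ContDiff ℂ m a) (hz : ContDiff ℂ m z)
    (n : ℕ) : ContDiff ℂ m fun u => (cubic (c u) (a u))^[n] (z u) := by
  induction n with
  | zero => exact hz
  | succ n ih =>
    simp only [iterate_succ_apply', cubic]
    fun_prop

theorem contDiff_deriv_cubic_iterate (hc : ContDiff ℂ m c) (ha : ContDiff ℂ m a)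
    (hz : ContDiff ℂ m z) (n : ℕ) :
    ContDiff ℂ m fun u => deriv ((cubic (c u) (a u))^[n]) (z u) := by
  simp only [deriv_iterate_eq_prod (cubic_differentiable _ _), cubic_deriv]
  refine contDiff_prod fun i _ => ?_
  have := contDiff_cubic_iterate hc ha hz i
  fun_prop

end

section
variable {c a z : ℂ → ℂ} {c' a' t : ℂ}

theorem hasDerivAt_cubic_iterate (hc : HasDerivAt c c' t) (ha : HasDerivAt a a' t) {X : ℕ → ℂ}
    (hz : HasDerivAt z (X 0) t)
    (hX : ∀ n, X (n + 1) = 3 * (((cubic (c t) (a t))^[n] (z t)) ^ 2 - c t ^ 2) * X n +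
      (-6 * c t * c' * (cubic (c t) (a t))^[n] (z t) + a')) (n : ℕ) :
    HasDerivAt (fun s => (cubic (c s) (a s))^[n] (z s)) (X n) t := by
  induction n with
  | zero => exact hz
  | succ n ih =>
    simp only [iterate_succ_apply', cubic]
    refine (((ih.fun_pow 3).fun_sub (((hc.fun_pow 2).const_mul 3).fun_mul ih)).fun_add
      ha).congr_deriv ?_
    rw [hX]
    push_cast
    ring

theorem hasDerivAt_deriv_cubic_iterate (hc : HasDerivAt c c' t) (ha : HasDerivAt a a' t)
    {X : ℕ → ℂ} (hz : HasDerivAt z (X 0) t)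
    (hX : ∀ n, X (n + 1) = 3 * (((cubic (c t) (a t))^[n] (z t)) ^ 2 - c t ^ 2) * X n +
      (-6 * c t * c' * (cubic (c t) (a t))^[n] (z t) + a')) (n : ℕ) :
    HasDerivAt (fun s => deriv ((cubic (c s) (a s))^[n]) (z s))
      (∑ i ∈ Finset.range n, (∏ j ∈ (Finset.range n).erase i,
        (3 * (((cubic (c t) (a t))^[j] (z t)) ^ 2 - c t ^ 2))) *
          (6 * (cubic (c t) (a t))^[i] (z t) * X i - 6 * c t * c')) t := by
  simp only [deriv_iterate_eq_prod (cubic_differentiable _ _), cubic_deriv]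
  have h (i : ℕ) : HasDerivAt (fun s => 3 * (((cubic (c s) (a s))^[i] (z s)) ^ 2 - c s ^ 2))
      (6 * (cubic (c t) (a t))^[i] (z t) * X i - 6 * c t * c') t := by
    refine ((((hasDerivAt_cubic_iterate hc ha hz hX i).fun_pow 2).fun_sub (hc.fun_pow 2)).const_mul
      3).congr_deriv ?_
    push_cast
    ring
  exact HasDerivAt.fun_finsetProd fun i _ => h i

end

/-- The map whose zero fibre in the first two coordinates is the curve of parameters with a
marked periodic point, and whose last coordinate is the multiplier. -/
noncomputable def multiplierMap (p q : ℕ) (u : (ℂ × ℂ) × ℂ) : (ℂ × ℂ) × ℂ :=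
  (((cubic u.1.1 u.1.2)^[p] u.1.1 - u.1.1, (cubic u.1.1 u.1.2)^[q] u.2 - u.2),
    deriv ((cubic u.1.1 u.1.2)^[q]) u.2)

theorem multiplierMap_contDiff (p q : ℕ) {m : WithTop ℕ∞} : ContDiff ℂ m (multiplierMap p q) := by
  have h1 : ContDiff ℂ m fun u : (ℂ × ℂ) × ℂ => u.1.1 := by fun_prop
  have h2 : ContDiff ℂ m fun u : (ℂ × ℂ) × ℂ => u.1.2 := by fun_prop
  have h3 : ContDiff ℂ m fun u : (ℂ × ℂ) × ℂ => u.2 := by fun_prop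
  exact (((contDiff_cubic_iterate h1 h2 h1 p).sub h1).prodMk
    ((contDiff_cubic_iterate h1 h2 h3 q).sub h3)).prodMk
    (contDiff_deriv_cubic_iterate h1 h2 h3 q)

/-- The solution of the linearised iteration with initial value `x₀`. -/
noncomputable def tangentSeq (c a z c' a' x₀ : ℂ) : ℕ → ℂ
  | 0 => x₀
  | n + 1 => 3 * (((cubic c a)^[n] z) ^ 2 - c ^ 2) * tangentSeq c a z c' a' x₀ n +
      (-6 * c * c' * (cubic c a)^[n] z + a')

namespace IsTypeDPoint

variable {p q : ℕ} {c a z : ℂ} (h : IsTypeDPoint p q c a z)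
include h

theorem fderiv_multiplierMap_injective :
    Injective (fderiv ℂ (multiplierMap p q) ((c, a), z)) := by
  rw [injective_iff_map_eq_zero]
  rintro ⟨⟨c', a'⟩, z'⟩ hv
  have hd : HasFDerivAt (multiplierMap p q) (fderiv ℂ (multiplierMap p q) ((c, a), z))
      (((c, a), z) + (0 : ℂ) • (((c', a'), z') : (ℂ × ℂ) × ℂ)) := by
    rw [zero_smul, add_zero]
    exact ((multiplierMap_contDiff p q (m := 1)).differentiable one_ne_zero _).hasFDerivAt
  have hl (x y : ℂ) : HasDerivAt (fun t : ℂ => x + t * y) y 0 := by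
    simpa using ((hasDerivAt_id (0 : ℂ)).mul_const y).const_add x
  have hline : HasDerivAt (fun t : ℂ => ((c, a), z) + t • (((c', a'), z') : (ℂ × ℂ) × ℂ))
      ((c', a'), z') 0 := by
    simpa using ((hasDerivAt_id (0 : ℂ)).smul_const (((c', a'), z') : (ℂ × ℂ) × ℂ)).const_add
      ((c, a), z)
  have hcomp := hd.comp_hasDerivAt (0 : ℂ) hline
  rw [hv] at hcomp
  have hc := hl c c'
  have ha := hl a a'
  have hz := hl z z'
  have k1 := (hasDerivAt_cubic_iterate hc ha (z := fun t => c + t * c')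
    (X := tangentSeq c a c c' a' c') hc
    (fun n => by simp [tangentSeq]) p).fun_sub hc
  have k2 := (hasDerivAt_cubic_iterate hc ha (X := tangentSeq c a z c' a' z') hz
    (fun n => by simp [tangentSeq]) q).fun_sub hz
  have k3 := hasDerivAt_deriv_cubic_iterate hc ha (X := tangentSeq c a z c' a' z') hz
    (fun n => by simp [tangentSeq]) q
  have e := (((k1.prodMk k2).prodMk k3).unique hcomp)
  simp only [zero_mul, add_zero, Prod.mk_eq_zero] at e
  obtain ⟨⟨e1, e2⟩, e3⟩ := e
  obtain ⟨r1, r2, r3⟩ := h.transversal (c' := c') (a' := a') (X := tangentSeq c a c c' a' c')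
    (Y := tangentSeq c a z c' a' z') rfl (fun n => rfl) (sub_eq_zero.1 e1) (fun n => rfl)
    (sub_eq_zero.1 e2) e3
  rw [r1, r2, show z' = 0 from r3]
  rfl

theorem exists_local_section : ∃ s : ℂ → (ℂ × ℂ) × ℂ,
    Tendsto s (𝓝 (deriv ((cubic c a)^[q]) z)) (𝓝 ((c, a), z)) ∧
    (∀ᶠ v in 𝓝 (deriv ((cubic c a)^[q]) z), ContinuousAt s v) ∧
    (∀ᶠ v in 𝓝 (deriv ((cubic c a)^[q]) z), multiplierMap p q (s v) = ((0, 0), v)) ∧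
    ∀ᶠ u in 𝓝 ((c, a), z), (multiplierMap p q u).1 = (0, 0) → s (multiplierMap p q u).2 = u := by
  let L := (LinearEquiv.ofInjectiveEndo (fderiv ℂ (multiplierMap p q) ((c, a), z)).toLinearMap
    h.fderiv_multiplierMap_injective).toContinuousLinearEquiv
  have hL : (L : (ℂ × ℂ) × ℂ →L[ℂ] (ℂ × ℂ) × ℂ) = fderiv ℂ (multiplierMap p q) ((c, a), z) := by
    ext <;> rfl
  have hs : HasStrictFDerivAt (multiplierMap p q) (L : (ℂ × ℂ) × ℂ →L[ℂ] (ℂ × ℂ) × ℂ)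
      ((c, a), z) := by
    rw [hL]
    exact ((multiplierMap_contDiff p q (m := 1)).contDiffAt).hasStrictFDerivAt one_ne_zero
  set e := hs.toOpenPartialHomeomorph (multiplierMap p q) with he
  have hval : multiplierMap p q ((c, a), z) = ((0, 0), deriv ((cubic c a)^[q]) z) := by
    simp [multiplierMap, h.per_c, h.per_z]
  have hcont : Continuous fun v : ℂ => (((0, 0), v) : (ℂ × ℂ) × ℂ) := by fun_prop
  have htgt : ((0, 0), deriv ((cubic c a)^[q]) z) ∈ e.target := by
    rw [← hval]
    exact hs.image_mem_toOpenPartialHomeomorph_target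
  have hev : ∀ᶠ v in 𝓝 (deriv ((cubic c a)^[q]) z), (((0, 0), v) : (ℂ × ℂ) × ℂ) ∈ e.target :=
    hcont.continuousAt.eventually_mem (e.open_target.mem_nhds htgt)
  have hca {v : ℂ} (hv : (((0, 0), v) : (ℂ × ℂ) × ℂ) ∈ e.target) :
      ContinuousAt (fun v : ℂ => e.symm ((0, 0), v)) v :=
    ContinuousAt.comp (f := fun v : ℂ => (((0, 0), v) : (ℂ × ℂ) × ℂ)) (e.continuousAt_symm hv)
      hcont.continuousAt
  refine ⟨fun v => e.symm ((0, 0), v), ?_, ?_, ?_, ?_⟩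
  · have := (hca htgt).tendsto
    rwa [← hval, show e.symm (multiplierMap p q ((c, a), z)) = ((c, a), z) from
      e.left_inv hs.mem_toOpenPartialHomeomorph_source] at this
  · exact hev.mono fun v hv => hca hv
  · exact hev.mono fun v hv => e.right_inv hv
  · filter_upwards [e.open_source.mem_nhds hs.mem_toOpenPartialHomeomorph_source] with u hu h0
    rw [← h0]
    exact e.left_inv hu

end IsTypeDPoint

theorem continuous_cubic_iterate {X : Type*} [TopologicalSpace X] {c a z : X → ℂ}
    (hc : Continuous c) (ha : Continuous a) (hz : Continuous z) (n : ℕ) :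
    Continuous fun u => (cubic (c u) (a u))^[n] (z u) := by
  induction n with
  | zero => simpa using hz
  | succ n ih =>
    simp only [iterate_succ_apply']
    unfold cubic at ih ⊢
    fun_prop

theorem continuous_deriv_cubic_iterate {X : Type*} [TopologicalSpace X] {c a z : X → ℂ}
    (hc : Continuous c) (ha : Continuous a) (hz : Continuous z) (n : ℕ) :
    Continuous fun u => deriv ((cubic (c u) (a u))^[n]) (z u) := by
  simp only [deriv_iterate_eq_prod (cubic_differentiable _ _), cubic_deriv]
  refine continuous_finsetProd _ fun i _ => ?_
  have := continuous_cubic_iterate hc ha hz i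
  fun_prop

/-- `F` maps the closed ball `closedBall z₀ r` into itself and contracts it by the factor `κ`. -/
structure ContractsBall (F : ℂ → ℂ) (z₀ : ℂ) (r κ : ℝ) : Prop where
  mapsTo : MapsTo F (closedBall z₀ r) (closedBall z₀ r)
  norm_deriv_le : ∀ x ∈ closedBall z₀ r, ‖deriv F x‖ ≤ κ
  lipschitz : ∀ x ∈ closedBall z₀ r, ∀ y ∈ closedBall z₀ r, ‖F x - F y‖ ≤ κ * ‖x - y‖

theorem ContractsBall.norm_iterate_sub_le {F : ℂ → ℂ} {z₀ : ℂ} {r κ : ℝ}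
    (h : ContractsBall F z₀ r κ) (hκ : 0 ≤ κ) {x z : ℂ} (hx : x ∈ closedBall z₀ r)
    (hz : z ∈ closedBall z₀ r) (hFz : F z = z) (k : ℕ) : ‖F^[k] x - z‖ ≤ κ ^ k * (2 * r) := by
  induction k with
  | zero =>
    rw [mem_closedBall, dist_eq_norm] at hx hz
    calc ‖x - z‖ = ‖(x - z₀) - (z - z₀)‖ := by congr 1; ring
      _ ≤ κ ^ 0 * (2 * r) := by linarith [norm_sub_le (x - z₀) (z - z₀)]
  | succ k ih =>
    have h1 := h.lipschitz _ (h.mapsTo.iterate k hx) z hz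
    rw [hFz] at h1
    rw [iterate_succ_apply', pow_succ']
    nlinarith

theorem ContractsBall.tendsto {F : ℂ → ℂ} {z₀ : ℂ} {r κ : ℝ}
    (h : ContractsBall F z₀ r κ) (hκ : 0 ≤ κ) (hκ1 : κ < 1) {x z : ℂ} (hx : x ∈ closedBall z₀ r)
    (hz : z ∈ closedBall z₀ r) (hFz : F z = z) : Tendsto (fun k => F^[k] x) atTop (𝓝 z) := by
  rw [tendsto_iff_norm_sub_tendsto_zero]
  refine squeeze_zero (fun _ => norm_nonneg _) (h.norm_iterate_sub_le hκ hx hz hFz) ?_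
  simpa using (tendsto_pow_atTop_nhds_zero_of_lt_one hκ hκ1).mul_const (2 * r)

theorem ContractsBall.eq_of_fixed {F : ℂ → ℂ} {z₀ : ℂ} {r κ : ℝ}
    (h : ContractsBall F z₀ r κ) (hκ1 : κ < 1) {x z : ℂ} (hx : x ∈ closedBall z₀ r)
    (hz : z ∈ closedBall z₀ r) (hFx : F x = x) (hFz : F z = z) : x = z := by
  have h1 := h.lipschitz x hx z hz
  rw [hFx, hFz] at h1
  by_contra hne
  have : 0 < ‖x - z‖ := norm_pos_iff.2 (sub_ne_zero.2 hne)
  nlinarith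

theorem exists_contractsBall {w₀ : ℂ × ℂ} {z₀ : ℂ} {q : ℕ}
    (hfix : (cubic w₀.1 w₀.2)^[q] z₀ = z₀) (hd : ‖deriv ((cubic w₀.1 w₀.2)^[q]) z₀‖ < 1) {ε : ℝ}
    (hε : 0 < ε) : ∃ κ : ℝ, 0 ≤ κ ∧ κ < 1 ∧ ∃ r : ℝ, 0 < r ∧ r < ε ∧
      ∀ᶠ w in 𝓝 w₀, ContractsBall ((cubic w.1 w.2)^[q]) z₀ r κ := by
  obtain ⟨κ, hκ, hκ1⟩ := exists_between hd
  have hκ0 : 0 ≤ κ := (norm_nonneg _).trans hκ.le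
  have hc1 : Continuous fun u : (ℂ × ℂ) × ℂ => deriv ((cubic u.1.1 u.1.2)^[q]) u.2 :=
    continuous_deriv_cubic_iterate (by fun_prop) (by fun_prop) (by fun_prop) q
  have hc2 : Continuous fun w : ℂ × ℂ => (cubic w.1 w.2)^[q] z₀ :=
    continuous_cubic_iterate (by fun_prop) (by fun_prop) (by fun_prop) q
  have h1 : ∀ᶠ u in 𝓝 w₀ ×ˢ 𝓝 z₀, ‖deriv ((cubic u.1.1 u.1.2)^[q]) u.2‖ < κ := by
    rw [← nhds_prod_eq]
    exact (hc1.norm.tendsto (w₀, z₀)).eventually (gt_mem_nhds hκ)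
  obtain ⟨P, hP, Q, hQ, hPQ⟩ := eventually_prod_iff.1 h1
  obtain ⟨δ, hδ, hδQ⟩ := Metric.eventually_nhds_iff.1 hQ
  set r := min δ ε / 2 with hr
  have hr0 : 0 < r := half_pos (lt_min hδ hε)
  have hrδ : r < δ := by have := min_le_left δ ε; have := lt_min hδ hε; linarith
  have hrε : r < ε := by have := min_le_right δ ε; have := lt_min hδ hε; linarith
  refine ⟨κ, hκ0, hκ1, r, hr0, hrε, ?_⟩
  have h2 : ∀ᶠ w in 𝓝 w₀, ‖(cubic w.1 w.2)^[q] z₀ - z₀‖ < (1 - κ) * r := by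
    have : Tendsto (fun w : ℂ × ℂ => ‖(cubic w.1 w.2)^[q] z₀ - z₀‖) (𝓝 w₀) (𝓝 0) := by
      have h3 : Continuous fun w : ℂ × ℂ => ‖(cubic w.1 w.2)^[q] z₀ - z₀‖ :=
        (hc2.sub continuous_const).norm
      simpa [hfix] using h3.tendsto w₀
    exact this.eventually (gt_mem_nhds (mul_pos (sub_pos.2 hκ1) hr0))
  filter_upwards [hP, h2] with w hw hw2
  have hder : ∀ x ∈ closedBall z₀ r, ‖deriv ((cubic w.1 w.2)^[q]) x‖ ≤ κ := fun x hx =>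
    (hPQ hw (hδQ ((mem_closedBall.1 hx).trans_lt hrδ))).le
  have hlip : ∀ x ∈ closedBall z₀ r, ∀ y ∈ closedBall z₀ r,
      ‖(cubic w.1 w.2)^[q] x - (cubic w.1 w.2)^[q] y‖ ≤ κ * ‖x - y‖ := fun x hx y hy =>
    (convex_closedBall z₀ r).norm_image_sub_le_of_norm_deriv_le
      (fun u _ => (cubic_differentiable w.1 w.2).iterate q u) hder hy hx
  refine ⟨fun x hx => ?_, hder, hlip⟩
  have h3 := hlip x hx z₀ (mem_closedBall_self hr0.le)
  rw [mem_closedBall, dist_eq_norm] at hx ⊢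
  have h4 := norm_add_le ((cubic w.1 w.2)^[q] x - (cubic w.1 w.2)^[q] z₀)
    ((cubic w.1 w.2)^[q] z₀ - z₀)
  rw [sub_add_sub_cancel] at h4
  nlinarith

namespace IsTypeDPoint

variable {p q : ℕ} {w₀ : ℂ × ℂ} {z₀ : ℂ} (h : IsTypeDPoint p q w₀.1 w₀.2 z₀)
include h

theorem exists_tracking {ε : ℝ} (hε : 0 < ε) : ∃ κ : ℝ, 0 ≤ κ ∧ κ < 1 ∧ ∃ r : ℝ, 0 < r ∧ r < ε ∧
    ∃ K : ℕ, ∀ᶠ w in 𝓝 w₀, ContractsBall ((cubic w.1 w.2)^[q]) z₀ r κ ∧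
      (cubic w.1 w.2)^[q * K] (-w.1) ∈ closedBall z₀ r := by
  obtain ⟨κ, h0, h1, r, hr, hrε, hev⟩ := exists_contractsBall h.per_z h.mult hε
  refine ⟨κ, h0, h1, r, hr, hrε, ?_⟩
  obtain ⟨K, hK⟩ := (h.tendsto.eventually (ball_mem_nhds z₀ hr)).exists
  refine ⟨K, hev.and ?_⟩
  have hc : Continuous fun w : ℂ × ℂ => (cubic w.1 w.2)^[q * K] (-w.1) :=
    continuous_cubic_iterate (by fun_prop) (by fun_prop) (by fun_prop) _
  exact (hc.continuousAt.eventually (isOpen_ball.mem_nhds hK)).mono fun w hw =>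
    ball_subset_closedBall hw

/-- The critical orbit tracks the attracting cycle uniformly in the parameter. -/
theorem eventually_norm_sub_lt {ε : ℝ} (hε : 0 < ε) : ∃ N ∈ 𝓝 w₀, ∀ᶠ k in atTop, ∀ w ∈ N, ∀ z,
    IsTypeDPoint p q w.1 w.2 z → ‖(cubic w.1 w.2)^[q * k] (-w.1) - z‖ < ε := by
  obtain ⟨κ, h0, h1, r, hr, hrε, K, hev⟩ := h.exists_tracking hε
  refine ⟨_, hev, ?_⟩
  have : Tendsto (fun k : ℕ => κ ^ k * (2 * r)) atTop (𝓝 0) := by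
    simpa using (tendsto_pow_atTop_nhds_zero_of_lt_one h0 h1).mul_const (2 * r)
  obtain ⟨M, hM⟩ := eventually_atTop.1 (this.eventually (gt_mem_nhds hε))
  filter_upwards [eventually_ge_atTop (M + K)] with k hk w hw z hz
  have hit (m : ℕ) : (cubic w.1 w.2)^[q * (m + K)] (-w.1) =
      ((cubic w.1 w.2)^[q])^[m] ((cubic w.1 w.2)^[q * K] (-w.1)) := by
    rw [← iterate_mul, ← iterate_add_apply, mul_add]
  have hzb : z ∈ closedBall z₀ r := by
    refine isClosed_closedBall.mem_of_tendsto ((tendsto_add_atTop_iff_nat K).2 hz.tendsto)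
      (Eventually.of_forall fun m => ?_)
    rw [hit]
    exact hw.1.mapsTo.iterate m hw.2
  obtain ⟨m, rfl⟩ := Nat.exists_eq_add_of_le' (le_of_add_le_right hk)
  rw [hit]
  exact (hw.1.norm_iterate_sub_le h0 hw.2 hzb hz.per_z m).trans_lt (hM m (by omega))

theorem eventually_mem_of_mem_nhds {V : Set ℂ} (hV : V ∈ 𝓝 z₀) :
    ∀ᶠ w in 𝓝 w₀, ∀ z, IsTypeDPoint p q w.1 w.2 z → z ∈ V := by
  obtain ⟨ε, hε, hεV⟩ := Metric.mem_nhds_iff.1 hV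
  obtain ⟨N, hN, hk⟩ := h.eventually_norm_sub_lt (half_pos hε)
  obtain ⟨k, hk1, hk2⟩ := (hk.and (h.tendsto.eventually (ball_mem_nhds z₀ (half_pos hε)))).exists
  have hc : Continuous fun w : ℂ × ℂ => (cubic w.1 w.2)^[q * k] (-w.1) :=
    continuous_cubic_iterate (by fun_prop) (by fun_prop) (by fun_prop) _
  filter_upwards [hN, hc.continuousAt.eventually (isOpen_ball.mem_nhds hk2)] with w hw hw2 z hz
  apply hεV
  have h1 := hk1 w hw z hz
  rw [dist_eq_norm] at hw2
  rw [mem_ball, dist_eq_norm]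
  rw [norm_sub_rev] at h1
  have := norm_add_le (z - (cubic w.1 w.2)^[q * k] (-w.1)) ((cubic w.1 w.2)^[q * k] (-w.1) - z₀)
  rw [sub_add_sub_cancel] at this
  linarith

theorem eventually_isTypeDPoint : ∀ᶠ u in 𝓝 (w₀, z₀),
    (multiplierMap p q u).1 = (0, 0) → IsTypeDPoint p q u.1.1 u.1.2 u.2 := by
  obtain ⟨κ, h0, h1, r, hr, hrε, K, hev⟩ := h.exists_tracking one_pos
  have e0 {F G : ℕ → (ℂ × ℂ) × ℂ → ℂ} (hF : ∀ k, Continuous (F k)) (hG : ∀ k, Continuous (G k))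
      (s : Finset ℕ) (hs : ∀ k ∈ s, F k (w₀, z₀) ≠ G k (w₀, z₀)) :
      ∀ᶠ u in 𝓝 (w₀, z₀), ∀ k ∈ s, F k u ≠ G k u :=
    (Filter.eventually_all_finset s).2 fun k hk =>
      (isOpen_ne_fun (hF k) (hG k)).mem_nhds (hs k hk)
  have c1 : Continuous fun u : (ℂ × ℂ) × ℂ => u.1.1 := by fun_prop
  have c2 : Continuous fun u : (ℂ × ℂ) × ℂ => u.1.2 := by fun_prop
  have e1 := e0 (fun k => continuous_cubic_iterate c1 c2 c1 k) (fun _ => c1) (Finset.Ioo 0 p)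
    fun k hk => h.min_c k (Finset.mem_Ioo.1 hk).1 (Finset.mem_Ioo.1 hk).2
  have e2 := e0 (fun k => continuous_cubic_iterate c1 c2 continuous_snd k)
    (fun _ => continuous_snd) (Finset.Ioo 0 q)
    fun k hk => h.min_z k (Finset.mem_Ioo.1 hk).1 (Finset.mem_Ioo.1 hk).2
  have e3 := e0 (fun _ => continuous_snd) (fun k => continuous_cubic_iterate c1 c2 c1 k)
    (Finset.range p) fun k hk => h.disj k (Finset.mem_range.1 hk)
  have e4 : ∀ᶠ u in 𝓝 (w₀, z₀), u.2 ∈ closedBall z₀ r :=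
    continuous_snd.continuousAt.eventually (closedBall_mem_nhds z₀ hr)
  have e5 := (continuous_fst.continuousAt (x := (w₀, z₀))).eventually hev
  filter_upwards [e1, e2, e3, e4, e5] with u u1 u2 u3 u4 u5 hu
  simp only [multiplierMap, Prod.mk.injEq, sub_eq_zero] at hu
  refine ⟨h.pos_p, h.pos_q, hu.1, fun k hk hkp => u1 k (Finset.mem_Ioo.2 ⟨hk, hkp⟩), hu.2,
    fun k hk hkq => u2 k (Finset.mem_Ioo.2 ⟨hk, hkq⟩), (u5.1.norm_deriv_le _ u4).trans_lt h1, ?_,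
    fun k hk => u3 k (Finset.mem_range.2 hk)⟩
  refine (tendsto_add_atTop_iff_nat K).1 ((u5.1.tendsto h0 h1 u5.2 u4 hu.2).congr fun m => ?_)
  rw [← iterate_mul, ← iterate_add_apply, mul_add]

end IsTypeDPoint

theorem IsTypeDPoint.eq {p q : ℕ} {c a z z' : ℂ} (h : IsTypeDPoint p q c a z)
    (h' : IsTypeDPoint p q c a z') : z = z' :=
  tendsto_nhds_unique h.tendsto h'.tendsto

theorem deriv_cubic_iterate_self {p : ℕ} (hp : 0 < p) (c a : ℂ) :
    deriv ((cubic c a)^[p]) c = 0 := by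
  rw [deriv_iterate_eq_prod (cubic_differentiable c a)]
  exact Finset.prod_eq_zero (Finset.mem_range.2 hp) (by simp [cubic_deriv])

theorem attractedToAttractingCycle_self {p : ℕ} (hp : 0 < p) {c a : ℂ}
    (hc : (cubic c a)^[p] c = c) : AttractedToAttractingCycle (cubic c a) c := by
  refine ⟨p, hp, c, hc, by simp [deriv_cubic_iterate_self hp], ?_⟩
  refine tendsto_const_nhds.congr fun k => ?_
  rw [iterate_mul]
  exact (iterate_fixed hc k).symm

theorem IsTypeDPoint.mem_hypLocus {p q : ℕ} {w : ℂ × ℂ} {z : ℂ}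
    (h : IsTypeDPoint p q w.1 w.2 z) : w ∈ hypLocus p :=
  ⟨⟨h.per_c, fun k hk => h.min_c k hk⟩, attractedToAttractingCycle_self h.pos_p h.per_c,
    q, h.pos_q, z, h.per_z, h.mult, h.tendsto⟩

/-- A type D component, together with its attracting periodic point `zpt` of period `q`. -/
structure IsTypeDComponent (p q : ℕ) (H : Set (ℂ × ℂ)) (zpt : ℂ × ℂ → ℂ) : Prop where
  isHyperbolicComponent : IsHyperbolicComponent p H
  isTypeDPoint : ∀ w ∈ H, IsTypeDPoint p q w.1 w.2 (zpt w)

/-- The multiplier of the cycle of `zpt w`. -/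
noncomputable def cycleMultiplier (q : ℕ) (zpt : ℂ × ℂ → ℂ) (w : ℂ × ℂ) : ℂ :=
  deriv ((cubic w.1 w.2)^[q]) (zpt w)

namespace IsTypeDComponent

variable {p q : ℕ} {H : Set (ℂ × ℂ)} {zpt : ℂ × ℂ → ℂ} (h : IsTypeDComponent p q H zpt)
include h

theorem nonempty : H.Nonempty := by
  obtain ⟨w, hw, rfl⟩ := h.isHyperbolicComponent
  exact ⟨w, mem_connectedComponentIn hw⟩

theorem isPreconnected : IsPreconnected H := by
  obtain ⟨w, hw, rfl⟩ := h.isHyperbolicComponent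
  exact isPreconnected_connectedComponentIn

theorem subset_of_isPreconnected {S : Set (ℂ × ℂ)} (hS : IsPreconnected S) (hSH : S ⊆ hypLocus p)
    {w : ℂ × ℂ} (hw : w ∈ H) (hwS : w ∈ S) : S ⊆ H := by
  obtain ⟨w', hw', rfl⟩ := h.isHyperbolicComponent
  rw [connectedComponentIn_eq hw]
  exact hS.subset_connectedComponentIn hwS hSH

theorem mem_of_mem_closure {w : ℂ × ℂ} (hw : w ∈ closure H) (hw' : w ∈ hypLocus p) : w ∈ H := by
  obtain ⟨w₁, hw₁⟩ := h.nonempty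
  refine h.subset_of_isPreconnected (S := insert w H) ?_ ?_ hw₁ (mem_insert_of_mem _ hw₁)
    (mem_insert _ _)
  · exact h.isPreconnected.subset_closure (subset_insert _ _)
      (insert_subset hw subset_closure)
  · exact insert_subset hw' fun u hu => (h.isTypeDPoint u hu).mem_hypLocus

theorem continuousOn_zpt : ContinuousOn zpt H := fun w hw _ hV =>
  (((h.isTypeDPoint w hw).eventually_mem_of_mem_nhds hV).filter_mono nhdsWithin_le_nhds).mp
    (eventually_mem_nhdsWithin.mono fun u hu hu' => hu' _ (h.isTypeDPoint u hu))

theorem continuousOn_cycleMultiplier : ContinuousOn (cycleMultiplier q zpt) H := by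
  have : Continuous fun u : (ℂ × ℂ) × ℂ => deriv ((cubic u.1.1 u.1.2)^[q]) u.2 :=
    continuous_deriv_cubic_iterate (by fun_prop) (by fun_prop) (by fun_prop) q
  have h2 : ContinuousOn (fun w => (w, zpt w)) H := continuousOn_id.prodMk h.continuousOn_zpt
  change ContinuousOn ((fun u : (ℂ × ℂ) × ℂ => deriv ((cubic u.1.1 u.1.2)^[q]) u.2) ∘
    fun w => (w, zpt w)) H
  exact this.comp_continuousOn h2

theorem mapsTo_cycleMultiplier : MapsTo (cycleMultiplier q zpt) H (ball 0 1) := fun w hw => by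
  simpa [cycleMultiplier] using (h.isTypeDPoint w hw).mult

theorem exists_local_inverse {w₀ : ℂ × ℂ} (hw₀ : w₀ ∈ H) : ∃ σ : ℂ → ℂ × ℂ,
    Tendsto σ (𝓝 (cycleMultiplier q zpt w₀)) (𝓝 w₀) ∧
    (∀ᶠ v in 𝓝 (cycleMultiplier q zpt w₀), σ v ∈ H ∧ cycleMultiplier q zpt (σ v) = v) ∧
    ∀ᶠ w in 𝓝[H] w₀, σ (cycleMultiplier q zpt w) = w := by
  have hD := h.isTypeDPoint w₀ hw₀
  have hmul (w : ℂ × ℂ) (hw : w ∈ H) :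
      multiplierMap p q (w, zpt w) = ((0, 0), cycleMultiplier q zpt w) := by
    have := h.isTypeDPoint w hw
    simp [multiplierMap, this.per_c, this.per_z, cycleMultiplier]
  obtain ⟨s, hs1, hs2, hs3, hs4⟩ := hD.exists_local_section
  have hs5 := hs1.eventually hD.eventually_isTypeDPoint
  obtain ⟨ε, hε, hball⟩ := Metric.eventually_nhds_iff_ball.1 (hs2.and (hs3.and hs5))
  have hs0 : s (cycleMultiplier q zpt w₀) = (w₀, zpt w₀) := by
    have := hs4.self_of_nhds
    rw [hmul w₀ hw₀] at this
    exact this rfl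
  have hTD : ∀ v ∈ ball (cycleMultiplier q zpt w₀) ε,
      IsTypeDPoint p q (s v).1.1 (s v).1.2 (s v).2 := fun v hv =>
    (hball v hv).2.2 (by rw [(hball v hv).2.1])
  have hH : (fun v => (s v).1) '' ball (cycleMultiplier q zpt w₀) ε ⊆ H := by
    refine h.subset_of_isPreconnected ?_ ?_ hw₀ ⟨_, mem_ball_self hε, by simp [hs0]⟩
    · exact (convex_ball _ _).isPreconnected.image _ fun v hv =>
        (hball v hv).1.fst.continuousWithinAt
    · rintro _ ⟨v, hv, rfl⟩
      exact (hTD v hv).mem_hypLocus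
  refine ⟨fun v => (s v).1, hs1.fst_nhds, ?_, ?_⟩
  · filter_upwards [ball_mem_nhds _ hε] with v hv
    have hvH : (s v).1 ∈ H := hH ⟨v, hv, rfl⟩
    refine ⟨hvH, ?_⟩
    have h1 := (hball v hv).2.1
    rw [← Prod.mk.eta (p := s v), (hTD v hv).eq (h.isTypeDPoint _ hvH), hmul _ hvH] at h1
    exact congrArg Prod.snd h1
  · have hz : Tendsto (fun w => (w, zpt w)) (𝓝[H] w₀) (𝓝 (w₀, zpt w₀)) :=
      (tendsto_id.mono_left nhdsWithin_le_nhds).prodMk_nhds (h.continuousOn_zpt w₀ hw₀)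
    filter_upwards [hz.eventually hs4, self_mem_nhdsWithin] with w hw hwH
    rw [hmul w hwH] at hw
    simp [hw rfl]

theorem nhds_le_map_cycleMultiplier {w₀ : ℂ × ℂ} (hw₀ : w₀ ∈ H) :
    𝓝 (cycleMultiplier q zpt w₀) ≤ map (cycleMultiplier q zpt) (𝓝[H] w₀) := by
  obtain ⟨σ, h1, h2, -⟩ := h.exists_local_inverse hw₀
  intro S hS
  have h3 : Tendsto σ (𝓝 (cycleMultiplier q zpt w₀)) (𝓝[H] w₀) :=
    tendsto_nhdsWithin_iff.2 ⟨h1, h2.mono fun v hv => hv.1⟩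
  filter_upwards [h3 (mem_map.1 hS), h2] with v hv hv2
  rw [mem_preimage, mem_preimage, hv2.2] at hv
  exact hv

theorem exists_injOn_cycleMultiplier {w₀ : ℂ × ℂ} (hw₀ : w₀ ∈ H) :
    ∃ N ∈ 𝓝[H] w₀, InjOn (cycleMultiplier q zpt) N := by
  obtain ⟨σ, -, -, h3⟩ := h.exists_local_inverse hw₀
  refine ⟨_, h3, fun x hx y hy hxy => ?_⟩
  calc x = σ (cycleMultiplier q zpt x) := hx.symm
    _ = σ (cycleMultiplier q zpt y) := by rw [hxy]
    _ = y := hy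

theorem analyticOnSlice : AnalyticOnSlice (cycleMultiplier q zpt) H := by
  intro U γ hU hγ1 hγ2 hγ
  have hcont : ContinuousOn γ U := hγ1.continuousOn.prodMk hγ2.continuousOn
  have hit (n : ℕ) (z : ℂ → ℂ) (hz : DifferentiableOn ℂ z U) :
      DifferentiableOn ℂ (fun t => (cubic (γ t).1 (γ t).2)^[n] (z t)) U := by
    induction n with
    | zero => simpa using hz
    | succ n ih =>
      simp only [iterate_succ_apply']
      have d1 := hγ1.differentiableOn
      have d2 := hγ2.differentiableOn
      unfold cubic at ih ⊢
      fun_prop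
  have hz : DifferentiableOn ℂ (fun t => zpt (γ t)) U := by
    have hlim : TendstoLocallyUniformlyOn
        (fun (k : ℕ) t => (cubic (γ t).1 (γ t).2)^[q * k] (-(γ t).1))
          (fun t => zpt (γ t)) atTop U := by
      rw [Metric.tendstoLocallyUniformlyOn_iff]
      intro ε hε t ht
      obtain ⟨N, hN, hk⟩ := (h.isTypeDPoint _ (hγ t ht)).eventually_norm_sub_lt hε
      refine ⟨γ ⁻¹' N ∩ U, inter_mem (hcont t ht hN) self_mem_nhdsWithin, ?_⟩
      filter_upwards [hk] with k hk u hu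
      rw [dist_comm, dist_eq_norm]
      exact hk _ hu.1 _ (h.isTypeDPoint _ (hγ u hu.2))
    exact hlim.differentiableOn (Eventually.of_forall fun k =>
      hit _ _ hγ1.differentiableOn.neg) hU
  refine DifferentiableOn.analyticOnNhd ?_ hU
  simp only [cycleMultiplier, deriv_iterate_eq_prod (cubic_differentiable _ _), cubic_deriv]
  refine DifferentiableOn.fun_finsetProd fun i _ => ?_
  have := hit i _ hz
  have d1 := hγ1.differentiableOn
  fun_prop

end IsTypeDComponent

/-- Attraction of a shifted subsequence suffices for attraction. -/
theorem attractedToAttractingCycle_of_tendsto {g : ℂ → ℂ} (hg : Differentiable ℂ g) {q j : ℕ}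
    (hq : 0 < q) {x z : ℂ} (hz : g^[q] z = z) (hd : ‖deriv (g^[q]) z‖ < 1)
    (h : Tendsto (fun k => g^[q * k + j] x) atTop (𝓝 z)) : AttractedToAttractingCycle g x := by
  obtain ⟨m, rfl⟩ : ∃ m, q = m + 1 := ⟨q - 1, by omega⟩
  refine ⟨m + 1, hq, g^[m * j] z, iterate_iterate_eq hz _, ?_, ?_⟩
  · rwa [deriv_iterate_iterate hg hz]
  · refine (tendsto_add_atTop_iff_nat j).1 ?_
    have h1 := ((hg.continuous.iterate (m * j)).tendsto z).comp h
    refine h1.congr fun k => ?_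
    rw [Function.comp_apply, ← iterate_add_apply]
    exact congrArg (fun n => g^[n] x) (by ring)

theorem exists_cubic_escape_of_isBounded {H : Set (ℂ × ℂ)} (hb : Bornology.IsBounded H) :
    ∃ R : ℝ, 1 < R ∧ ∀ w ∈ closure H, ∀ z, R ≤ ‖z‖ → 2 * ‖z‖ ≤ ‖cubic w.1 w.2 z‖ := by
  obtain ⟨M, hM⟩ := hb.closure.exists_norm_le
  obtain ⟨R, hR, h⟩ := cubic_escape (max M 0) (le_max_right _ _)
  refine ⟨R, hR, fun w hw => h _ _ ?_ ?_⟩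
  · exact (norm_fst_le w).trans ((hM w hw).trans (le_max_left _ _))
  · exact (norm_snd_le w).trans ((hM w hw).trans (le_max_left _ _))

namespace IsTypeDComponent

variable {p q : ℕ} {H : Set (ℂ × ℂ)} {zpt : ℂ × ℂ → ℂ} (h : IsTypeDComponent p q H zpt)
include h

theorem pos : 0 < p ∧ 0 < q := by
  obtain ⟨w, hw⟩ := h.nonempty
  exact ⟨(h.isTypeDPoint w hw).pos_p, (h.isTypeDPoint w hw).pos_q⟩

theorem closure_subset_Sp : closure H ⊆ Sp p := by
  intro w₀ hw₀
  have hper : (cubic w₀.1 w₀.2)^[p] w₀.1 = w₀.1 := by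
    have h1 : Continuous fun w : ℂ × ℂ => (cubic w.1 w.2)^[p] w.1 :=
      continuous_cubic_iterate continuous_fst continuous_snd continuous_fst p
    exact closure_minimal (fun w hw => (h.isTypeDPoint w hw).per_c)
      (isClosed_eq h1 continuous_fst) hw₀
  refine ⟨hper, fun k hk hkp hkc => ?_⟩
  obtain ⟨κ, -, hκ1, r, hr, -, hev⟩ := exists_contractsBall hper
    (by simp [deriv_cubic_iterate_self h.pos.1]) one_pos
  have h1 : Continuous fun w : ℂ × ℂ => (cubic w.1 w.2)^[k] w.1 :=
    continuous_cubic_iterate continuous_fst continuous_snd continuous_fst k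
  have e1 := (h1.tendsto w₀).eventually (closedBall_mem_nhds _ hr)
  have e2 := ((continuous_fst (X := ℂ) (Y := ℂ)).tendsto w₀).eventually (closedBall_mem_nhds _ hr)
  obtain ⟨w, ⟨h2, h3, h4⟩, hw⟩ := mem_closure_iff_nhds.1 hw₀ _ (hev.and (e1.and e2))
  have hD := h.isTypeDPoint w hw
  rw [hkc] at h3
  exact hD.min_c k hk hkp (h2.eq_of_fixed hκ1 h3 h4 (iterate_iterate_eq hD.per_c k) hD.per_c)

theorem exists_limit_point (hb : Bornology.IsBounded H) {w₀ : ℂ × ℂ} {U : Ultrafilter (ℂ × ℂ)}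
    (hU : (U : Filter (ℂ × ℂ)) ≤ 𝓝[H] w₀) {v : ℂ} (hv : Tendsto (cycleMultiplier q zpt) U (𝓝 v)) :
    ∃ z, (cubic w₀.1 w₀.2)^[q] z = z ∧ deriv ((cubic w₀.1 w₀.2)^[q]) z = v ∧
      ∀ k, z ≠ (cubic w₀.1 w₀.2)^[k] w₀.1 := by
  obtain ⟨R, hR1, hR⟩ := exists_cubic_escape_of_isBounded hb
  have hUH : ∀ᶠ w in (U : Filter (ℂ × ℂ)), w ∈ H := hU self_mem_nhdsWithin
  have hU0 : (U : Filter (ℂ × ℂ)) ≤ 𝓝 w₀ := hU.trans nhdsWithin_le_nhds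
  have hw₀ : w₀ ∈ closure H := by
    rw [mem_closure_iff_nhdsWithin_neBot]
    exact U.neBot.mono hU
  have hbd : ∀ᶠ w in (U : Filter (ℂ × ℂ)), zpt w ∈ closedBall (0 : ℂ) R := by
    filter_upwards [hUH] with w hw
    have hD := h.isTypeDPoint w hw
    simpa using (norm_lt_of_periodic (by linarith) (hR w (subset_closure hw)) hD.pos_q hD.per_z).le
  obtain ⟨z, -, hz⟩ := (isCompact_closedBall (0 : ℂ) R).ultrafilter_le_nhds (U.map zpt)
    (le_principal_iff.2 hbd)
  have hz' : Tendsto (fun w => (w, zpt w)) U (𝓝 (w₀, z)) :=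
    (tendsto_id'.2 hU0).prodMk_nhds hz
  have c1 : Continuous fun u : (ℂ × ℂ) × ℂ => u.1.1 := by fun_prop
  have c2 : Continuous fun u : (ℂ × ℂ) × ℂ => u.1.2 := by fun_prop
  have hper : (cubic w₀.1 w₀.2)^[q] z = z := by
    have h1 := (continuous_cubic_iterate c1 c2 continuous_snd q).tendsto (w₀, z)
    refine tendsto_nhds_unique_of_eventuallyEq (h1.comp hz') hz ?_
    filter_upwards [hUH] with w hw using (h.isTypeDPoint w hw).per_z
  refine ⟨z, hper, ?_, fun k hk => ?_⟩
  · have h1 := (continuous_deriv_cubic_iterate c1 c2 continuous_snd q).tendsto (w₀, z)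
    exact tendsto_nhds_unique (h1.comp hz') hv
  · set f := cubic w₀.1 w₀.2
    have hc : f^[p] w₀.1 = w₀.1 := (h.closure_subset_Sp hw₀).1
    have hpq (g : ℂ → ℂ) (x : ℂ) (hx : g^[p] x = x) : g^[p * q] x = x := by
      rw [iterate_mul]; exact iterate_fixed hx q
    have hqp (g : ℂ → ℂ) (x : ℂ) (hx : g^[q] x = x) : g^[p * q] x = x := by
      rw [mul_comm, iterate_mul]; exact iterate_fixed hx p
    have hd : deriv (f^[p * q]) z = 0 := by
      rw [hk, deriv_iterate_iterate (cubic_differentiable _ _) (hpq _ _ hc)]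
      exact deriv_cubic_iterate_self (Nat.mul_pos h.pos.1 h.pos.2) _ _
    obtain ⟨κ, -, hκ1, r, hr, -, hev⟩ := exists_contractsBall (hqp _ _ hper)
      (by rw [hd]; simp) one_pos
    have h1 : Continuous fun w : ℂ × ℂ => (cubic w.1 w.2)^[k] w.1 :=
      continuous_cubic_iterate continuous_fst continuous_snd continuous_fst k
    have e1 := (h1.tendsto w₀).eventually (closedBall_mem_nhds _ hr)
    have e2 : ∀ᶠ w in (U : Filter (ℂ × ℂ)), zpt w ∈ closedBall z r :=
      hz (closedBall_mem_nhds _ hr)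
    obtain ⟨w, ⟨h2, h3⟩, h4, hw⟩ := (((hev.and e1).filter_mono hU0).and (e2.and hUH)).exists
    have hD := h.isTypeDPoint w hw
    rw [← hk] at h3
    refine hD.ne_iterate_c 0 k (h2.eq_of_fixed hκ1 h4 h3 (hqp _ _ hD.per_z) ?_)
    exact iterate_iterate_eq (hpq _ _ hD.per_c) k

theorem mem_of_tendsto (hb : Bornology.IsBounded H) {w₀ : ℂ × ℂ} {U : Ultrafilter (ℂ × ℂ)}
    (hU : (U : Filter (ℂ × ℂ)) ≤ 𝓝[H] w₀) {v : ℂ} (hv : Tendsto (cycleMultiplier q zpt) U (𝓝 v))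
    (hv1 : ‖v‖ < 1) : w₀ ∈ H := by
  obtain ⟨z, hz, rfl, hzc⟩ := h.exists_limit_point hb hU hv
  obtain ⟨R, hR1, hR⟩ := exists_cubic_escape_of_isBounded hb
  have hw₀ : w₀ ∈ closure H := by
    rw [mem_closure_iff_nhdsWithin_neBot]
    exact U.neBot.mono hU
  have hSp := h.closure_subset_Sp hw₀
  refine h.mem_of_mem_closure hw₀ ⟨hSp, attractedToAttractingCycle_self h.pos.1 hSp.1, ?_⟩
  have hdiff := cubic_differentiable w₀.1 w₀.2
  obtain ⟨x, -, hx, j, hj⟩ := exists_critical_point_attracted hdiff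
    (R := R) (fun z hz => by have := hR w₀ hw₀ z hz.ge; linarith) hz hv1
    fun i => norm_lt_of_periodic (by linarith) (hR w₀ hw₀) h.pos.2 (iterate_iterate_eq hz i)
  by_cases hxc : x = w₀.1
  · refine absurd ?_ (hzc j)
    have h2 : Tendsto (fun k => (cubic w₀.1 w₀.2)^[p * k + 0] x) atTop (𝓝 w₀.1) := by
      refine tendsto_const_nhds.congr fun k => ?_
      rw [hxc, add_zero, iterate_mul]
      exact (iterate_fixed hSp.1 k).symm
    exact exists_iterate_eq_of_tendsto hdiff.continuous h.pos.2 h.pos.1 hj h2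
  · have hx' : x = -w₀.1 := by
      by_contra hne
      rw [cubic_deriv] at hx
      exact three_mul_sq_sub_sq_ne_zero hxc hne (by linear_combination hx)
    rw [← hx']
    exact attractedToAttractingCycle_of_tendsto hdiff h.pos.2 hz hv1 hj

theorem isCompact_inter_preimage (hb : Bornology.IsBounded H) {K : Set ℂ} (hK : K ⊆ ball 0 1)
    (hKc : IsCompact K) : IsCompact (H ∩ cycleMultiplier q zpt ⁻¹' K) := by
  refine Metric.isCompact_of_isClosed_isBounded ?_ (hb.subset inter_subset_left)
  refine isClosed_of_closure_subset fun w₀ hw₀ => ?_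
  rw [mem_closure_iff_nhdsWithin_neBot] at hw₀
  set U := Ultrafilter.of (𝓝[H ∩ cycleMultiplier q zpt ⁻¹' K] w₀)
  have hU : (U : Filter (ℂ × ℂ)) ≤ 𝓝[H ∩ cycleMultiplier q zpt ⁻¹' K] w₀ := Ultrafilter.of_le _
  have hUH : (U : Filter (ℂ × ℂ)) ≤ 𝓝[H] w₀ := hU.trans (nhdsWithin_mono _ inter_subset_left)
  have hUK : cycleMultiplier q zpt ⁻¹' K ∈ (U : Filter (ℂ × ℂ)) :=
    mem_of_superset (hU self_mem_nhdsWithin) inter_subset_right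
  obtain ⟨v, hvK, hv⟩ := hKc.ultrafilter_le_nhds (U.map (cycleMultiplier q zpt))
    (le_principal_iff.2 hUK)
  have hv' : Tendsto (cycleMultiplier q zpt) U (𝓝 v) := hv
  have hmem : w₀ ∈ H := h.mem_of_tendsto hb hUH hv' (by simpa using hK hvK)
  refine ⟨hmem, ?_⟩
  rw [mem_preimage, tendsto_nhds_unique
    ((h.continuousOn_cycleMultiplier w₀ hmem).mono_left hUH) hv']
  exact hvK

theorem exists_inverse (hb : Bornology.IsBounded H) : ∃ σ : ℂ → ℂ × ℂ, ContinuousOn σ (ball 0 1) ∧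
    (∀ v ∈ ball (0 : ℂ) 1, σ v ∈ H ∧ cycleMultiplier q zpt (σ v) = v) ∧
    ∀ w ∈ H, σ (cycleMultiplier q zpt w) = w := by
  obtain ⟨w₀, hw₀⟩ := h.nonempty
  obtain ⟨σ, h1, h2, -, h3⟩ := exists_section_of_proper isOpen_ball (convex_ball 0 1)
    h.mapsTo_cycleMultiplier h.continuousOn_cycleMultiplier
    (fun w hw => h.nhds_le_map_cycleMultiplier hw) (fun w hw => h.exists_injOn_cycleMultiplier hw)
    (fun K => h.isCompact_inter_preimage hb) hw₀
  exact ⟨σ, h1, h2, h3 h.isPreconnected⟩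

end IsTypeDComponent

/-- Hermite interpolation with prescribed zeros and derivatives. -/
theorem exists_polynomial_hermite (A : Finset ℂ) (d : ℂ → ℂ) : ∃ h : Polynomial ℂ,
    ∀ x ∈ A, h.eval x = 0 ∧ h.derivative.eval x = d x := by
  refine ⟨Lagrange.nodal A id * Lagrange.interpolate A id
    (fun x => d x / (Lagrange.nodal A id).derivative.eval x), fun x hx => ?_⟩
  have h0 : (Lagrange.nodal A id).eval x = 0 := Lagrange.eval_nodal_at_node (v := id) hx
  have h1 : (Lagrange.nodal A id).derivative.eval x ≠ 0 := by
    have := Lagrange.eval_nodal_derivative_eval_node_eq (v := id) hx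
    rw [id] at this
    rw [this]
    exact Lagrange.eval_nodal_not_at_node (v := id) fun y hy => by
      simpa [eq_comm] using (Finset.mem_erase.1 hy).1
  have h2 : (Lagrange.interpolate A id
      (fun x => d x / (Lagrange.nodal A id).derivative.eval x)).eval x =
      d x / (Lagrange.nodal A id).derivative.eval x :=
    Lagrange.eval_interpolate_at_node (v := id) _ (injective_id.injOn) hx
  refine ⟨by simp [h0], ?_⟩
  rw [Polynomial.derivative_mul, Polynomial.eval_add, Polynomial.eval_mul, Polynomial.eval_mul, h0,
    h2]
  field_simp
  ring

/-- The first and second divided differences of a polynomial are continuous. -/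
theorem exists_divided_differences (k : Polynomial ℂ) :
    ∃ (L : ℂ × ℂ → ℂ) (M : ℂ × ℂ × ℂ → ℂ), Continuous L ∧ Continuous M ∧
      (∀ y z, k.eval y - k.eval z = (y - z) * L (y, z)) ∧
      ∀ x y z, L (x, y) - L (x, z) = (y - z) * M (x, y, z) := by
  induction k using Polynomial.induction_on with
  | C a => exact ⟨0, 0, continuous_const, continuous_const, by simp, by simp⟩
  | add k₁ k₂ h₁ h₂ =>
    obtain ⟨L₁, M₁, a₁, b₁, c₁, d₁⟩ := h₁
    obtain ⟨L₂, M₂, a₂, b₂, c₂, d₂⟩ := h₂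
    refine ⟨L₁ + L₂, M₁ + M₂, a₁.add a₂, b₁.add b₂, fun y z => ?_, fun x y z => ?_⟩
    · simp only [Polynomial.eval_add, Pi.add_apply]
      linear_combination c₁ y z + c₂ y z
    · simp only [Pi.add_apply]
      linear_combination d₁ x y z + d₂ x y z
  | monomial n a h =>
    obtain ⟨L, M, hL, hM, h1, h2⟩ := h
    set k := Polynomial.C a * Polynomial.X ^ n
    have hk : Polynomial.C a * Polynomial.X ^ (n + 1) = k * Polynomial.X := by
      rw [pow_succ, mul_assoc]
    have hkc := k.continuous
    refine ⟨fun u => u.1 * L u + k.eval u.2, fun u => u.1 * M u + L u.2, by fun_prop, by fun_prop,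
      fun y z => ?_, fun x y z => ?_⟩
    · simp only [hk, Polynomial.eval_mul, Polynomial.eval_X]
      linear_combination y * h1 y z
    · linear_combination x * h2 x y z + h1 y z

theorem iterate_eq_iterate_of_eqOn {f g : ℂ → ℂ} {A : Set ℂ} (hfA : MapsTo f A A) (hfg : EqOn g f A)
    {x : ℂ} (hx : x ∈ A) (n : ℕ) : g^[n] x = f^[n] x := by
  induction n with
  | zero => rfl
  | succ n ih => rw [iterate_succ_apply', iterate_succ_apply', ih, hfg (hfA.iterate n hx)]

theorem deriv_iterate_eq_pow_mul {f g : ℂ → ℂ} (hf : Differentiable ℂ f) (hg : Differentiable ℂ g)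
    {A : Set ℂ} (hfA : MapsTo f A A) (hfg : EqOn g f A) {t : ℂ}
    (hd : ∀ x ∈ A, deriv g x = t * deriv f x) {x : ℂ} (hx : x ∈ A) (n : ℕ) :
    deriv (g^[n]) x = t ^ n * deriv (f^[n]) x := by
  rw [deriv_iterate_eq_prod hf, deriv_iterate_eq_prod hg, Finset.prod_congr rfl fun i _ => by
    rw [iterate_eq_iterate_of_eqOn hfA hfg hx, hd _ (hfA.iterate i hx)], Finset.prod_mul_distrib]
  simp

/-- A cubic polynomial with a superattracting cycle through `c` cannot have two further cycles
of distinct multipliers of modulus one. -/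
theorem not_two_neutral_cycles {c a : ℂ} {R : ℝ} (hR1 : 1 < R)
    (hR : ∀ z, R ≤ ‖z‖ → 2 * ‖z‖ ≤ ‖cubic c a z‖) {p q : ℕ} (hp : 0 < p) (hq : 0 < q)
    (hc : (cubic c a)^[p] c = c) {z₁ z₂ : ℂ} (hz₁ : (cubic c a)^[q] z₁ = z₁)
    (hz₂ : (cubic c a)^[q] z₂ = z₂) (hv₁ : ‖deriv ((cubic c a)^[q]) z₁‖ = 1)
    (hv₂ : ‖deriv ((cubic c a)^[q]) z₂‖ = 1) :
    deriv ((cubic c a)^[q]) z₁ = deriv ((cubic c a)^[q]) z₂ := by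
  set f := cubic c a with hf
  have hfd : Differentiable ℂ f := cubic_differentiable c a
  by_contra hne
  set A : Finset ℂ := (Finset.range p).image (fun i => f^[i] c) ∪
    ((Finset.range q).image (fun i => f^[i] z₁) ∪ (Finset.range q).image (fun i => f^[i] z₂))
    with hA
  have hmaps {n : ℕ} {x : ℂ} (hn : 0 < n) (hx : f^[n] x = x) :
      MapsTo f ((Finset.range n).image (fun i => f^[i] x))
        ((Finset.range n).image (fun i => f^[i] x)) := by
    intro y hy
    simp only [Finset.coe_image, mem_image, Finset.coe_range, mem_Iio] at hy ⊢
    obtain ⟨i, -, rfl⟩ := hy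
    refine ⟨(i + 1) % n, Nat.mod_lt _ hn, ?_⟩
    rw [IsPeriodicPt.iterate_mod_apply hx, iterate_succ_apply']
  have hmem {n : ℕ} (x : ℂ) (hn : 0 < n) : x ∈ (Finset.range n).image (fun i => f^[i] x) :=
    Finset.mem_image.2 ⟨0, Finset.mem_range.2 hn, rfl⟩
  have hfA : MapsTo f A A := by
    rw [hA, Finset.coe_union, Finset.coe_union]
    exact (hmaps hp hc).union_union ((hmaps hq hz₁).union_union (hmaps hq hz₂))
  have hcA : c ∈ A := Finset.mem_union_left _ (hmem c hp)
  have hz₁A : z₁ ∈ A := Finset.mem_union_right _ (Finset.mem_union_left _ (hmem z₁ hq))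
  have hz₂A : z₂ ∈ A := Finset.mem_union_right _ (Finset.mem_union_right _ (hmem z₂ hq))
  obtain ⟨h, hh⟩ := exists_polynomial_hermite A (fun x => -deriv f x)
  obtain ⟨L, M, hL, hM, hLk, hMk⟩ := exists_divided_differences h.derivative
  obtain ⟨B₁, hB₁⟩ := (isCompact_closedBall (0 : ℂ) R).exists_bound_of_continuousOn
    h.continuous.continuousOn
  obtain ⟨B₂, hB₂⟩ := ((isCompact_closedBall (0 : ℂ) R).prod ((isCompact_closedBall (0 : ℂ) R).prod
    (isCompact_closedBall (0 : ℂ) R))).exists_bound_of_continuousOn hM.continuousOn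
  set B := max B₁ (max B₂ 1) with hB
  have hB1 : 1 ≤ B := le_max_of_le_right (le_max_right _ _)
  have hBB₁ : B₁ ≤ B := le_max_left _ _
  have hBB₂ : B₂ ≤ B := le_max_of_le_right (le_max_left _ _)
  set ε : ℝ := (2 * B)⁻¹ with hε
  have hε0 : 0 < ε := by positivity
  have hεB : ε * B = 1 / 2 := by rw [hε]; field_simp
  have hε1 : ε ≤ 1 / 2 := by nlinarith
  set g : ℂ → ℂ := fun z => f z + ε * h.eval z with hg
  have hgd : Differentiable ℂ g := hfd.add (h.differentiable.const_mul _)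
  have hg' (z : ℂ) : deriv g z = 3 * (z ^ 2 - c ^ 2) + ε * h.derivative.eval z := by
    rw [hg, deriv_fun_add hfd.differentiableAt (by fun_prop), deriv_const_mul _ (by fun_prop),
      hf, cubic_deriv, Polynomial.deriv]
  have hgf : EqOn g f A := fun x hx => by simp [hg, (hh x hx).1]
  have hgf' (x : ℂ) (hx : x ∈ A) : deriv g x = (1 - ε : ℂ) * deriv f x := by
    rw [hg', (hh x hx).2, hf, cubic_deriv]; ring
  have hgR (z : ℂ) (hz : ‖z‖ = R) : R < ‖g z‖ := by
    have h1 := hR z hz.ge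
    have h2 := hB₁ z (by simp [hz])
    have h3 : ‖(ε : ℂ) * h.eval z‖ ≤ 1 / 2 := by
      rw [norm_mul, Complex.norm_real, Real.norm_of_nonneg hε0.le]
      nlinarith
    have h4 := norm_sub_le (g z) ((ε : ℂ) * h.eval z)
    rw [show g z - ε * h.eval z = f z by simp [hg]] at h4
    linarith
  have hcrit {n : ℕ} {z : ℂ} (hn : 0 < n) (hz : f^[n] z = z) (hzA : z ∈ A)
      (hd : ‖deriv (f^[n]) z‖ ≤ 1) : ∃ x, ‖x‖ < R ∧ deriv g x = 0 ∧
        ∃ j, Tendsto (fun k => g^[n * k + j] x) atTop (𝓝 z) := by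
    refine exists_critical_point_attracted hgd hgR ?_ ?_ fun i => ?_
    · rw [iterate_eq_iterate_of_eqOn hfA hgf hzA, hz]
    · rw [deriv_iterate_eq_pow_mul hfd hgd hfA hgf hgf' hzA, norm_mul, norm_pow]
      have h1 : ‖(1 - ε : ℂ)‖ < 1 := by
        rw [← Complex.ofReal_one, ← Complex.ofReal_sub, Complex.norm_real,
          Real.norm_of_nonneg (by linarith)]
        linarith
      have h2 := pow_lt_one₀ (norm_nonneg (1 - ε : ℂ)) h1 hn.ne'
      have h3 : 0 ≤ ‖(1 - ε : ℂ)‖ ^ n := by positivity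
      nlinarith
    · rw [iterate_eq_iterate_of_eqOn hfA hgf hzA]
      exact norm_lt_of_periodic hR1 hR hn (iterate_iterate_eq hz i)
  obtain ⟨x₀, hx₀, hx₀', j₀, hj₀⟩ := hcrit hp hc hcA
    (by rw [hf, deriv_cubic_iterate_self hp]; simp)
  obtain ⟨x₁, hx₁, hx₁', j₁, hj₁⟩ := hcrit hq hz₁ hz₁A hv₁.le
  obtain ⟨x₂, hx₂, hx₂', j₂, hj₂⟩ := hcrit hq hz₂ hz₂A hv₂.le
  have hcz {z : ℂ} (hz : f^[q] z = z) (hv : ‖deriv (f^[q]) z‖ = 1) (i j : ℕ) :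
      f^[i] c ≠ f^[j] z := by
    intro hij
    have hzp : f^[q * p] z = z := by rw [iterate_mul]; exact iterate_fixed hz p
    have hcp : f^[q * p] c = c := by rw [mul_comm, iterate_mul]; exact iterate_fixed hc q
    have h1 : deriv (f^[q * p]) (f^[j] z) = 0 := by
      rw [← hij, deriv_iterate_iterate hfd hcp]
      exact deriv_cubic_iterate_self (Nat.mul_pos hq hp) c a
    rw [deriv_iterate_iterate hfd hzp, iterate_mul] at h1
    have h2 := HasDerivAt.iterate z
      ((hfd.iterate q) z).hasDerivAt hz p
    rw [h2.deriv] at h1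
    have := eq_zero_of_pow_eq_zero h1
    rw [this] at hv
    simp at hv
  have hzA' {n₁ n₂ j₁ j₂ : ℕ} {x z z' : ℂ} (hn₁ : 0 < n₁) (hn₂ : 0 < n₂) (hz : z ∈ A) (hz' : z' ∈ A)
      (h1 : Tendsto (fun k => g^[n₁ * k + j₁] x) atTop (𝓝 z))
      (h2 : Tendsto (fun k => g^[n₂ * k + j₂] x) atTop (𝓝 z')) : f^[j₂] z = f^[j₁] z' := by
    have := exists_iterate_eq_of_tendsto hgd.continuous hn₁ hn₂ h1 h2
    rwa [iterate_eq_iterate_of_eqOn hfA hgf hz, iterate_eq_iterate_of_eqOn hfA hgf hz'] at this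
  have h01 : x₀ ≠ x₁ := by
    rintro rfl
    exact hcz hz₁ hv₁ _ _ (hzA' hp hq hcA hz₁A hj₀ hj₁)
  have h02 : x₀ ≠ x₂ := by
    rintro rfl
    exact hcz hz₂ hv₂ _ _ (hzA' hp hq hcA hz₂A hj₀ hj₂)
  have h12 : x₁ ≠ x₂ := by
    rintro rfl
    have := hzA' hq hq hz₁A hz₂A hj₁ hj₂
    apply hne
    rw [← deriv_iterate_iterate hfd hz₁ j₂, this, deriv_iterate_iterate hfd hz₂]
  rw [hg'] at hx₀' hx₁' hx₂'
  have e1 : 3 * (x₀ + x₁) + ε * L (x₀, x₁) = 0 := by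
    refine (mul_eq_zero.1 ?_).resolve_left (sub_ne_zero.2 h01)
    linear_combination hx₀' - hx₁' - ε * hLk x₀ x₁
  have e2 : 3 * (x₀ + x₂) + ε * L (x₀, x₂) = 0 := by
    refine (mul_eq_zero.1 ?_).resolve_left (sub_ne_zero.2 h02)
    linear_combination hx₀' - hx₂' - ε * hLk x₀ x₂
  have e3 : 3 + ε * M (x₀, x₁, x₂) = 0 := by
    refine (mul_eq_zero.1 ?_).resolve_left (sub_ne_zero.2 h12)
    linear_combination e1 - e2 - ε * hMk x₀ x₁ x₂
  have h5 := hB₂ (x₀, x₁, x₂) (by simp [hx₀.le, hx₁.le, hx₂.le])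
  have h6 : ‖(ε : ℂ) * M (x₀, x₁, x₂)‖ = 3 := by
    rw [show (ε : ℂ) * M (x₀, x₁, x₂) = -3 by linear_combination e3]; simp
  rw [norm_mul, Complex.norm_real, Real.norm_of_nonneg hε0.le] at h6
  nlinarith

namespace Polynomial

theorem Monic.cubic_step {R : Type*} [CommRing R] [Nontrivial R] {P e : Polynomial R}
    (hP : P.Monic) (hd : 0 < P.natDegree) (b : R) (he : e.natDegree ≤ 1) :
    (P ^ 3 - C b * P + e).Monic ∧ (P ^ 3 - C b * P + e).natDegree = 3 * P.natDegree := by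
  have h3 : (P ^ 3).natDegree = 3 * P.natDegree := hP.natDegree_pow 3
  have h1 : (C b * P).natDegree ≤ P.natDegree := natDegree_C_mul_le b P
  have h2 : (-(C b * P) + e).natDegree < (P ^ 3).natDegree := by
    refine (natDegree_add_le _ _).trans_lt ?_
    rw [natDegree_neg]
    omega
  rw [sub_add_eq_add_sub, show P ^ 3 + e - C b * P = P ^ 3 + (-(C b * P) + e) by ring]
  refine ⟨(hP.pow 3).add_of_left (degree_lt_degree h2), ?_⟩
  rw [natDegree_add_eq_left_of_natDegree_lt h2, h3]

theorem Monic.cubic_iterate {R : Type*} [CommRing R] [Nontrivial R] {P e : Polynomial R}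
    (hP : P.Monic) (hd : 0 < P.natDegree) (b : R) (he : e.natDegree ≤ 1) (n : ℕ) :
    ((fun Q => Q ^ 3 - C b * Q + e)^[n] P).Monic ∧
      ((fun Q => Q ^ 3 - C b * Q + e)^[n] P).natDegree = 3 ^ n * P.natDegree := by
  induction n with
  | zero => simpa using hP
  | succ n ih =>
    rw [iterate_succ_apply']
    have := ih.1.cubic_step (ih.2 ▸ by positivity) b he
    refine ⟨this.1, this.2.trans ?_⟩
    rw [ih.2, pow_succ']
    ring

theorem aeval_cubic_iterate {R A : Type*} [CommRing R] [CommRing A] [Algebra R A]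
    (P e : Polynomial R) (b : R) (x : A) (n : ℕ) :
    aeval x ((fun Q => Q ^ 3 - C b * Q + e)^[n] P) =
      (fun y => y ^ 3 - algebraMap R A b * y + aeval x e)^[n] (aeval x P) := by
  induction n with
  | zero => rfl
  | succ n ih => simp [iterate_succ_apply', ih]

end Polynomial

open Polynomial in
theorem isIntegral_of_cubic_iterate_critical {R A : Type*} [CommRing R] [Nontrivial R] [CommRing A]
    [Algebra R A] {c : R} {a : A} {p : ℕ} (hp : 0 < p)
    (h : (fun y => y ^ 3 - algebraMap R A (3 * c ^ 2) * y + a)^[p] (algebraMap R A c) =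
      algebraMap R A c) : IsIntegral R a := by
  obtain ⟨n, rfl⟩ : ∃ n, p = n + 1 := ⟨p - 1, by omega⟩
  have h1 : (C c : R[X]) ^ 3 - C (3 * c ^ 2) * C c + X = X + C (-2 * c ^ 3) := by
    simp only [← C_mul, ← C_pow, ← C_sub]
    rw [add_comm]
    congr 2
    ring
  have hX := natDegree_X_add_C (-2 * c ^ 3)
  obtain ⟨hm, hd⟩ := (monic_X_add_C (-2 * c ^ 3)).cubic_iterate (hX ▸ one_pos)
    (3 * c ^ 2) natDegree_X_le n
  rw [hX] at hd
  refine ⟨_ - C c, hm.sub_of_left ?_, ?_⟩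
  · exact degree_C_le.trans_lt (natDegree_pos_iff_degree_pos.1 (hd ▸ by positivity))
  · rw [← h1, ← iterate_succ_apply (fun Q : R[X] => Q ^ 3 - C (3 * c ^ 2) * Q + X), ← aeval_def,
      map_sub, aeval_cubic_iterate, aeval_C, aeval_X, h, sub_self]

open Polynomial in
theorem isIntegral_of_cubic_iterate {R A : Type*} [CommRing R] [Nontrivial R] [CommRing A]
    [Algebra R A] {b a : R} {z : A} {q : ℕ} (hq : 0 < q)
    (h : (fun y => y ^ 3 - algebraMap R A b * y + algebraMap R A a)^[q] z = z) :
    IsIntegral R z := by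
  obtain ⟨hm, hd⟩ := (monic_X (R := R)).cubic_iterate (by simp) b (e := C a) (by simp) q
  rw [natDegree_X, mul_one] at hd
  refine ⟨_ - X, hm.sub_of_left (degree_lt_degree ?_), ?_⟩
  · rw [hd, natDegree_X]
    exact Nat.one_lt_pow hq.ne' (by norm_num)
  · rw [← aeval_def, map_sub, aeval_cubic_iterate, aeval_C, aeval_X, h, sub_self]

/-- A continuous map into a compact set, defined on a convex set, has a limit at every boundary
point where its set of cluster values is finite. -/
theorem exists_tendsto_of_finite_cluster {X : Type*} [TopologicalSpace X] [T2Space X] {D : Set ℂ}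
    (hD : Convex ℝ D) {K : Set X} (hK : IsCompact K) {σ : ℂ → X} (hσ : ContinuousOn σ D)
    (hσK : MapsTo σ D K) {v₀ : ℂ} (hv₀ : v₀ ∈ closure D) {S : Set X} (hS : S.Finite)
    (hcl : ∀ x, ClusterPt x (map σ (𝓝[D] v₀)) → x ∈ S) : ∃ x, Tendsto σ (𝓝[D] v₀) (𝓝 x) := by
  have hne : (𝓝[D] v₀).NeBot := mem_closure_iff_nhdsWithin_neBot.1 hv₀
  have hmem : K ∈ map σ (𝓝[D] v₀) := mem_map.2 (mem_of_superset self_mem_nhdsWithin hσK)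
  obtain ⟨x, -, hx⟩ := hK (le_principal_iff.2 hmem)
  refine ⟨x, hK.le_nhds_of_unique_clusterPt hmem fun y _ hy => ?_⟩
  by_contra hyx
  obtain ⟨U, V, hU, hV, hxU, hSV, hUV⟩ := SeparatedNhds.of_isCompact_isCompact
    (isCompact_singleton (x := x)) (hS.subset sdiff_subset : (S \ {x}).Finite).isCompact
    (disjoint_singleton_left.2 fun hm => hm.2 rfl)
  have hev : ∀ᶠ v in 𝓝[D] v₀, σ v ∈ U ∪ V := by
    by_contra hcon
    have hfr : ∃ᶠ x in map σ (𝓝[D] v₀), x ∈ (U ∪ V)ᶜ :=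
      frequently_map.2 (not_eventually.1 hcon)
    have := frequently_mem_iff_neBot.1 hfr
    obtain ⟨y, -, hy⟩ := hK (inf_le_left.trans (le_principal_iff.2 hmem) :
      map σ (𝓝[D] v₀) ⊓ 𝓟 (U ∪ V)ᶜ ≤ 𝓟 K)
    have hyc : y ∈ (U ∪ V)ᶜ := (hU.union hV).isClosed_compl.closure_subset
      (mem_closure_iff_clusterPt.2 (hy.mono inf_le_right))
    by_cases hyx : y = x
    · exact hyc (Or.inl (hxU hyx))
    · exact hyc (Or.inr (hSV ⟨hcl y (hy.mono inf_le_left), hyx⟩))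
  obtain ⟨δ, hδ, hball⟩ := Metric.mem_nhdsWithin_iff.1 hev
  have hpre : IsPreconnected (σ '' (ball v₀ δ ∩ D)) :=
    ((convex_ball v₀ δ).inter hD).isPreconnected.image _ (hσ.mono inter_subset_right)
  have hin : σ '' (ball v₀ δ ∩ D) ∈ map σ (𝓝[D] v₀) :=
    image_mem_map (Metric.mem_nhdsWithin_iff.2 ⟨δ, hδ, subset_rfl⟩)
  have hmeet {y : X} {W : Set X} (hy : ClusterPt y (map σ (𝓝[D] v₀))) (hW : IsOpen W)
      (hyW : y ∈ W) : (σ '' (ball v₀ δ ∩ D) ∩ W).Nonempty := by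
    rw [inter_comm]
    exact clusterPt_iff_nonempty.1 hy (hW.mem_nhds hyW) hin
  have h1 := hmeet hx hU (hxU rfl)
  have h2 := hmeet hy hV (hSV ⟨hcl y hy, hyx⟩)
  obtain ⟨u, -, hu1, hu2⟩ := hpre U V hU hV (image_subset_iff.2 hball) h1 h2
  exact hUV.le_bot ⟨hu1, hu2⟩

open Polynomial in
theorem exists_monic_evalEval_eq_zero {T : Type*} (c x : T → ℂ)
    (hx : (aeval c : ℂ[X] →ₐ[ℂ] (T → ℂ)).toRingHom.IsIntegralElem x) :
    ∃ P : ℂ[X][X], P.Monic ∧ ∀ t, P.evalEval (c t) (x t) = 0 := by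
  obtain ⟨P, hP, h0⟩ := hx
  refine ⟨P, hP, fun t => ?_⟩
  have h1 := hom_eval₂ P (aeval c : ℂ[X] →ₐ[ℂ] (T → ℂ)).toRingHom (Pi.evalRingHom _ t) x
  have h2 : (Pi.evalRingHom (fun _ => ℂ) t).comp (aeval c : ℂ[X] →ₐ[ℂ] (T → ℂ)).toRingHom =
      evalRingHom (c t) := by
    ext <;> simp
  rw [h0, h2, eval₂_evalRingHom] at h1
  simpa using h1.symm

theorem cubic_iterate_pi_apply {T : Type*} (c a z : T → ℂ) (n : ℕ) (t : T) :
    ((fun y => y ^ 3 - 3 * c ^ 2 * y + a)^[n] z) t = (cubic (c t) (a t))^[n] (z t) := by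
  induction n with
  | zero => rfl
  | succ n ih =>
    rw [iterate_succ_apply', iterate_succ_apply', ← ih]
    simp [cubic]

open Polynomial in
/-- Along a family of cubic polynomials with periodic critical point `c` and a periodic point `z`,
the parameter `a` and the multiplier at `z` are integral over `ℂ[c]`. -/
theorem isIntegralElem_of_periodic {T : Type*} [Nonempty T] {c a z : T → ℂ} {p q : ℕ} (hp : 0 < p)
    (hq : 0 < q) (hc : ∀ t, (cubic (c t) (a t))^[p] (c t) = c t)
    (hz : ∀ t, (cubic (c t) (a t))^[q] (z t) = z t) :
    (aeval c : ℂ[X] →ₐ[ℂ] (T → ℂ)).toRingHom.IsIntegralElem a ∧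
      (aeval c : ℂ[X] →ₐ[ℂ] (T → ℂ)).toRingHom.IsIntegralElem
        fun t => deriv ((cubic (c t) (a t))^[q]) (z t) := by
  let _ : Algebra ℂ[X] (T → ℂ) := (aeval c : ℂ[X] →ₐ[ℂ] (T → ℂ)).toRingHom.toAlgebra
  have hX : algebraMap ℂ[X] (T → ℂ) X = c := aeval_X c
  have hci : IsIntegral ℂ[X] c := hX ▸ isIntegral_algebraMap
  have h3i : IsIntegral ℂ[X] (3 : T → ℂ) := by
    have h := isIntegral_algebraMap (R := ℂ[X]) (A := T → ℂ) (x := 3)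
    rwa [map_ofNat] at h
  have hai : IsIntegral ℂ[X] a := by
    refine isIntegral_of_cubic_iterate_critical (c := X) hp ?_
    simp only [map_mul, map_pow, hX, map_ofNat]
    funext t
    rw [cubic_iterate_pi_apply, hc]
  have hbi : IsIntegral ℂ[X] (3 * c ^ 2) := h3i.mul (hci.pow 2)
  have hzi : IsIntegral ℂ[X] z := by
    refine isIntegral_trans (A := integralClosure ℂ[X] (T → ℂ)) z ?_
    refine isIntegral_of_cubic_iterate (b := ⟨_, hbi⟩) (a := ⟨_, hai⟩) hq ?_
    funext t
    exact (cubic_iterate_pi_apply c a z q t).trans (hz t)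
  refine ⟨hai, ?_⟩
  have hit (n : ℕ) : IsIntegral ℂ[X] ((fun y => y ^ 3 - 3 * c ^ 2 * y + a)^[n] z) := by
    induction n with
    | zero => exact hzi
    | succ n ih =>
      rw [iterate_succ_apply']
      exact ((ih.pow 3).sub (hbi.mul ih)).add hai
  have hprod : IsIntegral ℂ[X] (∏ j ∈ Finset.range q,
      3 * (((fun y => y ^ 3 - 3 * c ^ 2 * y + a)^[j] z) ^ 2 - c ^ 2)) :=
    IsIntegral.prod _ fun j _ => h3i.mul (((hit j).pow 2).sub (hci.pow 2))
  suffices heq : (fun t => deriv ((cubic (c t) (a t))^[q]) (z t)) = ∏ j ∈ Finset.range q,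
      3 * (((fun y => y ^ 3 - 3 * c ^ 2 * y + a)^[j] z) ^ 2 - c ^ 2) by
    rw [heq]
    exact hprod
  funext t
  rw [deriv_iterate_eq_prod (cubic_differentiable _ _), Finset.prod_apply]
  refine Finset.prod_congr rfl fun j _ => ?_
  simp [cubic_deriv, cubic_iterate_pi_apply]

open Polynomial in
theorem continuous_evalEval (P : ℂ[X][X]) : Continuous fun u : ℂ × ℂ => P.evalEval u.1 u.2 := by
  have heq : (fun u : ℂ × ℂ => P.evalEval u.1 u.2) =
      fun u => ∑ i ∈ Finset.range (P.natDegree + 1), (P.coeff i).eval u.1 * u.2 ^ i := by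
    funext u
    rw [← eval₂_evalRingHom, eval₂_eq_sum_range]
    rfl
  rw [heq]
  refine continuous_finsetSum _ fun i _ => ?_
  exact ((P.coeff i).continuous.comp continuous_fst).mul (continuous_snd.pow i)

open Polynomial in
/-- A monic relation `Q(x, y) = 0` restricts the limits of `x` as `y` tends to `y₀ ≠ y` to a finite
set. -/
theorem exists_finite_of_monic_relation {Q : ℂ[X][X]} (hQ : Q.Monic) (y₀ : ℂ) :
    ∃ S : Set ℂ, S.Finite ∧ ∀ {T : Type} (F : Filter T) [F.NeBot] (x y : T → ℂ) (x₀ : ℂ),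
      (∀ᶠ t in F, Q.evalEval (x t) (y t) = 0) → (∀ᶠ t in F, y t ≠ y₀) → Tendsto x F (𝓝 x₀) →
      Tendsto y F (𝓝 y₀) → x₀ ∈ S := by
  obtain ⟨Q₁, hQ₁, hdvd⟩ := exists_eq_pow_rootMultiplicity_mul_and_not_dvd Q hQ.ne_zero (C y₀)
  rw [dvd_iff_isRoot, IsRoot.def] at hdvd
  refine ⟨{x | (Q₁.eval (C y₀)).IsRoot x}, finite_setOfPred_isRoot hdvd, ?_⟩
  intro T F _ x y x₀ h0 hne hx hy
  have h1 : Tendsto (fun t => Q₁.evalEval (x t) (y t)) F (𝓝 (Q₁.evalEval x₀ y₀)) :=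
    ((continuous_evalEval Q₁).tendsto (x₀, y₀)).comp (hx.prodMk_nhds hy)
  refine (tendsto_nhds_unique_of_eventuallyEq h1 tendsto_const_nhds ?_ : Q₁.evalEval x₀ y₀ = 0)
  filter_upwards [h0, hne] with t ht htne
  rw [hQ₁, evalEval_mul, evalEval_pow] at ht
  refine (mul_eq_zero.1 ht).resolve_left (pow_ne_zero _ ?_)
  simpa [evalEval, sub_eq_zero] using htne

/-- A filter finer than the limits of a section of `m` at `v₀` is one along which
`m` tends to `v₀`. -/
theorem le_nhdsWithin_and_tendsto_of_section {X : Type*} [TopologicalSpace X] {H : Set X}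
    {m : X → ℂ} {D : Set ℂ} {σ : ℂ → X} (hσ : ∀ v ∈ D, σ v ∈ H ∧ m (σ v) = v) {v₀ : ℂ} {w₀ : X}
    {F : Filter X} (hF : F ≤ map σ (𝓝[D] v₀)) (hF0 : F ≤ 𝓝 w₀) :
    F ≤ 𝓝[H] w₀ ∧ Tendsto m F (𝓝 v₀) := by
  refine ⟨le_inf hF0 (hF.trans (le_principal_iff.2 (mem_map.2 ?_))), ?_⟩
  · filter_upwards [self_mem_nhdsWithin] with v hv using (hσ v hv).1
  · refine Tendsto.mono_left (tendsto_map'_iff.2 ?_) hF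
    refine (tendsto_nhdsWithin_of_tendsto_nhds tendsto_id).congr' ?_
    filter_upwards [self_mem_nhdsWithin] with v hv using (hσ v hv).2.symm

namespace IsTypeDComponent

variable {p q : ℕ} {H : Set (ℂ × ℂ)} {zpt : ℂ × ℂ → ℂ} (h : IsTypeDComponent p q H zpt)
include h

open Polynomial in
/-- For a point `v₀` of the unit circle, only finitely many points of `closure H` are limits of
points of `H` whose multiplier tends to `v₀`. -/
theorem exists_finite_limits {v₀ : ℂ} (hv₀ : ‖v₀‖ = 1) : ∃ S : Set (ℂ × ℂ), S.Finite ∧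
    ∀ (U : Ultrafilter (ℂ × ℂ)) (w₀ : ℂ × ℂ), (U : Filter (ℂ × ℂ)) ≤ 𝓝[H] w₀ →
      Tendsto (cycleMultiplier q zpt) U (𝓝 v₀) → w₀ ∈ S := by
  have : Nonempty H := h.nonempty.to_subtype
  obtain ⟨ha, hm⟩ := isIntegralElem_of_periodic (T := H) (c := fun t => t.1.1) (a := fun t => t.1.2)
    (z := fun t => zpt t.1) h.pos.1 h.pos.2 (fun t => (h.isTypeDPoint t.1 t.2).per_c)
    fun t => (h.isTypeDPoint t.1 t.2).per_z
  obtain ⟨P, hP, hP0⟩ := exists_monic_evalEval_eq_zero _ _ ha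
  obtain ⟨Q, hQ, hQ0⟩ := exists_monic_evalEval_eq_zero _ _ hm
  obtain ⟨S, hS, hSQ⟩ := exists_finite_of_monic_relation hQ v₀
  refine ⟨⋃ x ∈ S, Prod.mk x '' {y | (P.map (evalRingHom x)).IsRoot y}, ?_, ?_⟩
  · exact hS.biUnion fun x _ => (finite_setOfPred_isRoot (hP.map _).ne_zero).image _
  · intro U w₀ hU hv
    have hUH : ∀ᶠ w in (U : Filter (ℂ × ℂ)), w ∈ H := hU self_mem_nhdsWithin
    have hU0 : (U : Filter (ℂ × ℂ)) ≤ 𝓝 w₀ := hU.trans nhdsWithin_le_nhds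
    have h1 : w₀.1 ∈ S := by
      refine hSQ (U : Filter (ℂ × ℂ)) Prod.fst (cycleMultiplier q zpt) w₀.1 ?_ ?_
        ((continuous_fst.tendsto w₀).mono_left hU0) hv
      · filter_upwards [hUH] with w hw using hQ0 ⟨w, hw⟩
      · filter_upwards [hUH] with w hw heq
        have := h.mapsTo_cycleMultiplier hw
        rw [heq, mem_ball_zero_iff, hv₀] at this
        exact lt_irrefl _ this
    have h2 : P.evalEval w₀.1 w₀.2 = 0 := by
      refine tendsto_nhds_unique_of_eventuallyEq
        (((continuous_evalEval P).tendsto w₀).mono_left hU0) tendsto_const_nhds ?_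
      filter_upwards [hUH] with w hw using hP0 ⟨w, hw⟩
    refine mem_biUnion h1 ⟨w₀.2, ?_, rfl⟩
    rw [mem_ofPred, IsRoot.def, eval_map, eval₂_evalRingHom]
    exact h2

theorem exists_tendsto_section (hb : Bornology.IsBounded H) {σ : ℂ → ℂ × ℂ}
    (hσc : ContinuousOn σ (ball 0 1))
    (hσ : ∀ v ∈ ball (0 : ℂ) 1, σ v ∈ H ∧ cycleMultiplier q zpt (σ v) = v) {v₀ : ℂ}
    (hv₀ : v₀ ∈ closedBall (0 : ℂ) 1) : ∃ w, Tendsto σ (𝓝[ball 0 1] v₀) (𝓝 w) := by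
  rcases (mem_closedBall_zero_iff.1 hv₀).lt_or_eq with h1 | h1
  · exact ⟨_, hσc v₀ (mem_ball_zero_iff.2 h1)⟩
  · obtain ⟨S, hS, hSU⟩ := h.exists_finite_limits h1
    refine exists_tendsto_of_finite_cluster (convex_ball 0 1) hb.isCompact_closure hσc
      (fun v hv => subset_closure (hσ v hv).1) ?_ hS fun w hw => ?_
    · rwa [closure_ball 0 one_ne_zero]
    · obtain ⟨U, hU, hUw⟩ := clusterPt_iff_ultrafilter.1 hw
      obtain ⟨h2, h3⟩ := le_nhdsWithin_and_tendsto_of_section hσ hU hUw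
      exact hSU U w h2 h3

end IsTypeDComponent

namespace IsTypeDComponent

variable {p q : ℕ} {H : Set (ℂ × ℂ)} {zpt : ℂ × ℂ → ℂ} (h : IsTypeDComponent p q H zpt)
include h

/-- Two boundary values of the inverse of the multiplier map that agree come from the same point of
the closed disk. -/
theorem eq_of_tendsto_section (hb : Bornology.IsBounded H) {σ : ℂ → ℂ × ℂ}
    (hσ : ∀ v ∈ ball (0 : ℂ) 1, σ v ∈ H ∧ cycleMultiplier q zpt (σ v) = v) {v₁ v₂ : ℂ}
    (hv₁ : v₁ ∈ closedBall (0 : ℂ) 1) (hv₂ : v₂ ∈ closedBall (0 : ℂ) 1) {w : ℂ × ℂ}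
    (h₁ : Tendsto σ (𝓝[ball 0 1] v₁) (𝓝 w)) (h₂ : Tendsto σ (𝓝[ball 0 1] v₂) (𝓝 w)) :
    v₁ = v₂ := by
  have key {v : ℂ} (hv : v ∈ closedBall (0 : ℂ) 1) (hw : Tendsto σ (𝓝[ball 0 1] v) (𝓝 w)) :
      ∃ U : Ultrafilter (ℂ × ℂ), (U : Filter (ℂ × ℂ)) ≤ 𝓝[H] w ∧
        Tendsto (cycleMultiplier q zpt) U (𝓝 v) := by
    have : (𝓝[ball 0 1] v).NeBot := by
      rwa [← mem_closure_iff_nhdsWithin_neBot, closure_ball 0 one_ne_zero]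
    exact ⟨Ultrafilter.of (map σ (𝓝[ball 0 1] v)),
      le_nhdsWithin_and_tendsto_of_section hσ (Ultrafilter.of_le _)
        ((Ultrafilter.of_le _).trans hw)⟩
  obtain ⟨U₁, hU₁, hm₁⟩ := key hv₁ h₁
  obtain ⟨U₂, hU₂, hm₂⟩ := key hv₂ h₂
  by_cases hwH : w ∈ H
  · have hc := h.continuousOn_cycleMultiplier w hwH
    exact (tendsto_nhds_unique hm₁ (hc.mono_left hU₁)).trans
      (tendsto_nhds_unique (hc.mono_left hU₂) hm₂)
  have hn {U : Ultrafilter (ℂ × ℂ)} {v : ℂ} (hv : v ∈ closedBall (0 : ℂ) 1)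
      (hU : (U : Filter (ℂ × ℂ)) ≤ 𝓝[H] w)
      (hm : Tendsto (cycleMultiplier q zpt) U (𝓝 v)) : ‖v‖ = 1 :=
    (mem_closedBall_zero_iff.1 hv).eq_of_not_lt fun hlt => hwH (h.mem_of_tendsto hb hU hm hlt)
  have hw : w ∈ closure H := mem_closure_iff_nhdsWithin_neBot.2 (U₁.neBot.mono hU₁)
  obtain ⟨R, hR1, hR⟩ := exists_cubic_escape_of_isBounded hb
  obtain ⟨z₁, hz₁, hd₁, -⟩ := h.exists_limit_point hb hU₁ hm₁
  obtain ⟨z₂, hz₂, hd₂, -⟩ := h.exists_limit_point hb hU₂ hm₂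
  rw [← hd₁, ← hd₂]
  exact not_two_neutral_cycles hR1 (hR w hw) h.pos.1 h.pos.2 (h.closure_subset_Sp hw).1 hz₁ hz₂
    (hd₁ ▸ hn hv₁ hU₁ hm₁) (hd₂ ▸ hn hv₂ hU₂ hm₂)

/-- The inverse of the multiplier map extends to a continuous bijection from the closed disk onto
`closure H`. -/
theorem exists_extended_inverse (hb : Bornology.IsBounded H) : ∃ ι : ℂ → ℂ × ℂ,
    ContinuousOn ι (closedBall 0 1) ∧ BijOn ι (closedBall 0 1) (closure H) ∧
      BijOn ι (ball 0 1) H ∧ ∀ w ∈ H, ι (cycleMultiplier q zpt w) = w := by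
  obtain ⟨σ, hσc, hσ, hσinv⟩ := h.exists_inverse hb
  have hlim (v : ℂ) (hv : v ∈ closedBall (0 : ℂ) 1) :
      Tendsto σ (𝓝[ball 0 1] v) (𝓝 (extendFrom (ball 0 1) σ v)) :=
    tendsto_extendFrom (h.exists_tendsto_section hb hσc hσ hv)
  have hcl : closure (ball (0 : ℂ) 1) = closedBall 0 1 := closure_ball 0 one_ne_zero
  have heq (v : ℂ) (hv : v ∈ ball (0 : ℂ) 1) : extendFrom (ball 0 1) σ v = σ v :=
    extendFrom_eq (subset_closure hv) (hσc v hv)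
  have hcont : ContinuousOn (extendFrom (ball 0 1) σ) (closedBall 0 1) :=
    continuousOn_extendFrom hcl.ge fun v hv => h.exists_tendsto_section hb hσc hσ hv
  have hinv (w : ℂ × ℂ) (hw : w ∈ H) : extendFrom (ball 0 1) σ (cycleMultiplier q zpt w) = w :=
    (heq _ (h.mapsTo_cycleMultiplier hw)).trans (hσinv w hw)
  have hinj : InjOn (extendFrom (ball 0 1) σ) (closedBall 0 1) := fun v₁ hv₁ v₂ hv₂ h12 =>
    h.eq_of_tendsto_section hb hσ hv₁ hv₂ (hlim v₁ hv₁) (h12 ▸ hlim v₂ hv₂)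
  refine ⟨extendFrom (ball 0 1) σ, hcont, ⟨fun v hv => ?_, hinj, ?_⟩,
    ⟨fun v hv => ?_, hinj.mono ball_subset_closedBall, fun w hw => ?_⟩, hinv⟩
  · have : (𝓝[ball 0 1] v).NeBot := by
      rwa [← mem_closure_iff_nhdsWithin_neBot, hcl]
    refine mem_closure_of_tendsto (hlim v hv) ?_
    filter_upwards [self_mem_nhdsWithin] with u hu using (hσ u hu).1
  · refine closure_minimal (fun w hw => ?_)
      ((isCompact_closedBall 0 1).image_of_continuousOn hcont).isClosed
    exact ⟨_, ball_subset_closedBall (h.mapsTo_cycleMultiplier hw), hinv w hw⟩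
  · rw [heq v hv]
    exact (hσ v hv).1
  · exact ⟨_, h.mapsTo_cycleMultiplier hw, hinv w hw⟩

theorem bijOn_cycleMultiplier (hb : Bornology.IsBounded H) :
    BijOn (cycleMultiplier q zpt) H (ball 0 1) := by
  obtain ⟨σ, -, hσ, hσinv⟩ := h.exists_inverse hb
  exact ⟨h.mapsTo_cycleMultiplier, LeftInvOn.injOn hσinv, fun v hv => ⟨σ v, hσ v hv⟩⟩

end IsTypeDComponent

/-- The inverse of a continuous injection on a compact set is continuous on the image. -/
theorem IsCompact.continuousOn_invFunOn {X Y : Type*} [TopologicalSpace X] [TopologicalSpace Y]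
    [T2Space Y] [Nonempty X] {K : Set X} (hK : IsCompact K) {f : X → Y} (hf : ContinuousOn f K)
    (hinj : InjOn f K) : ContinuousOn (invFunOn f K) (f '' K) := by
  rw [continuousOn_iff_isClosed]
  intro C hC
  refine ⟨f '' (K ∩ C), ?_, ?_⟩
  · exact ((hK.inter_right hC).image_of_continuousOn (hf.mono inter_subset_left)).isClosed
  · ext y
    constructor
    · rintro ⟨hyC, x, hx, rfl⟩
      rw [mem_preimage, hinj.leftInvOn_invFunOn hx] at hyC
      exact ⟨⟨x, ⟨hx, hyC⟩, rfl⟩, x, hx, rfl⟩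
    · rintro ⟨⟨x, ⟨hx, hxC⟩, rfl⟩, -⟩
      refine ⟨?_, x, hx, rfl⟩
      rwa [mem_preimage, hinj.leftInvOn_invFunOn hx]

theorem isTypeDComponent_of_isHyperbolicComponent {p q : ℕ} {H : Set (ℂ × ℂ)} (hp : 1 ≤ p)
    (hH : IsHyperbolicComponent p H) (hq : 0 < q) {zpt : ℂ × ℂ → ℂ}
    (htypeD : ∀ w ∈ H,
      (cubic w.1 w.2)^[q] (zpt w) = zpt w ∧
      (∀ j, 0 < j → j < q → (cubic w.1 w.2)^[j] (zpt w) ≠ zpt w) ∧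
      ‖deriv ((cubic w.1 w.2)^[q]) (zpt w)‖ < 1 ∧
      Tendsto (fun k => (cubic w.1 w.2)^[q * k] (-w.1)) atTop (𝓝 (zpt w)) ∧
      ∀ k, k < p → zpt w ≠ (cubic w.1 w.2)^[k] w.1) : IsTypeDComponent p q H zpt where
  isHyperbolicComponent := hH
  isTypeDPoint w hw := by
    obtain ⟨h1, h2, h3, h4, h5⟩ := htypeD w hw
    have hSp : w ∈ Sp p := by
      obtain ⟨w₀, -, rfl⟩ := hH
      exact (connectedComponentIn_subset _ _ hw).1
    exact ⟨hp, hq, hSp.1, hSp.2, h1, h2, h3, h4, h5⟩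

/-- On a bounded Type D hyperbolic component `H` of `S_p`, with second
attracting cycle of period `q` through the point `zpt w ∈ U_{c,a}(-c)`, the multiplier
map `ρ(c,a) = (f_{c,a}^q)'(z_{c,a})` is a conformal isomorphism onto the unit disk and
extends to a homeomorphism from the closure of `H` onto the closed unit disk; in
particular `∂H` is a Jordan curve. -/
theorem typeD_multiplier_is_conformal_iso
    (p : ℕ) (hp : 1 ≤ p) (H : Set (ℂ × ℂ))
    (hH : IsHyperbolicComponent p H) (hb : Bornology.IsBounded H)
    (q : ℕ) (hq : 0 < q) (zpt : ℂ × ℂ → ℂ)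
    (htypeD : ∀ w ∈ H,
      zpt w ∈ fatouComponent (cubic w.1 w.2) (-w.1) ∧
      (cubic w.1 w.2)^[q] (zpt w) = zpt w ∧
      (∀ j, 0 < j → j < q → (cubic w.1 w.2)^[j] (zpt w) ≠ zpt w) ∧
      ‖deriv ((cubic w.1 w.2)^[q]) (zpt w)‖ < 1 ∧
      Tendsto (fun k => (cubic w.1 w.2)^[q * k] (-w.1)) atTop (𝓝 (zpt w)) ∧
      ∀ k, k < p → zpt w ≠ (cubic w.1 w.2)^[k] w.1) :
    (ContinuousOn (fun w => deriv ((cubic w.1 w.2)^[q]) (zpt w)) H ∧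
      AnalyticOnSlice (fun w => deriv ((cubic w.1 w.2)^[q]) (zpt w)) H ∧
      BijOn (fun w => deriv ((cubic w.1 w.2)^[q]) (zpt w)) H (ball (0 : ℂ) 1)) ∧
    (∃ ρ' : ℂ × ℂ → ℂ, ContinuousOn ρ' (closure H) ∧
      (∀ w ∈ H, ρ' w = deriv ((cubic w.1 w.2)^[q]) (zpt w)) ∧
      BijOn ρ' (closure H) (closedBall (0 : ℂ) 1) ∧
      ∃ ι : ℂ → ℂ × ℂ, ContinuousOn ι (closedBall (0 : ℂ) 1) ∧
        (∀ v ∈ closedBall (0 : ℂ) 1, ι v ∈ closure H ∧ ρ' (ι v) = v) ∧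
        ∀ w ∈ closure H, ι (ρ' w) = w) ∧
    IsJordanCurve (closure H \ H) := by
  have h := isTypeDComponent_of_isHyperbolicComponent hp hH hq fun w hw => (htypeD w hw).2
  obtain ⟨ι, hι, hbij, hbijH, hιinv⟩ := h.exists_extended_inverse hb
  refine ⟨⟨h.continuousOn_cycleMultiplier, h.analyticOnSlice, h.bijOn_cycleMultiplier hb⟩,
    ⟨invFunOn ι (closedBall 0 1), ?_, fun w hw => ?_, (bijOn_comm hbij.invOn_invFunOn.symm).1 hbij,
      ι, hι, fun v hv => ⟨hbij.mapsTo hv, hbij.injOn.leftInvOn_invFunOn hv⟩,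
      fun w hw => hbij.surjOn.rightInvOn_invFunOn hw⟩, ?_⟩
  · rw [← hbij.image_eq]
    exact (isCompact_closedBall 0 1).continuousOn_invFunOn hι hbij.injOn
  · change _ = cycleMultiplier q zpt w
    have h1 := hbij.injOn.leftInvOn_invFunOn
      (ball_subset_closedBall (h.mapsTo_cycleMultiplier hw))
    rwa [hιinv w hw] at h1
  · refine ⟨fun v => ι v, hι.comp_continuous continuous_subtype_val
      fun v => sphere_subset_closedBall v.2, fun v₁ v₂ h12 => Subtype.ext (hbij.injOn
        (sphere_subset_closedBall v₁.2) (sphere_subset_closedBall v₂.2) h12), ?_⟩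
    rw [← hbij.image_eq, ← hbijH.image_eq, ← hbij.injOn.image_sdiff_subset ball_subset_closedBall,
      closedBall_sdiff_ball, image_eq_range]
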